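/- arXiv:2305.03818 — 2 statements merged into one kernel-verified Lean document; each statement's English description precedes it below -/
import Mathlib

section
/- Let k ≥ 2, q ≥ 1 and 2 ≤ t ≤ 2^q be integers and let d = 2^q·(k+1) − t. For any 2^{q+1} − 2 masses μ_1, …, μ_{2^{q+1}−2} on ℝ^d there exist k pairwise orthogonal hyperplanes H_1, …, H_k in ℝ^d such that (i) any two of H_1, …, H_k equipartition each of the first 2^{q+1} − t masses μ_1, …, μ_{2^{q+1}−t}, and (ii) any two of H_2, …, H_k equipartition each of the remaining t − 2 masses μ_{2^{q+1}−t+1}, …, μ_{2^{q+1}−2}. -/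
open MeasureTheory RealInnerProductSpace

noncomputable section

/-- The closed half-space determined by the hyperplane `{x | ⟪a, x⟫ = b}`:
`true` corresponds to `H⁺ = {x | ⟪a, x⟫ ≥ b}`, `false` to `H⁻ = {x | ⟪a, x⟫ ≤ b}`. -/
def halfSpace {d : ℕ} (a : EuclideanSpace ℝ (Fin d)) (b : ℝ) (ε : Bool) :
    Set (EuclideanSpace ℝ (Fin d)) :=
  if ε then {x | b ≤ ⟪a, x⟫} else {x | ⟪a, x⟫ ≤ b}

/-- The region `⋂ i ∈ s, H i ^ (ε i)` determined by the hyperplanes indexed by `s`. -/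
def region {d k : ℕ} (a : Fin k → EuclideanSpace ℝ (Fin d)) (b : Fin k → ℝ)
    (s : Finset (Fin k)) (ε : Fin k → Bool) : Set (EuclideanSpace ℝ (Fin d)) :=
  ⋂ i ∈ s, halfSpace (a i) (b i) (ε i)

set_option linter.unusedSectionVars false
set_option linter.unusedSimpArgs false
set_option linter.unusedVariables false

namespace EquiTop

/-! ### Mod 2 cubical chains on the integer grid -/

variable {I : Type*} [Fintype I] [DecidableEq I]

/-- elementary boundary in direction `i` -/
def bd1 (i : I) (z : (I → ℤ) → ZMod 2) (p : I → ℤ) : ZMod 2 :=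
  if Even (p i) then z (p + Pi.single i 1) + z (p - Pi.single i 1) else 0

/-- total boundary -/
def bd (z : (I → ℤ) → ZMod 2) (p : I → ℤ) : ZMod 2 := ∑ i, bd1 i z p

lemma bd_add (z w : (I → ℤ) → ZMod 2) : bd (z + w) = bd z + bd w := by
  funext p
  simp only [bd, Pi.add_apply, ← Finset.sum_add_distrib]
  refine Finset.sum_congr rfl fun i _ => ?_
  unfold bd1
  split_ifs
  · simp only [Pi.add_apply]; ring
  · simp

lemma bd_zero : bd (0 : (I → ℤ) → ZMod 2) = 0 := by
  funext p; simp [bd, bd1]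

lemma bd_sum {α : Type*} (s : Finset α) (z : α → (I → ℤ) → ZMod 2) :
    bd (∑ a ∈ s, z a) = ∑ a ∈ s, bd (z a) := by
  classical
  induction s using Finset.induction_on with
  | empty => simp [bd_zero]
  | insert a s ha ih => rw [Finset.sum_insert ha, Finset.sum_insert ha, bd_add, ih]

lemma z2_add_self (x : ZMod 2) : x + x = 0 := CharTwo.add_self_eq_zero x

lemma bd1_bd1_self (i : I) (z : (I → ℤ) → ZMod 2) (p : I → ℤ) : bd1 i (bd1 i z) p = 0 := by
  have e1 : ¬ Even ((p + Pi.single i 1 : I → ℤ) i) ↔ Even (p i) := by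
    simp [Int.even_add_one]
  have e2 : ¬ Even ((p - Pi.single i 1 : I → ℤ) i) ↔ Even (p i) := by
    simp [Int.even_sub_one]
  unfold bd1
  split_ifs with h1 h2 h3 h3
  all_goals first | exact absurd h2 (e1.2 h1) | exact absurd h3 (e2.2 h1) | simp

lemma bd1_comm (i j : I) (z : (I → ℤ) → ZMod 2) (p : I → ℤ) :
    bd1 i (bd1 j z) p = bd1 j (bd1 i z) p := by
  by_cases hij : i = j
  · subst hij; rfl
  have e1 : ∀ q : I → ℤ, (q + Pi.single i 1 : I → ℤ) j = q j := fun q => by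
    simp [Pi.single_apply, Ne.symm hij]
  have e2 : ∀ q : I → ℤ, (q - Pi.single i 1 : I → ℤ) j = q j := fun q => by
    simp [Pi.single_apply, Ne.symm hij]
  have e3 : ∀ q : I → ℤ, (q + Pi.single j 1 : I → ℤ) i = q i := fun q => by
    simp [Pi.single_apply, hij]
  have e4 : ∀ q : I → ℤ, (q - Pi.single j 1 : I → ℤ) i = q i := fun q => by
    simp [Pi.single_apply, hij]
  unfold bd1
  simp only [e1, e2, e3, e4]
  split_ifs
  · rw [show p + Pi.single i 1 + Pi.single j 1 = p + Pi.single j 1 + Pi.single i (1:ℤ) by abel,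
      show p - Pi.single i 1 + Pi.single j 1 = p + Pi.single j 1 - Pi.single i (1:ℤ) by abel,
      show p + Pi.single i 1 - Pi.single j 1 = p - Pi.single j 1 + Pi.single i (1:ℤ) by abel,
      show p - Pi.single i 1 - Pi.single j 1 = p - Pi.single j 1 - Pi.single i (1:ℤ) by abel]
    ring
  all_goals simp

lemma bd1_sum {α : Type*} (i : I) (s : Finset α) (z : α → (I → ℤ) → ZMod 2) (p : I → ℤ) :
    bd1 i (fun q => ∑ a ∈ s, z a q) p = ∑ a ∈ s, bd1 i (z a) p := by
  unfold bd1
  split_ifs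
  · rw [Finset.sum_add_distrib]
  · simp

lemma bd_bd (z : (I → ℤ) → ZMod 2) : bd (bd z) = 0 := by
  funext p
  have : bd (bd z) p = ∑ i, ∑ j, bd1 i (bd1 j z) p := by
    unfold bd
    exact Finset.sum_congr rfl fun i _ => bd1_sum i _ _ p
  rw [this, ← Finset.sum_product', Pi.zero_apply]
  refine Finset.sum_involution (fun x _ => x.swap) ?_ ?_ ?_ ?_
  · rintro ⟨i, j⟩ _
    simp only [Prod.swap]
    rw [bd1_comm i j]; exact z2_add_self _
  · rintro ⟨i, j⟩ _ h
    simp only [Prod.swap, ne_eq, Prod.mk.injEq, not_and]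
    rintro rfl
    exact absurd (bd1_bd1_self _ _ _) h
  · simp
  · simp

/-- bounded support -/
def Bdd (z : (I → ℤ) → ZMod 2) : Prop := ∃ R : ℤ, ∀ p, z p ≠ 0 → ∀ i, |p i| ≤ R

lemma Bdd.finite {z : (I → ℤ) → ZMod 2} (h : Bdd z) : (Function.support z).Finite := by
  obtain ⟨R, hR⟩ := h
  refine (Set.finite_Icc (fun _ : I => -R) (fun _ => R)).subset fun p hp => ?_
  have := hR p hp
  exact ⟨fun i => (abs_le.1 (this i)).1, fun i => (abs_le.1 (this i)).2⟩

lemma bd_ne_zero {z : (I → ℤ) → ZMod 2} {p : I → ℤ} (h : bd z p ≠ 0) :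
    ∃ i, Even (p i) ∧ (z (p + Pi.single i 1) ≠ 0 ∨ z (p - Pi.single i 1) ≠ 0) := by
  obtain ⟨i, -, hi⟩ := Finset.exists_ne_zero_of_sum_ne_zero h
  refine ⟨i, ?_⟩
  unfold bd1 at hi
  split_ifs at hi with he
  · refine ⟨he, ?_⟩
    by_contra hc
    push Not at hc
    simp [hc.1, hc.2] at hi
  · exact absurd rfl hi

lemma Bdd.bd {z : (I → ℤ) → ZMod 2} (h : Bdd z) : Bdd (bd z) := by
  obtain ⟨R, hR⟩ := h
  refine ⟨R + 1, fun p hp j => ?_⟩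
  obtain ⟨i, -, hi⟩ := bd_ne_zero hp
  rcases hi with hi | hi
  · have := abs_le.1 (hR _ hi j)
    rw [Pi.add_apply, Pi.single_apply] at this
    rw [abs_le]; split_ifs at this <;> constructor <;> linarith [this.1, this.2]
  · have := abs_le.1 (hR _ hi j)
    rw [Pi.sub_apply, Pi.single_apply] at this
    rw [abs_le]; split_ifs at this <;> constructor <;> linarith [this.1, this.2]

lemma Bdd.mul {z : (I → ℤ) → ZMod 2} (h : Bdd z) (s : (I → ℤ) → ZMod 2) : Bdd (s * z) := by
  obtain ⟨R, hR⟩ := h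
  exact ⟨R, fun p hp => hR p (right_ne_zero_of_mul hp)⟩

lemma Bdd.add {z w : (I → ℤ) → ZMod 2} (h : Bdd z) (h' : Bdd w) : Bdd (z + w) := by
  obtain ⟨R, hR⟩ := h
  obtain ⟨R', hR'⟩ := h'
  refine ⟨max R R', fun p hp i => ?_⟩
  by_cases h0 : z p = 0
  · have : w p ≠ 0 := by rintro h1; apply hp; simp [h0, h1]
    exact (hR' p this i).trans (le_max_right _ _)
  · exact (hR p h0 i).trans (le_max_left _ _)

lemma Bdd.zero : Bdd (0 : (I → ℤ) → ZMod 2) := ⟨0, fun p hp => absurd rfl hp⟩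

lemma Bdd.sum {α : Type*} (s : Finset α) (z : α → (I → ℤ) → ZMod 2) (h : ∀ a ∈ s, Bdd (z a)) :
    Bdd (∑ a ∈ s, z a) := by
  classical
  induction s using Finset.induction_on with
  | empty => simpa using Bdd.zero
  | insert a s ha ih =>
    rw [Finset.sum_insert ha]
    exact (h a (by simp)).add (ih fun b hb => h b (by simp [hb]))

/-- the iterated cup product of the coboundaries of the labels, evaluated on `z` -/
def NN : List ((I → ℤ) → ZMod 2) → ((I → ℤ) → ZMod 2) → ZMod 2
  | [], z => ∑ᶠ p, z p
  | s :: ss, z => NN ss (s * bd z + bd (s * z))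

lemma NN_add (ss : List ((I → ℤ) → ZMod 2)) (z w : (I → ℤ) → ZMod 2) (hz : Bdd z) (hw : Bdd w) :
    NN ss (z + w) = NN ss z + NN ss w := by
  induction ss generalizing z w with
  | nil => exact finsum_add_distrib hz.finite hw.finite
  | cons s ss ih =>
    simp only [NN]
    rw [← ih _ _ ((hz.bd.mul s).add (hz.mul s).bd) ((hw.bd.mul s).add (hw.mul s).bd)]
    congr 1
    rw [bd_add, mul_add, mul_add, bd_add]; abel

lemma NN_zero (ss : List ((I → ℤ) → ZMod 2)) : NN ss 0 = 0 := by
  have := NN_add ss 0 0 Bdd.zero Bdd.zero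
  rw [add_zero] at this
  rw [this]; exact z2_add_self _

lemma NN_sum {α : Type*} (ss : List ((I → ℤ) → ZMod 2)) (s : Finset α)
    (z : α → (I → ℤ) → ZMod 2) (h : ∀ a ∈ s, Bdd (z a)) :
    NN ss (∑ a ∈ s, z a) = ∑ a ∈ s, NN ss (z a) := by
  classical
  induction s using Finset.induction_on with
  | empty => simpa using NN_zero ss
  | insert a s ha ih =>
    rw [Finset.sum_insert ha, Finset.sum_insert ha, NN_add _ _ _ (h a (by simp)),
      ih fun b hb => h b (by simp [hb])]
    exact Bdd.sum _ _ fun b hb => h b (by simp [hb])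

lemma finsum_bd1 (i : I) (z : (I → ℤ) → ZMod 2) (hz : Bdd z) : ∑ᶠ p, bd1 i z p = 0 := by
  let w : (I → ℤ) → ZMod 2 := fun p => if Even (p i) then 0 else z p
  have hw : Bdd w := by
    obtain ⟨R, hR⟩ := hz
    refine ⟨R, fun p hp => hR p fun h0 => hp ?_⟩
    simp [w, h0]
  have h1 : ∀ p, bd1 i z p = w (p + Pi.single i 1) + w (p - Pi.single i 1) := by
    intro p
    simp only [bd1, w, Pi.add_apply, Pi.sub_apply, Pi.single_eq_same, Int.even_add_one,
      Int.even_sub_one]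
    split_ifs <;> simp
  have f1 : (Function.support fun p => w (p + Pi.single i 1)).Finite :=
    hw.finite.preimage (f := fun p => p + Pi.single i 1)
      (add_left_injective (Pi.single i (1 : ℤ) : I → ℤ)).injOn
  have f2 : (Function.support fun p => w (p - Pi.single i 1)).Finite :=
    hw.finite.preimage (f := fun p => p - Pi.single i 1)
      (sub_left_injective (b := (Pi.single i (1 : ℤ) : I → ℤ))).injOn
  rw [finsum_congr h1, finsum_add_distrib f1 f2]
  have g1 : ∑ᶠ p : I → ℤ, w (p + Pi.single i 1) = ∑ᶠ p, w p :=
    finsum_comp_equiv (f := w) (Equiv.addRight (Pi.single i (1:ℤ) : I → ℤ))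
  have g2 : ∑ᶠ p : I → ℤ, w (p - Pi.single i 1) = ∑ᶠ p, w p :=
    finsum_comp_equiv (f := w) (Equiv.subRight (Pi.single i (1:ℤ) : I → ℤ))
  rw [g1, g2]; exact z2_add_self _

lemma Bdd.bd1 {z : (I → ℤ) → ZMod 2} (h : Bdd z) (i : I) : Bdd (bd1 i z) := by
  obtain ⟨R, hR⟩ := h
  refine ⟨R + 1, fun p hp j => ?_⟩
  have hi : z (p + Pi.single i 1) ≠ 0 ∨ z (p - Pi.single i 1) ≠ 0 := by
    by_contra hc
    push Not at hc
    simp [EquiTop.bd1, hc.1, hc.2] at hp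
  rcases hi with hi | hi
  · have := abs_le.1 (hR _ hi j)
    rw [Pi.add_apply, Pi.single_apply] at this
    rw [abs_le]; split_ifs at this <;> constructor <;> linarith [this.1, this.2]
  · have := abs_le.1 (hR _ hi j)
    rw [Pi.sub_apply, Pi.single_apply] at this
    rw [abs_le]; split_ifs at this <;> constructor <;> linarith [this.1, this.2]

lemma NN_bd (ss : List ((I → ℤ) → ZMod 2)) (z : (I → ℤ) → ZMod 2) (hz : Bdd z) :
    NN ss (bd z) = 0 := by
  induction ss generalizing z with
  | nil =>
    simp only [NN]
    unfold bd
    rw [finsum_sum_comm _ _ fun i _ => (hz.bd1 i).finite]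
    exact Finset.sum_eq_zero fun i _ => finsum_bd1 i z hz
  | cons s ss ih =>
    simp only [NN]
    rw [bd_bd, mul_zero, zero_add]
    exact ih _ (hz.bd.mul s)

lemma NN_cons (s : (I → ℤ) → ZMod 2) (ss : List ((I → ℤ) → ZMod 2)) (z : (I → ℤ) → ZMod 2)
    (hz : Bdd z) : NN (s :: ss) z = NN ss (s * bd z) := by
  simp only [NN]
  rw [NN_add _ _ _ (hz.bd.mul s) (hz.mul s).bd, NN_bd _ _ (hz.mul s), add_zero]

/-- extraction of sign changes -/
lemma NN_extract (ss : List ((I → ℤ) → ZMod 2)) (z : (I → ℤ) → ZMod 2) (h : NN ss z ≠ 0) :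
    ∃ p, z p ≠ 0 ∧ ∀ s ∈ ss, ∃ u v : I → ℤ, s u ≠ s v ∧ (∀ i, |u i - p i| ≤ ss.length) ∧
      (∀ i, |v i - p i| ≤ ss.length) := by
  induction ss generalizing z with
  | nil =>
    simp only [NN] at h
    obtain ⟨p, hp⟩ : ∃ p, z p ≠ 0 := by
      by_contra hc
      push Not at hc
      exact h (by rw [finsum_congr hc, finsum_zero])
    exact ⟨p, hp, by simp⟩
  | cons s ss ih =>
    simp only [NN] at h
    obtain ⟨p', hp', hs⟩ := ih _ h
    have key : ∃ p, z p ≠ 0 ∧ s p ≠ s p' ∧ ∀ i, |p' i - p i| ≤ 1 := by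
      by_contra hc
      push Not at hc
      apply hp'
      have hd : ∀ q, (∀ i, |p' i - q i| ≤ 1) → s p' * z q + s q * z q = 0 := by
        intro q hq
        by_cases hzq : z q = 0
        · simp [hzq]
        by_cases hsq : s q = s p'
        · rw [hsq]; exact z2_add_self _
        · obtain ⟨i, hi⟩ := hc q hzq hsq
          exact absurd (hq i) (not_le.2 hi)
      simp only [Pi.add_apply, Pi.mul_apply, bd, Finset.mul_sum, ← Finset.sum_add_distrib]
      refine Finset.sum_eq_zero fun i _ => ?_
      unfold bd1
      split_ifs
      · have h1 := hd (p' + Pi.single i 1) fun j => by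
          simp only [Pi.add_apply, Pi.single_apply]; split_ifs <;> simp
        have h2 := hd (p' - Pi.single i 1) fun j => by
          simp only [Pi.sub_apply, Pi.single_apply]; split_ifs <;> simp
        simp only [Pi.mul_apply]
        linear_combination h1 + h2
      · simp
    obtain ⟨p, hzp, hsp, hpp⟩ := key
    refine ⟨p, hzp, ?_⟩
    have tri : ∀ u : I → ℤ, (∀ i, |u i - p' i| ≤ ss.length) →
        ∀ i, |u i - p i| ≤ (s :: ss).length := by
      intro u hu i
      have := abs_sub_le (u i) (p' i) (p i)
      have h1 := hu i
      have h2 := hpp i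
      simp only [List.length_cons]
      push_cast
      linarith
    intro s' hs'
    rcases List.mem_cons.1 hs' with rfl | hs'
    · refine ⟨p, p', hsp, fun i => ?_, tri p' fun i => by simp⟩
      simp only [sub_self, abs_zero]; positivity
    · obtain ⟨u, v, h1, h2, h3⟩ := hs s' hs'
      exact ⟨u, v, h1, tri u h2, tri v h3⟩

end EquiTop

namespace EquiTop
variable {I : Type*} [Fintype I] [DecidableEq I]

/-- sign change of the coordinates in `S` -/
def flip (S : I → Prop) [DecidablePred S] (p : I → ℤ) : I → ℤ := fun x => if S x then - p x else p x

lemma flip_flip (S : I → Prop) [DecidablePred S] (p : I → ℤ) : flip S (flip S p) = p := by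
  funext x; unfold flip; split_ifs <;> simp

lemma bd_flip (S : I → Prop) [DecidablePred S] (z : (I → ℤ) → ZMod 2) (p : I → ℤ) :
    bd (fun q => z (flip S q)) p = bd z (flip S p) := by
  unfold bd
  refine Finset.sum_congr rfl fun i _ => ?_
  unfold bd1
  have he : Even (flip S p i) ↔ Even (p i) := by unfold flip; split_ifs <;> simp
  simp only [he]
  split_ifs with h
  · by_cases hS : S i
    · have e1 : flip S (p + Pi.single i 1) = flip S p - Pi.single i 1 := by
        funext x
        by_cases hx : x = i
        · subst hx; simp [flip, hS]; ring
        · simp [flip, hx]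
      have e2 : flip S (p - Pi.single i 1) = flip S p + Pi.single i 1 := by
        funext x
        by_cases hx : x = i
        · subst hx; simp [flip, hS]; ring
        · simp [flip, hx]
      rw [e1, e2, add_comm]
    · have e1 : flip S (p + Pi.single i 1) = flip S p + Pi.single i 1 := by
        funext x
        by_cases hx : x = i
        · subst hx; simp [flip, hS]
        · simp [flip, hx]
      have e2 : flip S (p - Pi.single i 1) = flip S p - Pi.single i 1 := by
        funext x
        by_cases hx : x = i
        · subst hx; simp [flip, hS]
        · simp [flip, hx]
      rw [e1, e2]
  · rfl

lemma Bdd.flip {z : (I → ℤ) → ZMod 2} (h : Bdd z) (S : I → Prop) [DecidablePred S] :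
    Bdd (fun p => z (flip S p)) := by
  obtain ⟨R, hR⟩ := h
  refine ⟨R, fun p hp i => ?_⟩
  have := hR _ hp i
  unfold EquiTop.flip at this
  split_ifs at this
  · simpa using this
  · exact this

lemma z2_cases (a : ZMod 2) : a = 0 ∨ a = 1 := by
  revert a; decide

/-- the set of cells on which all the blocks are on the boundary of the cube is closed. -/
def ClosedK (K : Set (I → ℤ)) : Prop :=
  ∀ (p : I → ℤ) i, Even (p i) → (p + Pi.single i 1 ∈ K ∨ p - Pi.single i 1 ∈ K) → p ∈ K

lemma NN_flip (S : I → Prop) [DecidablePred S] (K : Set (I → ℤ)) (hK : ClosedK K)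
    (ss : List ((I → ℤ) → ZMod 2))
    (hs : ∀ s ∈ ss, ∃ a : ZMod 2, ∀ p ∈ K, s (flip S p) = s p + a)
    (z : (I → ℤ) → ZMod 2) (hz : Bdd z) (hzK : ∀ p, z p ≠ 0 → p ∈ K) :
    NN ss (fun p => z (flip S p)) = NN ss z := by
  induction ss generalizing z with
  | nil =>
    simp only [NN]
    exact finsum_comp_equiv (f := z) (Equiv.mk (flip S) (flip S) (flip_flip S) (flip_flip S))
  | cons s ss ih =>
    rw [NN_cons _ _ _ (hz.flip S), NN_cons _ _ _ hz]
    have hbK : ∀ p, bd z p ≠ 0 → p ∈ K := by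
      intro p hp
      obtain ⟨i, he, hi⟩ := bd_ne_zero hp
      exact hK p i he (hi.imp (hzK _) (hzK _))
    obtain ⟨a, ha⟩ := hs s (by simp)
    have h1 : (s * bd fun p => z (flip S p)) =
        fun p => ((fun q => s (flip S q)) * bd z) (flip S p) := by
      funext p
      simp only [Pi.mul_apply, bd_flip, flip_flip]
    rw [h1, ih (fun s hs' => hs s (by simp [hs'])) _ (hz.bd.mul _)
      (fun p hp => hbK p (right_ne_zero_of_mul hp))]
    rcases z2_cases a with rfl | rfl
    · congr 1
      funext p
      simp only [Pi.mul_apply]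
      by_cases h0 : bd z p = 0
      · simp [h0]
      · rw [ha p (hbK p h0), add_zero]
    · have : ((fun q => s (flip S q)) * bd z) = s * bd z + bd z := by
        funext p
        simp only [Pi.mul_apply, Pi.add_apply]
        by_cases h0 : bd z p = 0
        · simp [h0]
        · rw [ha p (hbK p h0)]; ring
      rw [this, NN_add _ _ _ (hz.bd.mul _) hz.bd, NN_bd _ _ hz, add_zero]

/-- The induction step for the evaluation. -/
lemma NN_step {κ : Type*} [Fintype κ] (S : κ → I → Prop) [∀ i, DecidablePred (S i)]
    (K : Set (I → ℤ)) (hK : ClosedK K)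
    (s : (I → ℤ) → ZMod 2) (ss : List ((I → ℤ) → ZMod 2))
    (hss : ∀ s ∈ ss, ∀ i, ∃ a : ZMod 2, ∀ p ∈ K, s (flip (S i) p) = s p + a)
    (a : κ → ZMod 2) (ha : ∀ i, ∀ p ∈ K, s (flip (S i) p) = s p + a i)
    (z : (I → ℤ) → ZMod 2) (hz : Bdd z)
    (y : κ → (I → ℤ) → ZMod 2) (hy : ∀ i, Bdd (y i)) (hyK : ∀ i p, y i p ≠ 0 → p ∈ K)
    (hzy : bd z = ∑ i, (y i + fun p => y i (flip (S i) p))) :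
    NN (s :: ss) z = ∑ i, a i * NN ss (y i) := by
  rw [NN_cons _ _ _ hz, hzy, Finset.mul_sum, NN_sum]
  · refine Finset.sum_congr rfl fun i _ => ?_
    have h1 : (s * fun p => y i (flip (S i) p)) =
        fun p => ((fun q => s (flip (S i) q)) * y i) (flip (S i) p) := by
      funext p
      simp only [Pi.mul_apply, flip_flip]
    have h2 : NN ss (s * fun p => y i (flip (S i) p)) =
        NN ss ((fun q => s (flip (S i) q)) * y i) := by
      rw [h1]
      exact NN_flip (S i) K hK ss (fun s hs => hss s hs i) _ ((hy i).mul _)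
        (fun p hp => hyK i p (right_ne_zero_of_mul hp))
    rw [mul_add, NN_add _ _ _ ((hy i).mul _) (((hy i).flip _).mul _), h2,
      ← NN_add _ _ _ ((hy i).mul _) ((hy i).mul _)]
    have h3 : s * y i + (fun q => s (flip (S i) q)) * y i = fun p => a i * y i p := by
      funext p
      simp only [Pi.mul_apply, Pi.add_apply]
      by_cases h0 : y i p = 0
      · simp [h0]
      · rw [ha i p (hyK i p h0)]
        linear_combination z2_add_self (s p * y i p)
    rw [h3]
    rcases z2_cases (a i) with h | h
    · simp only [h, zero_mul]; exact NN_zero ss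
    · simp only [h, one_mul]
  · intro i _
    exact ((hy i).add ((hy i).flip _)).mul _

/-! ### Product functions -/

/-- one-dimensional boundary -/
def bd0 (f : ℤ → ZMod 2) (x : ℤ) : ZMod 2 := if Even x then f (x + 1) + f (x - 1) else 0

lemma bd_prod (φ : I → ℤ → ZMod 2) (p : I → ℤ) :
    bd (fun q => ∏ l, φ l (q l)) p =
      ∑ l, bd0 (φ l) (p l) * ∏ l' ∈ Finset.univ.erase l, φ l' (p l') := by
  unfold bd
  refine Finset.sum_congr rfl fun i _ => ?_
  unfold bd1 bd0
  have h : ∀ q : I → ℤ, (∀ l, l ≠ i → q l = p l) →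
      ∏ l, φ l (q l) = φ i (q i) * ∏ l' ∈ Finset.univ.erase i, φ l' (p l') := by
    intro q hq
    rw [← Finset.mul_prod_erase Finset.univ _ (Finset.mem_univ i)]
    congr 1
    refine Finset.prod_congr rfl fun l hl => ?_
    rw [hq l (Finset.ne_of_mem_erase hl)]
  split_ifs
  · beta_reduce
    rw [h (p + Pi.single i 1) (fun l hl => by simp [hl]),
      h (p - Pi.single i 1) (fun l hl => by simp [hl])]
    simp only [Pi.add_apply, Pi.sub_apply, Pi.single_eq_same]
    ring
  · simp

lemma bd_blockprod {κ ι : Type*} [Fintype κ] [DecidableEq κ] [Fintype ι] [DecidableEq ι]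
    (f : κ → (ι → ℤ) → ZMod 2) (p : κ × ι → ℤ) :
    bd (fun q : κ × ι → ℤ => ∏ i, f i (fun l => q (i, l))) p =
      ∑ i, bd (f i) (fun l => p (i, l)) *
        ∏ i' ∈ Finset.univ.erase i, f i' (fun l => p (i', l)) := by
  unfold bd
  rw [Fintype.sum_prod_type]
  refine Finset.sum_congr rfl fun i _ => ?_
  rw [Finset.sum_mul]
  refine Finset.sum_congr rfl fun l _ => ?_
  have h : ∀ q : κ × ι → ℤ, (∀ i' l', i' ≠ i → q (i', l') = p (i', l')) →
      ∏ i', f i' (fun l => q (i', l)) = f i (fun l => q (i, l)) *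
        ∏ i' ∈ Finset.univ.erase i, f i' (fun l => p (i', l)) := by
    intro q hq
    rw [← Finset.mul_prod_erase Finset.univ _ (Finset.mem_univ i)]
    congr 1
    refine Finset.prod_congr rfl fun i' hi' => ?_
    congr 1
    funext l'
    exact hq i' l' (Finset.ne_of_mem_erase hi')
  unfold bd1
  split_ifs
  · beta_reduce
    rw [h (p + Pi.single (i, l) 1) (fun i' l' hl => by simp [hl]),
      h (p - Pi.single (i, l) 1) (fun i' l' hl => by simp [hl])]
    have e1 : (fun l' => (p + Pi.single (i, l) 1 : κ × ι → ℤ) (i, l')) =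
        (fun l' => p (i, l')) + Pi.single l 1 := by
      funext l'
      simp [Pi.single_apply]
    have e2 : (fun l' => (p - Pi.single (i, l) 1 : κ × ι → ℤ) (i, l')) =
        (fun l' => p (i, l')) - Pi.single l 1 := by
      funext l'
      simp [Pi.single_apply]
    rw [e1, e2]
    ring
  · simp

end EquiTop

namespace EquiTop

/-! ### The sphere chains -/

/-- all the edges of `[-L, L]` -/
def cA (L x : ℤ) : ZMod 2 := if Odd x ∧ |x| < L then 1 else 0
/-- all the edges of `[0, L]` -/
def cB (L x : ℤ) : ZMod 2 := if Odd x ∧ 0 < x ∧ x < L then 1 else 0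
/-- the point `0` -/
def cO (x : ℤ) : ZMod 2 := if x = 0 then 1 else 0

lemma bd0_cO (x : ℤ) : bd0 cO x = 0 := by
  unfold bd0 cO
  split_ifs with h h1 h2 h3
  all_goals first | rfl | (exfalso; rw [Int.even_iff] at h; omega)

lemma bd0_cA (L x : ℤ) (hL : Even L) (h : |x| ≠ L) : bd0 (cA L) x = 0 := by
  unfold bd0
  split_ifs with hx
  · have : cA L (x + 1) = cA L (x - 1) := by
      unfold cA
      congr 1
      rw [eq_iff_iff, abs_lt, abs_lt]
      rw [Int.odd_iff, Int.odd_iff]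
      rw [Int.even_iff] at hx hL
      rcases abs_cases x with ⟨h1, h2⟩ | ⟨h1, h2⟩ <;> rw [h1] at h <;> omega
    rw [this]; exact z2_add_self _
  · rfl

lemma bd0_cB (L x : ℤ) (hL : Even L) (hL0 : 0 < L) :
    bd0 (cB L) x = cO x + if x = L then 1 else 0 := by
  unfold bd0 cO
  rw [Int.even_iff] at hL
  simp only [Int.even_iff]
  by_cases hx : x % 2 = 0
  · rw [if_pos hx]
    unfold cB
    simp only [Int.odd_iff]
    by_cases h0 : x = 0
    · rw [if_pos (by omega), if_neg (by omega), if_pos h0, if_neg (by omega)]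
    by_cases h1 : x = L
    · rw [if_neg (by omega), if_pos (by omega), if_neg h0, if_pos h1]
    · rw [if_neg h0, if_neg h1]
      by_cases h2 : 0 < x ∧ x < L
      · rw [if_pos (by omega), if_pos (by omega)]; rfl
      · rw [if_neg (by omega), if_neg (by omega)]
  · rw [if_neg hx, if_neg (by omega), if_neg (by omega)]; rfl

lemma cA_eq (L x : ℤ) : cA L x = cB L x + cB L (-x) := by
  unfold cA cB
  simp only [abs_lt, Int.odd_iff]
  by_cases h : x % 2 = 1
  · by_cases h1 : 0 < x
    · by_cases h2 : x < L
      · rw [if_pos (by omega), if_pos (by omega), if_neg (by omega)]; rfl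
      · rw [if_neg (by omega), if_neg (by omega), if_neg (by omega)]; rfl
    · by_cases h2 : -L < x
      · rw [if_pos (by omega), if_neg (by omega), if_pos (by omega)]; rfl
      · rw [if_neg (by omega), if_neg (by omega), if_neg (by omega)]; rfl
  · rw [if_neg (by omega), if_neg (by omega), if_neg (by omega)]; rfl

lemma cA_neg (L x : ℤ) : cA L (-x) = cA L x := by
  unfold cA; simp

lemma cO_neg (x : ℤ) : cO (-x) = cO x := by
  unfold cO; simp

variable {D : ℕ}

def phQ (L : ℤ) (j : ℕ) (l : Fin D) : ℤ → ZMod 2 :=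
  if (l : ℕ) < j then cA L else if (l : ℕ) = j then cB L else cO

def phE (L : ℤ) (j : ℕ) (l : Fin D) : ℤ → ZMod 2 :=
  if (l : ℕ) < j then cA L else cO

def chQ (L : ℤ) (j : ℕ) (x : Fin D → ℤ) : ZMod 2 := ∏ l, phQ L j l (x l)
def chE (L : ℤ) (j : ℕ) (x : Fin D → ℤ) : ZMod 2 := ∏ l, phE L j l (x l)

/-- the hemisphere of dimension `j` -/
def zeta (L : ℤ) (j : ℕ) : (Fin D → ℤ) → ZMod 2 := bd (chQ L j) + chE L j

lemma phE_neg (L : ℤ) (j : ℕ) (l : Fin D) (x : ℤ) : phE L j l (-x) = phE L j l x := by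
  unfold phE; split_ifs
  · exact cA_neg L x
  · exact cO_neg x

lemma chE_neg (L : ℤ) (j : ℕ) (x : Fin D → ℤ) : chE L j (-x) = chE L j x := by
  unfold chE
  exact Finset.prod_congr rfl fun l _ => phE_neg L j l (x l)

lemma prod_split (φ : Fin D → ℤ → ZMod 2) (j : Fin D) (x : Fin D → ℤ) :
    ∏ l, φ l (x l) = φ j (x j) * ∏ l ∈ Finset.univ.erase j, φ l (x l) :=
  (Finset.mul_prod_erase Finset.univ _ (Finset.mem_univ j)).symm

lemma phQ_of_ne (L : ℤ) (j l : Fin D) (h : l ≠ j) : phQ L j l = phE L j l := by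
  have : (l : ℕ) ≠ j := fun h' => h (Fin.ext h')
  unfold phQ phE; simp [this]

lemma phE_succ_of_ne (L : ℤ) (j l : Fin D) (h : l ≠ j) : phE L (j + 1) l = phE L j l := by
  have : (l : ℕ) ≠ j := fun h' => h (Fin.ext h')
  unfold phE
  have : (l : ℕ) < j + 1 ↔ (l : ℕ) < j := by omega
  simp only [this]

lemma chE_succ (L : ℤ) (j : Fin D) (x : Fin D → ℤ) :
    chE L (j + 1) x = chQ L j x + chQ L j (-x) := by
  unfold chE chQ
  rw [prod_split _ j, prod_split _ j, prod_split _ j]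
  have h1 : ∏ l ∈ Finset.univ.erase j, phE L (j + 1) l (x l) =
      ∏ l ∈ Finset.univ.erase j, phE L j l (x l) :=
    Finset.prod_congr rfl fun l hl => by rw [phE_succ_of_ne L j l (Finset.ne_of_mem_erase hl)]
  have h2 : ∏ l ∈ Finset.univ.erase j, phQ L j l (x l) =
      ∏ l ∈ Finset.univ.erase j, phE L j l (x l) :=
    Finset.prod_congr rfl fun l hl => by rw [phQ_of_ne L j l (Finset.ne_of_mem_erase hl)]
  have h3 : ∏ l ∈ Finset.univ.erase j, phQ L j l ((-x) l) =
      ∏ l ∈ Finset.univ.erase j, phE L j l (x l) :=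
    Finset.prod_congr rfl fun l hl => by
      rw [phQ_of_ne L j l (Finset.ne_of_mem_erase hl), Pi.neg_apply, phE_neg]
  rw [h1, h2, h3]
  have h4 : phE L (j + 1) j = cA L := by simp [phE]
  have h5 : phQ L j j = cB L := by simp [phQ]
  rw [h4, h5, cA_eq, Pi.neg_apply]; ring

lemma bd_neg (z : (Fin D → ℤ) → ZMod 2) (x : Fin D → ℤ) :
    bd (fun y => z (-y)) x = bd z (-x) := by
  have := bd_flip (fun _ : Fin D => True) z x
  have h : ∀ y : Fin D → ℤ, flip (fun _ => True) y = -y := fun y => by funext l; simp [flip]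
  simpa only [h] using this

lemma bd_zeta_succ (L : ℤ) (j : Fin D) (x : Fin D → ℤ) :
    bd (zeta L (j + 1)) x = zeta L j x + zeta L j (-x) := by
  unfold zeta
  have h : (chE L (j + 1) : (Fin D → ℤ) → ZMod 2) = chQ L j + fun x => chQ L j (-x) := by
    funext x; exact chE_succ L j x
  rw [bd_add, bd_bd, zero_add, h, bd_add]
  simp only [Pi.add_apply, bd_neg, chE_neg]
  linear_combination - z2_add_self (chE L j x)

lemma bd_zeta_zero (L : ℤ) (x : Fin D → ℤ) : bd (zeta L 0) x = 0 := by
  unfold zeta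
  rw [bd_add, bd_bd, zero_add]
  have : (chE L 0 : (Fin D → ℤ) → ZMod 2) = fun q => ∏ l, phE L 0 l (q l) := rfl
  rw [this, bd_prod]
  refine Finset.sum_eq_zero fun l _ => ?_
  have : phE L 0 l = cO := by simp [phE]
  rw [this, bd0_cO, zero_mul]

lemma zeta_formula (L : ℤ) (hL : Even L) (hL0 : 0 < L) (j : Fin D) (x : Fin D → ℤ) :
    zeta L j x = (if x j = L then 1 else 0) * ∏ l ∈ Finset.univ.erase j, phE L j l (x l) +
      ∑ l ∈ Finset.univ.erase j, bd0 (phE L j l) (x l) *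
        ∏ l' ∈ Finset.univ.erase l, phQ L j l' (x l') := by
  unfold zeta
  have h0 : (chQ L j : (Fin D → ℤ) → ZMod 2) = fun q => ∏ l, phQ L j l (q l) := rfl
  rw [Pi.add_apply, h0, bd_prod]
  unfold chE
  rw [prod_split _ j, ← Finset.add_sum_erase Finset.univ _ (Finset.mem_univ j)]
  have h2 : ∏ l ∈ Finset.univ.erase j, phQ L j l (x l) =
      ∏ l ∈ Finset.univ.erase j, phE L j l (x l) :=
    Finset.prod_congr rfl fun l hl => by rw [phQ_of_ne L j l (Finset.ne_of_mem_erase hl)]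
  have h3 : ∑ l ∈ Finset.univ.erase j, bd0 (phQ L j l) (x l) *
        ∏ l' ∈ Finset.univ.erase l, phQ L j l' (x l') =
      ∑ l ∈ Finset.univ.erase j, bd0 (phE L j l) (x l) *
        ∏ l' ∈ Finset.univ.erase l, phQ L j l' (x l') :=
    Finset.sum_congr rfl fun l hl => by rw [phQ_of_ne L j l (Finset.ne_of_mem_erase hl)]
  have h4 : phE L j j = cO := by simp [phE]
  have h5 : phQ L j j = cB L := by simp [phQ]
  rw [h3, h2, h4, h5, bd0_cB L _ hL hL0]
  linear_combination z2_add_self (cO (x j) * ∏ l ∈ Finset.univ.erase j, phE L j l (x l))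

lemma zeta_support (L : ℤ) (hL : Even L) (hL0 : 0 < L) (j : Fin D) (x : Fin D → ℤ)
    (h : zeta L j x ≠ 0) : ∃ l, |x l| = L := by
  by_contra hc
  push Not at hc
  apply h
  rw [zeta_formula L hL hL0]
  have : x j ≠ L := fun h' => hc j (by rw [h']; exact abs_of_pos hL0)
  rw [if_neg this, zero_mul, zero_add]
  refine Finset.sum_eq_zero fun l hl => ?_
  have : bd0 (phE L j l) (x l) = 0 := by
    unfold phE
    split_ifs
    · exact bd0_cA L _ hL (hc l)
    · exact bd0_cO _
  rw [this, zero_mul]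

lemma zeta_zero (L : ℤ) (hL : Even L) (hL0 : 0 < L) (x : Fin (D + 1) → ℤ) :
    zeta L 0 x = if x = Pi.single 0 L then 1 else 0 := by
  have := zeta_formula L hL hL0 0 x
  rw [Fin.val_zero] at this
  rw [this, Finset.sum_eq_zero, add_zero]
  · have hE : ∀ l : Fin (D + 1), phE L 0 l = cO := fun l => by simp [phE]
    simp only [hE]
    split_ifs with h1 h2 h2
    · rw [one_mul]
      refine Finset.prod_eq_one fun l hl => ?_
      rw [h2]
      simp [cO, Finset.ne_of_mem_erase hl]
    · rw [one_mul]
      obtain ⟨l, hl⟩ : ∃ l, x l ≠ (Pi.single 0 L : Fin (D + 1) → ℤ) l := by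
        by_contra hc
        push Not at hc
        exact h2 (funext hc)
      have hl0 : l ≠ 0 := by
        rintro rfl
        simp [h1] at hl
      refine Finset.prod_eq_zero (Finset.mem_erase.2 ⟨hl0, Finset.mem_univ l⟩) ?_
      have : x l ≠ 0 := by simpa [hl0] using hl
      simp [cO, this]
    · exact absurd (by rw [h2]; simp) h1
    · simp
  · intro l hl
    have : phE L 0 l = cO := by simp [phE]
    rw [this, bd0_cO, zero_mul]

lemma ph_bdd (L : ℤ) (hL0 : 0 < L) (x : ℤ) : (cA L x ≠ 0 → |x| ≤ L) ∧ (cB L x ≠ 0 → |x| ≤ L) ∧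
    (cO x ≠ 0 → |x| ≤ L) := by
  refine ⟨fun h => ?_, fun h => ?_, fun h => ?_⟩
  · unfold cA at h
    split_ifs at h with h1
    · exact h1.2.le
    · exact absurd rfl h
  · unfold cB at h
    split_ifs at h with h1
    · rw [abs_le]; constructor <;> linarith [h1.2.1, h1.2.2]
    · exact absurd rfl h
  · unfold cO at h
    split_ifs at h with h1
    · rw [h1]; simp [hL0.le]
    · exact absurd rfl h

lemma zeta_bdd (L : ℤ) (hL0 : 0 < L) (j : ℕ) : Bdd (zeta L j : (Fin D → ℤ) → ZMod 2) := by
  have hQ : Bdd (chQ L j : (Fin D → ℤ) → ZMod 2) := by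
    refine ⟨L, fun x hx l => ?_⟩
    have h := Finset.prod_ne_zero_iff.1 hx l (Finset.mem_univ l)
    unfold phQ at h
    split_ifs at h
    · exact (ph_bdd L hL0 _).1 h
    · exact (ph_bdd L hL0 _).2.1 h
    · exact (ph_bdd L hL0 _).2.2 h
  have hE : Bdd (chE L j : (Fin D → ℤ) → ZMod 2) := by
    refine ⟨L, fun x hx l => ?_⟩
    have h := Finset.prod_ne_zero_iff.1 hx l (Finset.mem_univ l)
    unfold phE at h
    split_ifs at h
    · exact (ph_bdd L hL0 _).1 h
    · exact (ph_bdd L hL0 _).2.2 h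
  exact hQ.bd.add hE

/-! ### Products of spheres -/

variable {κ : Type*} [Fintype κ] [DecidableEq κ]

/-- product of hemispheres -/
def ZZ (L : ℤ) (e : κ →₀ ℕ) (p : κ × Fin (D + 1) → ℤ) : ZMod 2 :=
  ∏ i, zeta L (e i) (fun l => p (i, l))

/-- flipping a block -/
abbrev blk (i : κ) (x : κ × Fin (D + 1)) : Prop := x.1 = i

def KK (L : ℤ) : Set (κ × Fin (D + 1) → ℤ) := {p | ∀ i, ∃ l, |p (i, l)| = L}

lemma closedKK (L : ℤ) (hL : Even L) : ClosedK (KK L : Set (κ × Fin (D + 1) → ℤ)) := by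
  intro p x hx hp i
  have key : ∀ q : κ × Fin (D + 1) → ℤ, q ∈ KK L → (∀ y, y ≠ x → q y = p y) → ¬ Even (q x) →
      ∃ l, |p (i, l)| = L := by
    intro q hq hqp hqx
    obtain ⟨l, hl⟩ := hq i
    refine ⟨l, ?_⟩
    rw [← hl]
    by_cases hil : (i, l) = x
    · exfalso
      apply hqx
      rw [← hil, ← even_abs, hl]; exact hL
    · rw [hqp _ hil]
  rcases hp with hp | hp
  · refine key _ hp (fun y hy => by simp [hy]) ?_
    simp [Int.even_add_one, hx]
  · refine key _ hp (fun y hy => by simp [hy]) ?_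
    simp [Int.even_sub_one, hx]

lemma ZZ_bdd (L : ℤ) (hL0 : 0 < L) (e : κ →₀ ℕ) :
    Bdd (ZZ L e : (κ × Fin (D + 1) → ℤ) → ZMod 2) := by
  choose R hR using fun i => zeta_bdd (D := D + 1) L hL0 (e i)
  refine ⟨∑ i, |R i|, fun p hp x => ?_⟩
  have h := Finset.prod_ne_zero_iff.1 hp x.1 (Finset.mem_univ x.1)
  have h1 := hR _ _ h x.2
  calc |p x| ≤ R x.1 := h1
    _ ≤ |R x.1| := le_abs_self _
    _ ≤ ∑ i, |R i| := Finset.single_le_sum (f := fun i => |R i|) (fun i _ => abs_nonneg _)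
        (Finset.mem_univ x.1)

lemma ZZ_K (L : ℤ) (hL : Even L) (hL0 : 0 < L) (e : κ →₀ ℕ) (he : ∀ i, e i ≤ D)
    (p : κ × Fin (D + 1) → ℤ) (hp : ZZ L e p ≠ 0) : p ∈ KK L := by
  intro i
  have h := Finset.prod_ne_zero_iff.1 hp i (Finset.mem_univ i)
  exact zeta_support L hL hL0 ⟨e i, Nat.lt_succ_of_le (he i)⟩ _ h

lemma bd_ZZ (L : ℤ) (e : κ →₀ ℕ) (he : ∀ i, e i ≤ D) :
    bd (ZZ L e : (κ × Fin (D + 1) → ℤ) → ZMod 2) =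
      ∑ i, ((if e i = 0 then 0 else ZZ L (e - Finsupp.single i 1)) +
        fun p => (if e i = 0 then 0 else ZZ L (e - Finsupp.single i 1) :
          (κ × Fin (D + 1) → ℤ) → ZMod 2) (flip (blk i) p)) := by
  funext p
  have h0 : (ZZ L e : (κ × Fin (D + 1) → ℤ) → ZMod 2) =
    fun q => ∏ i, zeta L (e i) (fun l => q (i, l)) := rfl
  rw [h0, bd_blockprod (fun i => zeta L (e i)), Finset.sum_apply]
  refine Finset.sum_congr rfl fun i _ => ?_
  rw [Pi.add_apply]
  by_cases hi : e i = 0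
  · simp only [hi, if_true, Pi.zero_apply, add_zero]
    rw [bd_zeta_zero, zero_mul]
  · simp only [hi, if_false]
    obtain ⟨j, hj⟩ := Nat.exists_eq_succ_of_ne_zero hi
    have hjD : j < D + 1 := by have := he i; omega
    have hz := bd_zeta_succ L (⟨j, hjD⟩ : Fin (D + 1)) (fun l => p (i, l))
    simp only at hz
    rw [hj, hz]
    unfold ZZ
    have e1 : (e - Finsupp.single i 1 : κ →₀ ℕ) i = j := by simp [hj]
    have e2 : ∀ i', i' ≠ i → (e - Finsupp.single i 1 : κ →₀ ℕ) i' = e i' := fun i' h => by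
      simp [Finsupp.single_apply, h.symm]
    rw [← Finset.mul_prod_erase Finset.univ
        (fun i' => zeta L ((e - Finsupp.single i 1 : κ →₀ ℕ) i') fun l => p (i', l)) (Finset.mem_univ i),
      ← Finset.mul_prod_erase Finset.univ
        (fun i' => zeta L ((e - Finsupp.single i 1 : κ →₀ ℕ) i') fun l => flip (blk i) p (i', l))
        (Finset.mem_univ i), e1]
    have g1 : ∏ i' ∈ Finset.univ.erase i,
        zeta L ((e - Finsupp.single i 1 : κ →₀ ℕ) i') (fun l => p (i', l)) =
        ∏ i' ∈ Finset.univ.erase i, zeta L (e i') (fun l => p (i', l)) :=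
      Finset.prod_congr rfl fun i' hi' => by rw [e2 i' (Finset.ne_of_mem_erase hi')]
    have g2 : ∏ i' ∈ Finset.univ.erase i,
        zeta L ((e - Finsupp.single i 1 : κ →₀ ℕ) i') (fun l => flip (blk i) p (i', l)) =
        ∏ i' ∈ Finset.univ.erase i, zeta L (e i') (fun l => p (i', l)) :=
      Finset.prod_congr rfl fun i' hi' => by
        rw [e2 i' (Finset.ne_of_mem_erase hi')]
        congr 1
        funext l
        simp [flip, Finset.ne_of_mem_erase hi']
    have g3 : (fun l => flip (blk i) p (i, l)) = -(fun l => p (i, l)) := by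
      funext l; simp [flip]
    rw [g1, g2, g3]; ring

lemma NN_ZZ_zero (L : ℤ) (hL : Even L) (hL0 : 0 < L) :
    NN [] (ZZ L (0 : κ →₀ ℕ) : (κ × Fin (D + 1) → ℤ) → ZMod 2) = 1 := by
  simp only [NN]
  rw [finsum_eq_single _ (fun x : κ × Fin (D + 1) => if x.2 = 0 then L else 0)]
  · unfold ZZ
    refine Finset.prod_eq_one fun i _ => ?_
    rw [Finsupp.zero_apply, zeta_zero L hL hL0, if_pos]
    funext l
    simp [Pi.single_apply]
  · intro p hp
    by_contra h
    apply hp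
    funext x
    have h1 := Finset.prod_ne_zero_iff.1 h x.1 (Finset.mem_univ x.1)
    rw [Finsupp.zero_apply, zeta_zero L hL hL0] at h1
    split_ifs at h1 with h2
    · have := congrFun h2 x.2
      simp only [Pi.single_apply] at this
      exact this
    · exact absurd rfl h1

/-- The evaluation of the cup product. -/
theorem NN_eval (L : ℤ) (hL : Even L) (hL0 : 0 < L)
    (ss : List (((κ × Fin (D + 1) → ℤ) → ZMod 2) × (κ → ZMod 2)))
    (hss : ∀ s ∈ ss, ∀ i, ∀ p ∈ KK L, s.1 (flip (blk i) p) = s.1 p + s.2 i)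
    (e : κ →₀ ℕ) (he : ∀ i, e i ≤ D) (hdeg : ∑ i, e i = ss.length) :
    NN (ss.map Prod.fst) (ZZ L e) =
      MvPolynomial.coeff e ((ss.map fun s =>
        ∑ i, MvPolynomial.C (s.2 i) * (MvPolynomial.X i : MvPolynomial κ (ZMod 2))).prod) := by
  induction ss generalizing e with
  | nil =>
    have : e = 0 := by
      ext i
      simp only [List.length_nil, Finset.sum_eq_zero_iff, Finset.mem_univ, true_imp_iff] at hdeg
      simpa using hdeg i
    subst this
    simp only [List.map_nil, List.prod_nil]
    rw [NN_ZZ_zero L hL hL0]; simp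
  | cons s ss ih =>
    rw [List.map_cons, List.map_cons, List.prod_cons]
    rw [NN_step blk (KK L) (closedKK L hL) s.1 (ss.map Prod.fst) ?_ s.2
      (hss s (by simp)) (ZZ L e) (ZZ_bdd L hL0 e)
      (fun i => if e i = 0 then 0 else ZZ L (e - Finsupp.single i 1)) ?_ ?_ (bd_ZZ L e he)]
    · rw [Finset.sum_mul, MvPolynomial.coeff_sum]
      refine Finset.sum_congr rfl fun i _ => ?_
      rw [mul_assoc, MvPolynomial.coeff_C_mul]
      congr 1
      rw [mul_comm, MvPolynomial.coeff_mul_X']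
      by_cases hi : e i = 0
      · rw [if_pos hi, if_neg (by simpa using hi), NN_zero]
      · rw [if_neg hi, if_pos (by simpa using hi)]
        refine ih (fun s hs => hss s (by simp [hs])) _ ?_ ?_
        · intro i'
          refine le_trans ?_ (he i')
          simp
        · have h1 : e = (e - Finsupp.single i 1) + Finsupp.single i 1 := by
            rw [tsub_add_cancel_of_le]
            rw [Finsupp.single_le_iff]; omega
          rw [h1] at hdeg
          simp only [Finsupp.add_apply, Finset.sum_add_distrib, List.length_cons] at hdeg
          have h2 : ∑ x, (Finsupp.single i 1 : κ →₀ ℕ) x = 1 := by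
            simp [Finsupp.single_apply]
          omega
    · intro s' hs' i
      obtain ⟨t, ht, rfl⟩ := List.mem_map.1 hs'
      exact ⟨t.2 i, hss t (by simp [ht]) i⟩
    · intro i
      by_cases hi : e i = 0
      · simp only [hi, if_true]; exact Bdd.zero
      · simp only [hi, if_false]; exact ZZ_bdd L hL0 _
    · intro i p hp
      by_cases hi : e i = 0
      · simp only [hi, if_true] at hp; exact absurd rfl hp
      · simp only [hi, if_false] at hp
        refine ZZ_K L hL hL0 _ ?_ p hp
        intro i'
        refine le_trans ?_ (he i')
        simp

end EquiTop

namespace EquiTop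
variable {D : ℕ} {κ : Type*} [Fintype κ] [DecidableEq κ]

/-! ### The Borsuk-Ulam type theorem -/

lemma bd_bound {I : Type*} [Fintype I] [DecidableEq I] {z : (I → ℤ) → ZMod 2} {R : ℤ}
    (hR : ∀ p, z p ≠ 0 → ∀ i, |p i| ≤ R) : ∀ p, bd z p ≠ 0 → ∀ i, |p i| ≤ R + 1 := by
  intro p hp j
  obtain ⟨i, -, hi⟩ := bd_ne_zero hp
  rcases hi with hi | hi
  · have := abs_le.1 (hR _ hi j)
    rw [Pi.add_apply, Pi.single_apply] at this
    rw [abs_le]; split_ifs at this <;> constructor <;> linarith [this.1, this.2]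
  · have := abs_le.1 (hR _ hi j)
    rw [Pi.sub_apply, Pi.single_apply] at this
    rw [abs_le]; split_ifs at this <;> constructor <;> linarith [this.1, this.2]

lemma zeta_bound (L : ℤ) (hL0 : 0 < L) (j : ℕ) (x : Fin D → ℤ) (hx : zeta L j x ≠ 0) (l : Fin D) :
    |x l| ≤ L + 1 := by
  have hQ : ∀ x : Fin D → ℤ, chQ L j x ≠ 0 → ∀ l, |x l| ≤ L := by
    intro x hx l
    have h := Finset.prod_ne_zero_iff.1 hx l (Finset.mem_univ l)
    unfold phQ at h
    split_ifs at h
    · exact (ph_bdd L hL0 _).1 h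
    · exact (ph_bdd L hL0 _).2.1 h
    · exact (ph_bdd L hL0 _).2.2 h
  by_cases h1 : bd (chQ L j) x = 0
  · have h2 : chE L j x ≠ 0 := by
      intro h2; apply hx; simp [zeta, h1, h2]
    have h := Finset.prod_ne_zero_iff.1 h2 l (Finset.mem_univ l)
    unfold phE at h
    split_ifs at h
    · linarith [(ph_bdd L hL0 _).1 h]
    · linarith [(ph_bdd L hL0 _).2.2 h]
  · exact bd_bound hQ x h1 l

/-- sign change of a block of real coordinates -/
def rflip (i : κ) (x : κ × Fin (D + 1) → ℝ) : κ × Fin (D + 1) → ℝ :=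
  fun y => if y.1 = i then - x y else x y

/-- no block vanishes -/
def NZ (x : κ × Fin (D + 1) → ℝ) : Prop := ∀ i, ∃ l, x (i, l) ≠ 0

open Classical in
/-- sign of the first nonzero coordinate -/
def lexs (b : Fin (D + 1) → ℤ) : ZMod 2 :=
  if ∃ l, (∀ l' < l, b l' = 0) ∧ 0 < b l then 0 else 1

lemma lexs_neg (b : Fin (D + 1) → ℤ) (hb : b ≠ 0) : lexs (-b) = lexs b + 1 := by
  classical
  have hex : ∃ l, b l ≠ 0 := Function.ne_iff.1 hb
  obtain ⟨l, hl, hmin⟩ : ∃ l, b l ≠ 0 ∧ ∀ l' < l, b l' = 0 := by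
    obtain ⟨l, hl, hm⟩ := WellFounded.has_min (wellFounded_lt (α := Fin (D + 1)))
      {l | b l ≠ 0} hex
    refine ⟨l, hl, fun l' h' => ?_⟩
    by_contra hc
    exact hm l' hc h'
  have huniq : ∀ m, (∀ l' < m, b l' = 0) → b m ≠ 0 → m = l := by
    intro m hm hm'
    rcases lt_trichotomy m l with h | h | h
    · exact absurd (hmin m h) hm'
    · exact h
    · exact absurd (hm l h) hl
  have e1 : (∃ m, (∀ l' < m, b l' = 0) ∧ 0 < b m) ↔ 0 < b l := by
    constructor
    · rintro ⟨m, h1, h2⟩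
      rw [← huniq m h1 h2.ne']; exact h2
    · intro h; exact ⟨l, hmin, h⟩
  have e2 : (∃ m, (∀ l' < m, (-b) l' = 0) ∧ 0 < (-b) m) ↔ b l < 0 := by
    constructor
    · rintro ⟨m, h1, h2⟩
      have h3 : b m < 0 := by simpa using h2
      rw [← huniq m (fun l' h' => by simpa using h1 l' h') h3.ne]; exact h3
    · intro h; exact ⟨l, fun l' h' => by simp [hmin l' h'], by simpa using h⟩
  unfold lexs
  rw [if_congr e1 rfl rfl, if_congr e2 rfl rfl]
  rcases lt_or_gt_of_ne hl with h | h
  · rw [if_pos h, if_neg (by omega)]; decide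
  · rw [if_neg (by omega), if_pos h]; decide

def tie (a : κ → ZMod 2) (p : κ × Fin (D + 1) → ℤ) : ZMod 2 :=
  ∑ i, a i * lexs (fun l => p (i, l))

lemma tie_flip (a : κ → ZMod 2) (p : κ × Fin (D + 1) → ℤ) (i : κ) (hp : ∃ l, p (i, l) ≠ 0) :
    tie a (flip (blk i) p) = tie a p + a i := by
  unfold tie
  rw [← Finset.add_sum_erase Finset.univ _ (Finset.mem_univ i),
    ← Finset.add_sum_erase Finset.univ (fun i => a i * lexs (fun l => p (i, l)))
      (Finset.mem_univ i)]
  have h1 : ∑ i' ∈ Finset.univ.erase i, a i' * lexs (fun l => flip (blk i) p (i', l)) =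
      ∑ i' ∈ Finset.univ.erase i, a i' * lexs (fun l => p (i', l)) := by
    refine Finset.sum_congr rfl fun i' hi' => ?_
    congr 2
    funext l
    simp [flip, Finset.ne_of_mem_erase hi']
  have g3 : (fun l => flip (blk i) p (i, l)) = -(fun l => p (i, l)) := by
    funext l; simp [flip]
  rw [h1, g3, lexs_neg]
  · ring
  · obtain ⟨l, hl⟩ := hp
    exact fun h => hl (congrFun h l)

/-- rescaled real point of a cell -/
def scl (L : ℤ) (p : κ × Fin (D + 1) → ℤ) : κ × Fin (D + 1) → ℝ := fun y => (p y : ℝ) / L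

open Classical in
/-- the labelling associated with a function -/
def lab (f : (κ × Fin (D + 1) → ℝ) → ℝ) (a : κ → ZMod 2) (L : ℤ)
    (p : κ × Fin (D + 1) → ℤ) : ZMod 2 :=
  if f (scl L p) < 0 then 1 else if 0 < f (scl L p) then 0 else tie a p

lemma lab_ne (f : (κ × Fin (D + 1) → ℝ) → ℝ) (a : κ → ZMod 2) (L : ℤ)
    (u v : κ × Fin (D + 1) → ℤ) (h : lab f a L u ≠ lab f a L v) :
    f (scl L u) * f (scl L v) ≤ 0 := by
  by_contra hc
  push Not at hc
  apply h
  unfold lab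
  rcases pos_and_pos_or_neg_and_neg_of_mul_pos hc with ⟨h1, h2⟩ | ⟨h1, h2⟩
  · rw [if_neg (not_lt.2 h1.le), if_pos h1, if_neg (not_lt.2 h2.le), if_pos h2]
  · rw [if_pos h1, if_pos h2]

lemma lab_flip (f : (κ × Fin (D + 1) → ℝ) → ℝ) (a : κ → ZMod 2) (L : ℤ) (hL0 : 0 < L)
    (hf : ∀ i x, NZ x → f (rflip i x) = if a i = 0 then f x else - f x)
    (i : κ) (p : κ × Fin (D + 1) → ℤ) (hp : p ∈ KK L) :
    lab f a L (flip (blk i) p) = lab f a L p + a i := by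
  have hp0 : ∀ i, ∃ l, p (i, l) ≠ 0 := by
    intro i
    obtain ⟨l, hl⟩ := hp i
    refine ⟨l, fun h => ?_⟩
    rw [h, abs_zero] at hl
    omega
  have hL' : (L : ℝ) ≠ 0 := by exact_mod_cast hL0.ne'
  have hnz : NZ (scl L p) := by
    intro i
    obtain ⟨l, hl⟩ := hp0 i
    exact ⟨l, div_ne_zero (by exact_mod_cast hl) hL'⟩
  have h1 : scl L (flip (blk i) p) = rflip i (scl L p) := by
    funext y
    unfold scl rflip flip blk
    split_ifs
    · push_cast; ring
    · rfl
  unfold lab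
  rw [h1, hf i _ hnz, tie_flip a p i (hp0 i)]
  rcases z2_cases (a i) with h | h
  · simp [h]
  · rw [h, if_neg one_ne_zero]
    rcases lt_trichotomy (f (scl L p)) 0 with h2 | h2 | h2
    · rw [if_neg (by linarith), if_pos (by linarith), if_pos h2]; rfl
    · simp [h2]
    · rw [if_pos (by linarith), if_neg (by linarith), if_pos h2]; rfl

theorem borsukUlam {J : Type*} [Fintype J] (f : J → (κ × Fin (D + 1) → ℝ) → ℝ)
    (a : J → κ → ZMod 2)
    (hcont : ∀ j x, NZ x → ContinuousAt (f j) x)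
    (hf : ∀ j i x, NZ x → f j (rflip i x) = if a j i = 0 then f j x else - f j x)
    (e : κ →₀ ℕ) (he : ∀ i, e i ≤ D)
    (hcoef : MvPolynomial.coeff e (∏ j, ∑ i, MvPolynomial.C (a j i) *
      (MvPolynomial.X i : MvPolynomial κ (ZMod 2))) ≠ 0) :
    ∃ x, NZ x ∧ ∀ j, f j x = 0 := by
  classical
  set n := Fintype.card J with hn
  have hdeg : ∑ i, e i = n := by
    have hh : (∏ j, ∑ i, MvPolynomial.C (a j i) *
        (MvPolynomial.X i : MvPolynomial κ (ZMod 2))).IsHomogeneous (∑ j : J, 1) := by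
      refine MvPolynomial.IsHomogeneous.prod _ _ _ fun j _ => ?_
      refine MvPolynomial.IsHomogeneous.sum _ _ _ fun i _ => ?_
      exact MvPolynomial.isHomogeneous_C_mul_X _ _
    have := hh hcoef
    rw [Finsupp.weight_apply, Finsupp.sum_fintype _ _ (by simp)] at this
    simpa using this
  -- approximate solutions
  have step : ∀ m : ℕ, ∃ p : κ × Fin (D + 1) → ℤ, p ∈ KK (2 * (m + 1) : ℤ) ∧
      (∀ y, |p y| ≤ 2 * (m + 1) + 1) ∧
      ∀ j, ∃ u v : κ × Fin (D + 1) → ℤ,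
        f j (scl (2 * (m + 1)) u) * f j (scl (2 * (m + 1)) v) ≤ 0 ∧
        (∀ y, |u y - p y| ≤ n) ∧ (∀ y, |v y - p y| ≤ n) := by
    intro m
    set L : ℤ := 2 * (m + 1) with hLdef
    have hL : Even L := even_two_mul _
    have hL0 : 0 < L := by positivity
    set ss : List (((κ × Fin (D + 1) → ℤ) → ZMod 2) × (κ → ZMod 2)) :=
      (Finset.univ : Finset J).toList.map fun j => (lab (f j) (a j) L, a j) with hss
    have hlen : ss.length = n := by simp [hss, hn]
    have hev := NN_eval L hL hL0 ss (by
      intro s hs i p hp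
      obtain ⟨j, -, rfl⟩ := List.mem_map.1 hs
      exact lab_flip (f j) (a j) L hL0 (hf j) i p hp) e he (by rw [hdeg, hlen])
    have hprod : (ss.map fun s => ∑ i, MvPolynomial.C (s.2 i) *
        (MvPolynomial.X i : MvPolynomial κ (ZMod 2))).prod =
        ∏ j, ∑ i, MvPolynomial.C (a j i) *
        (MvPolynomial.X i : MvPolynomial κ (ZMod 2)) := by
      rw [hss, List.map_map, ← Finset.prod_map_toList]
      rfl
    rw [hprod] at hev
    obtain ⟨p, hp, hq⟩ := NN_extract _ _ (hev ▸ hcoef)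
    refine ⟨p, ZZ_K L hL hL0 e he p hp, fun y => ?_, fun j => ?_⟩
    · have h := Finset.prod_ne_zero_iff.1 hp y.1 (Finset.mem_univ y.1)
      exact zeta_bound L hL0 _ _ h y.2
    · obtain ⟨u, v, h1, h2, h3⟩ := hq (lab (f j) (a j) L) (by
        rw [hss, List.map_map, List.mem_map]
        exact ⟨j, by simp, rfl⟩)
      rw [List.length_map, hlen] at h2 h3
      exact ⟨u, v, lab_ne _ _ _ _ _ h1, h2, h3⟩
  choose p hpK hpb u v huv hu hv using step
  set P : ℕ → (κ × Fin (D + 1) → ℝ) := fun m => scl (2 * (m + 1)) (p m) with hP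
  have hLpos : ∀ m : ℕ, (0 : ℝ) < 2 * (m + 1) := fun m => by positivity
  have hPb : ∀ m, P m ∈ Set.Icc (fun _ => (-2 : ℝ)) (fun _ => 2) := by
    intro m
    have key : ∀ y, |P m y| ≤ 2 := by
      intro y
      simp only [hP, scl]
      push_cast
      rw [abs_div, abs_of_pos (hLpos m), div_le_iff₀ (hLpos m)]
      have := hpb m y
      have h2 : |(p m y : ℝ)| ≤ 2 * (m + 1) + 1 := by exact_mod_cast this
      have : (0 : ℝ) ≤ m := by positivity
      linarith
    exact ⟨fun y => (abs_le.1 (key y)).1, fun y => (abs_le.1 (key y)).2⟩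
  obtain ⟨x, -, φ, hφ, hx⟩ := isCompact_Icc.tendsto_subseq hPb
  have hx1 : ∀ i, ∃ l, |x (i, l)| = 1 := by
    intro i
    have hc : Continuous fun x : κ × Fin (D + 1) → ℝ => ∏ l, (|x (i, l)| - 1) := by fun_prop
    have h1 := (hc.tendsto x).comp hx
    have h2 : ∀ m, ∏ l, (|P m (i, l)| - 1) = 0 := by
      intro m
      obtain ⟨l, hl⟩ := hpK m i
      refine Finset.prod_eq_zero (Finset.mem_univ l) ?_
      simp only [hP, scl]
      push_cast
      rw [abs_div, abs_of_pos (hLpos m)]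
      have : |(p m (i, l) : ℝ)| = 2 * (m + 1) := by exact_mod_cast hl
      rw [this, div_self (hLpos m).ne', sub_self]
    have h3 : ((fun x : κ × Fin (D + 1) → ℝ => ∏ l, (|x (i, l)| - 1)) ∘ P ∘ φ) = fun _ => 0 := by
      funext m; exact h2 _
    rw [h3] at h1
    have h4 := tendsto_nhds_unique h1 tendsto_const_nhds
    obtain ⟨l, -, hl⟩ := Finset.prod_eq_zero_iff.1 h4
    exact ⟨l, by linarith⟩
  have hnz : NZ x := by
    intro i
    obtain ⟨l, hl⟩ := hx1 i
    refine ⟨l, fun h => ?_⟩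
    rw [h] at hl; simp at hl
  refine ⟨x, hnz, fun j => ?_⟩
  have lim : ∀ w : ℕ → (κ × Fin (D + 1) → ℤ), (∀ m y, |w m y - p m y| ≤ n) →
      Filter.Tendsto (fun m => scl (2 * (φ m + 1)) (w (φ m))) Filter.atTop (nhds x) := by
    intro w hw
    have h0 : Filter.Tendsto (fun m : ℕ => (n : ℝ) / (2 * (m + 1))) Filter.atTop (nhds 0) := by
      have := (tendsto_one_div_add_atTop_nhds_zero_nat (𝕜 := ℝ)).const_mul ((n : ℝ) / 2)
      rw [mul_zero] at this
      refine this.congr fun m => ?_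
      field_simp
    rw [tendsto_pi_nhds]
    intro y
    have hxy := (tendsto_pi_nhds.1 hx) y
    have hd : Filter.Tendsto (fun m => scl (2 * (φ m + 1)) (w (φ m)) y - P (φ m) y)
        Filter.atTop (nhds 0) := by
      refine squeeze_zero_norm (fun m => ?_) (h0.comp hφ.tendsto_atTop)
      simp only [hP, scl, Function.comp]
      push_cast
      rw [← sub_div, Real.norm_eq_abs, abs_div, abs_of_pos (hLpos _)]
      have : |(w (φ m) y : ℝ) - p (φ m) y| ≤ n := by exact_mod_cast hw (φ m) y
      exact div_le_div_of_nonneg_right this (hLpos _).le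
    have := hd.add hxy
    simpa using this
  have hul := (hcont j x hnz).tendsto.comp (lim (fun m => u m j) fun m y => hu m j y)
  have hvl := (hcont j x hnz).tendsto.comp (lim (fun m => v m j) fun m y => hv m j y)
  have hle := le_of_tendsto (hul.mul hvl) (Filter.Eventually.of_forall fun m => huv (φ m) j)
  nlinarith [mul_self_nonneg (f j x)]

end EquiTop

namespace EquiPoly
open MvPolynomial

variable {κ : Type*} [Fintype κ] [DecidableEq κ]

/-- weight of an exponent -/
def wt (w : κ → ℕ) (β : κ →₀ ℕ) : ℕ := ∑ i, w i * β i

lemma wt_add (w : κ → ℕ) (β γ : κ →₀ ℕ) : wt w (β + γ) = wt w β + wt w γ := by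
  simp [wt, mul_add, Finset.sum_add_distrib]

lemma wt_single (w : κ → ℕ) (i : κ) (n : ℕ) : wt w (Finsupp.single i n) = w i * n := by
  simp [wt, Finsupp.single_apply]

/-- `β` is the unique monomial of lowest weight of `P`, with coefficient `1` -/
def Lead (w : κ → ℕ) (P : MvPolynomial κ (ZMod 2)) (β : κ →₀ ℕ) : Prop :=
  coeff β P = 1 ∧ ∀ γ, coeff γ P ≠ 0 → γ = β ∨ wt w β < wt w γ

lemma Lead.mul {w : κ → ℕ} {P Q : MvPolynomial κ (ZMod 2)} {β γ : κ →₀ ℕ}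
    (hP : Lead w P β) (hQ : Lead w Q γ) : Lead w (P * Q) (β + γ) := by
  constructor
  · rw [coeff_mul, Finset.sum_eq_single (β, γ)]
    · rw [hP.1, hQ.1, one_mul]
    · rintro ⟨x, y⟩ hxy hne
      by_contra h
      have hx := hP.2 x (left_ne_zero_of_mul h)
      have hy := hQ.2 y (right_ne_zero_of_mul h)
      have hs : x + y = β + γ := by simpa using hxy
      have hw : wt w x + wt w y = wt w β + wt w γ := by rw [← wt_add, hs, wt_add]
      rcases hx with rfl | hx
      · rcases hy with rfl | hy
        · exact hne rfl
        · omega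
      · rcases hy with rfl | hy <;> omega
    · simp
  · intro δ hδ
    rw [coeff_mul] at hδ
    obtain ⟨⟨x, y⟩, hxy, h⟩ := Finset.exists_ne_zero_of_sum_ne_zero hδ
    have hx := hP.2 x (left_ne_zero_of_mul h)
    have hy := hQ.2 y (right_ne_zero_of_mul h)
    have hs : x + y = δ := by simpa using hxy
    rw [← hs, wt_add, wt_add]
    rcases hx with rfl | hx
    · rcases hy with rfl | hy
      · exact Or.inl rfl
      · right; omega
    · right
      rcases hy with rfl | hy <;> omega

lemma Lead.one (w : κ → ℕ) : Lead w 1 0 := by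
  refine ⟨by simp, fun γ h => ?_⟩
  left
  by_contra hne
  apply h
  rw [coeff_one, if_neg (Ne.symm hne)]

lemma Lead.pow {w : κ → ℕ} {P : MvPolynomial κ (ZMod 2)} {β : κ →₀ ℕ}
    (hP : Lead w P β) (n : ℕ) : Lead w (P ^ n) (n • β) := by
  induction n with
  | zero => simpa using Lead.one w
  | succ n ih => rw [pow_succ, succ_nsmul]; exact ih.mul hP

lemma Lead.prod {w : κ → ℕ} {α : Type*} (s : Finset α) (P : α → MvPolynomial κ (ZMod 2))
    (β : α → κ →₀ ℕ) (h : ∀ a ∈ s, Lead w (P a) (β a)) :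
    Lead w (∏ a ∈ s, P a) (∑ a ∈ s, β a) := by
  classical
  induction s using Finset.induction_on with
  | empty => simpa using Lead.one w
  | insert a s ha ih =>
    rw [Finset.prod_insert ha, Finset.sum_insert ha]
    exact (h a (by simp)).mul (ih fun b hb => h b (by simp [hb]))

lemma Lead.X (w : κ → ℕ) (i : κ) : Lead w (X i) (Finsupp.single i 1) := by
  refine ⟨by simp, fun γ h => ?_⟩
  left
  by_contra hne
  apply h
  rw [coeff_X, if_neg (Ne.symm hne)]

lemma Lead.X_add_X (w : κ → ℕ) (i j : κ) (h : w i ≠ w j) :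
    Lead w (MvPolynomial.X i + MvPolynomial.X j)
      (Finsupp.single (if w i < w j then i else j) 1) := by
  have key : ∀ i j : κ, w i < w j → Lead w (MvPolynomial.X i + MvPolynomial.X j)
      (Finsupp.single i 1) := by
    intro i j hij
    have hne : i ≠ j := by rintro rfl; omega
    constructor
    · rw [coeff_add, coeff_X, coeff_X, if_pos rfl, if_neg, add_zero]
      rw [Finsupp.single_left_inj one_ne_zero]; exact hne.symm
    · intro γ hγ
      rw [coeff_add, coeff_X, coeff_X] at hγ
      by_cases h1 : Finsupp.single i 1 = γ
      · exact Or.inl h1.symm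
      · by_cases h2 : Finsupp.single j 1 = γ
        · right
          rw [← h2, wt_single, wt_single]; omega
        · simp [h1, h2] at hγ
  rcases lt_or_gt_of_ne h with h1 | h1
  · rw [if_pos h1]; exact key i j h1
  · rw [if_neg (by omega), add_comm]; exact key j i h1

lemma Lead.coeff_of_lt {w : κ → ℕ} {P : MvPolynomial κ (ZMod 2)} {β γ : κ →₀ ℕ}
    (h : Lead w P β) (hw : wt w γ < wt w β) : coeff γ P = 0 := by
  by_contra hc
  rcases h.2 γ hc with rfl | h' <;> omega

/-- sum of minima over a permutation -/
lemma sum_min (r : ℕ) (π : Equiv.Perm (Fin (r + 1))) :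
    (∑ i, ∑ j ∈ Finset.Ioi i, min (π i : ℤ) (π j : ℤ)) + ∑ i, (π i : ℤ) * π i =
      r * ∑ i, (π i : ℤ) := by
  -- twice the first sum, as a sum over all ordered pairs
  have h1 : ∑ i, ∑ j, min (π i : ℤ) (π j : ℤ) =
      2 * (∑ i, ∑ j ∈ Finset.Ioi i, min (π i : ℤ) (π j : ℤ)) + ∑ i, (π i : ℤ) := by
    have hs : ∀ i : Fin (r + 1), ∑ j, min (π i : ℤ) (π j : ℤ) =
        (∑ j ∈ Finset.Ioi i, min (π i : ℤ) (π j : ℤ)) +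
        (∑ j ∈ Finset.Iio i, min (π i : ℤ) (π j : ℤ)) + π i := by
      intro i
      have hu : (Finset.univ : Finset (Fin (r + 1))) =
          (Finset.Ioi i ∪ Finset.Iio i) ∪ {i} := by
        ext j
        simp only [Finset.mem_univ, Finset.mem_union, Finset.mem_Ioi, Finset.mem_Iio,
          Finset.mem_singleton, true_iff]
        rcases lt_trichotomy i j with h | h | h <;> simp [h]
      rw [hu, Finset.sum_union, Finset.sum_union]
      · simp
      · rw [Finset.disjoint_left]
        intro j hj hj'
        rw [Finset.mem_Ioi] at hj
        rw [Finset.mem_Iio] at hj'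
        exact absurd hj (not_lt.2 hj'.le)
      · simp
    rw [Finset.sum_congr rfl fun i _ => hs i, Finset.sum_add_distrib, Finset.sum_add_distrib]
    have hsw : ∑ i, ∑ j ∈ Finset.Iio i, min (π i : ℤ) (π j : ℤ) =
        ∑ i, ∑ j ∈ Finset.Ioi i, min (π i : ℤ) (π j : ℤ) := by
      rw [Finset.sum_comm' (t' := Finset.univ) (s' := fun j => Finset.Ioi j)]
      · refine Finset.sum_congr rfl fun i _ => Finset.sum_congr rfl fun j _ => min_comm _ _
      · intro x y; simp
    rw [hsw]; ring
  have h2 : ∑ i, ∑ j, min (π i : ℤ) (π j : ℤ) =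
      ∑ i : Fin (r + 1), ∑ j : Fin (r + 1), min (i : ℤ) (j : ℤ) := by
    rw [Equiv.sum_comp π (fun i => ∑ j, min (i : ℤ) (π j : ℤ))]
    refine Finset.sum_congr rfl fun i _ => ?_
    exact Equiv.sum_comp π (fun j => min (i : ℤ) (j : ℤ))
  have h3 : ∑ i, (π i : ℤ) * π i = ∑ i : Fin (r + 1), (i : ℤ) * i :=
    Equiv.sum_comp π (fun i => (i : ℤ) * i)
  have h4 : ∑ i, (π i : ℤ) = ∑ i : Fin (r + 1), (i : ℤ) :=
    Equiv.sum_comp π (fun i => (i : ℤ))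
  have h5 : ∀ n : ℕ, 2 * ∑ i ∈ Finset.range (n + 1), (i : ℤ) = n * (n + 1) := by
    intro n
    induction n with
    | zero => simp
    | succ n ih => rw [Finset.sum_range_succ, mul_add, ih]; push_cast; ring
  have h6 : ∀ n : ℕ, (∑ i ∈ Finset.range (n + 1), ∑ j ∈ Finset.range (n + 1), min (i : ℤ) (j : ℤ))
      + 2 * ∑ i ∈ Finset.range (n + 1), (i : ℤ) * i =
      (2 * n + 1) * ∑ i ∈ Finset.range (n + 1), (i : ℤ) := by
    intro n
    induction n with
    | zero => simp
    | succ n ih =>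
      have e1 : ∑ i ∈ Finset.range (n + 1), ∑ j ∈ Finset.range (n + 1 + 1), min (i : ℤ) (j : ℤ) =
          ∑ i ∈ Finset.range (n + 1), ∑ j ∈ Finset.range (n + 1), min (i : ℤ) (j : ℤ) +
          ∑ i ∈ Finset.range (n + 1), (i : ℤ) := by
        rw [← Finset.sum_add_distrib]
        refine Finset.sum_congr rfl fun i hi => ?_
        rw [Finset.sum_range_succ]
        congr 1
        apply min_eq_left
        have := Finset.mem_range.1 hi
        exact_mod_cast this.le
      have e2 : ∑ j ∈ Finset.range (n + 1 + 1), min ((n + 1 : ℕ) : ℤ) (j : ℤ) =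
          ∑ i ∈ Finset.range (n + 1), (i : ℤ) + (n + 1) := by
        rw [Finset.sum_range_succ]
        congr 1
        · refine Finset.sum_congr rfl fun i hi => ?_
          apply min_eq_right
          have := Finset.mem_range.1 hi
          exact_mod_cast this.le
        · push_cast; simp
      rw [Finset.sum_range_succ
          (fun i : ℕ => ∑ j ∈ Finset.range (n + 1 + 1), min (i : ℤ) (j : ℤ)) (n + 1), e1, e2,
        Finset.sum_range_succ (fun i : ℕ => (i : ℤ) * i) (n + 1),
        Finset.sum_range_succ (fun i : ℕ => (i : ℤ)) (n + 1)]
      push_cast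
      linear_combination ih
  have h7 : ∑ i : Fin (r + 1), ∑ j : Fin (r + 1), min (i : ℤ) (j : ℤ) =
      ∑ i ∈ Finset.range (r + 1), ∑ j ∈ Finset.range (r + 1), min (i : ℤ) (j : ℤ) := by
    rw [← Fin.sum_univ_eq_sum_range (fun i => ∑ j ∈ Finset.range (r + 1), min (i : ℤ) (j : ℤ))]
    refine Finset.sum_congr rfl fun i _ => ?_
    exact Fin.sum_univ_eq_sum_range (fun j => min (i : ℤ) (j : ℤ)) _
  have h8 : ∑ i : Fin (r + 1), (i : ℤ) = ∑ i ∈ Finset.range (r + 1), (i : ℤ) :=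
    Fin.sum_univ_eq_sum_range (fun j => (j : ℤ)) _
  have h9 : ∑ i : Fin (r + 1), (i : ℤ) * i = ∑ i ∈ Finset.range (r + 1), (i : ℤ) * i :=
    Fin.sum_univ_eq_sum_range (fun j => (j : ℤ) * j) _
  have h10 := h6 r
  rw [← h7, ← h8, ← h9, ← h2, ← h3, ← h4, h1] at h10
  linarith

end EquiPoly

namespace EquiPoly
open MvPolynomial

lemma wt_sum {κ : Type*} [Fintype κ] [DecidableEq κ] {α : Type*} (w : κ → ℕ) (s : Finset α)
    (β : α → κ →₀ ℕ) : wt w (∑ a ∈ s, β a) = ∑ a ∈ s, wt w (β a) := by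
  classical
  induction s using Finset.induction_on with
  | empty => simp [wt]
  | insert a s ha ih => rw [Finset.sum_insert ha, Finset.sum_insert ha, wt_add, ih]

lemma wt_nsmul {κ : Type*} [Fintype κ] [DecidableEq κ] (w : κ → ℕ) (n : ℕ)
    (β : κ →₀ ℕ) : wt w (n • β) = n * wt w β := by
  simp only [wt, Finsupp.smul_apply, smul_eq_mul, Finset.mul_sum]
  refine Finset.sum_congr rfl fun i _ => by ring

/-- the Vandermonde expansion in characteristic two -/
lemma vander (r q : ℕ) :
    ∏ i : Fin (r + 1), ∏ j ∈ Finset.Ioi i,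
      ((X i : MvPolynomial (Fin (r + 1)) (ZMod 2)) + X j) ^ (2 ^ q) =
    ∑ π : Equiv.Perm (Fin (r + 1)), ∏ i, X i ^ (2 ^ q * (π i : ℕ)) := by
  have h1 : ∏ i : Fin (r + 1), ∏ j ∈ Finset.Ioi i,
      ((X i : MvPolynomial (Fin (r + 1)) (ZMod 2)) + X j) ^ (2 ^ q) =
      (Matrix.vandermonde
        (fun i : Fin (r + 1) => (X i : MvPolynomial (Fin (r + 1)) (ZMod 2)) ^ (2 ^ q))).det := by
    rw [Matrix.det_vandermonde]
    refine Finset.prod_congr rfl fun i _ => Finset.prod_congr rfl fun j _ => ?_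
    rw [add_pow_char_pow, CharTwo.sub_eq_add]; exact add_comm _ _
  rw [h1, ← Matrix.det_transpose, Matrix.det_apply']
  refine Finset.sum_congr rfl fun π _ => ?_
  have hs : ((Equiv.Perm.sign π : ℤ) : MvPolynomial (Fin (r + 1)) (ZMod 2)) = 1 := by
    rcases Int.units_eq_one_or (Equiv.Perm.sign π) with h | h
    · rw [h]; simp
    · rw [h]; simp [CharTwo.neg_eq]
  rw [hs, one_mul]
  refine Finset.prod_congr rfl fun i _ => ?_
  rw [Matrix.transpose_apply, Matrix.vandermonde_apply, ← pow_mul]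

lemma eq_rev (r : ℕ) (π : Equiv.Perm (Fin (r + 1))) (h : ∀ i j, i < j → π j < π i) :
    π = Fin.revPerm := by
  have h1 : StrictMono (fun i => π (Fin.rev i)) := fun i j hij => h _ _ (Fin.rev_lt_rev.2 hij)
  have h2 : (fun i => π (Fin.rev i)) = id := by
    apply (h1.range_inj strictMono_id).1
    rw [Set.range_id]
    exact (π.surjective.comp Fin.rev_surjective).range_eq
  ext i
  have := congrFun h2 (Fin.rev i)
  simp only [Fin.rev_rev, id] at this
  rw [this]; rfl

/-- abstract form of the coefficient computation -/
theorem coeff_aux (r q : ℕ) (c m w e' : Fin (r + 1) → ℕ) (hmw : ∀ i, m i + w i = 2 ^ q)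
    (hw : ∀ i, 0 < w i)
    (hcm : ∀ i, c i + 1 = 2 ^ q + m i)
    (e : Fin (r + 1) →₀ ℕ)
    (he : ∀ j, c j + 2 ^ q * r = e j + ∑ i ∈ Finset.Iio j, w i) :
    coeff e ((∏ i, X i ^ c i) * ∏ i, ∏ j ∈ Finset.Ioi i,
      ((X i : MvPolynomial (Fin (r + 1)) (ZMod 2)) + X j) ^ (c i + 1)) = 1 := by
  set M := 2 ^ q with hM
  have hsplit : (∏ i, X i ^ c i) * ∏ i, ∏ j ∈ Finset.Ioi i,
      ((X i : MvPolynomial (Fin (r + 1)) (ZMod 2)) + X j) ^ (c i + 1) =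
      ∑ π : Equiv.Perm (Fin (r + 1)), (∏ i, X i ^ c i) * (∏ i, X i ^ (M * (π i : ℕ))) *
        ∏ i, ∏ j ∈ Finset.Ioi i, ((X i : MvPolynomial (Fin (r + 1)) (ZMod 2)) + X j) ^ (m i) := by
    rw [← Finset.sum_mul, ← Finset.mul_sum, ← vander, mul_assoc]
    congr 1
    rw [← Finset.prod_mul_distrib]
    apply Finset.prod_congr rfl
    intro i _
    rw [← Finset.prod_mul_distrib]
    refine Finset.prod_congr rfl fun j _ => ?_
    rw [← pow_add, hcm]
  let β : Equiv.Perm (Fin (r + 1)) → (Fin (r + 1) →₀ ℕ) := fun π =>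
    (∑ i, c i • Finsupp.single i 1) + (∑ i, (M * (π i : ℕ)) • Finsupp.single i 1) +
      ∑ i, ∑ j ∈ Finset.Ioi i,
        m i • Finsupp.single (if (π i : ℕ) < (π j : ℕ) then i else j) 1
  have hlead : ∀ π : Equiv.Perm (Fin (r + 1)), Lead (fun i => (π i : ℕ))
      ((∏ i, X i ^ c i) * (∏ i, X i ^ (M * (π i : ℕ))) *
        ∏ i, ∏ j ∈ Finset.Ioi i, ((X i : MvPolynomial (Fin (r + 1)) (ZMod 2)) + X j) ^ (m i))
      (β π) := by
    intro π
    refine ((Lead.prod _ _ _ fun i _ => (Lead.X _ i).pow _).mul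
      (Lead.prod _ _ _ fun i _ => (Lead.X _ i).pow _)).mul
      (Lead.prod _ _ _ fun i _ => Lead.prod _ _ _ fun j hj => (Lead.X_add_X _ i j ?_).pow _)
    intro h
    have h1 := π.injective (Fin.ext h)
    rw [Finset.mem_Ioi, h1] at hj
    exact lt_irrefl _ hj
  have hwt : ∀ π : Equiv.Perm (Fin (r + 1)),
      (wt (fun i => (π i : ℕ)) (β π) : ℤ) - wt (fun i => (π i : ℕ)) e =
        ∑ i, ∑ j ∈ Finset.Ioi i, (w i : ℤ) * ((π j : ℤ) - min (π i : ℤ) (π j)) := by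
    intro π
    have h1 : (wt (fun i => (π i : ℕ)) (β π) : ℤ) = ∑ i, (c i : ℤ) * π i +
        ∑ i, (M : ℤ) * (π i * π i) + ∑ i, ∑ j ∈ Finset.Ioi i, (m i : ℤ) * min (π i : ℤ) (π j) := by
      simp only [β, wt_add, wt_sum, wt_nsmul, wt_single, mul_one]
      push_cast
      congr 1
      · congr 1
        exact Finset.sum_congr rfl fun i _ => by ring
      · refine Finset.sum_congr rfl fun i _ => Finset.sum_congr rfl fun j _ => ?_
        congr 1
        split_ifs with h
        · rw [min_eq_left]; exact_mod_cast h.le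
        · rw [min_eq_right]; exact_mod_cast not_lt.1 h
    have h2 : (wt (fun i => (π i : ℕ)) e : ℤ) = ∑ i, (π i : ℤ) * e i := by
      simp only [wt]; push_cast; rfl
    have h3 : ∑ i, ∑ j ∈ Finset.Ioi i, (w i : ℤ) * (π j : ℤ) =
        ∑ j, (π j : ℤ) * (c j + M * r - e j) := by
      rw [Finset.sum_comm' (t' := Finset.univ) (s' := fun j => Finset.Iio j)
        (by intro x y; simp)]
      refine Finset.sum_congr rfl fun j _ => ?_
      rw [← Finset.sum_mul]
      have := he j
      have h4 : (c j : ℤ) + M * r = e j + ∑ i ∈ Finset.Iio j, (w i : ℤ) := by exact_mod_cast this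
      rw [h4]; ring
    have h4 : ∑ i, ∑ j ∈ Finset.Ioi i, (w i : ℤ) * min (π i : ℤ) (π j) +
        ∑ i, ∑ j ∈ Finset.Ioi i, (m i : ℤ) * min (π i : ℤ) (π j) =
        M * ∑ i, ∑ j ∈ Finset.Ioi i, min (π i : ℤ) (π j) := by
      simp only [Finset.mul_sum, ← Finset.sum_add_distrib]
      refine Finset.sum_congr rfl fun i _ => Finset.sum_congr rfl fun j _ => ?_
      have : (m i : ℤ) + w i = M := by exact_mod_cast hmw i
      rw [← this]; ring
    have h5 := sum_min r π
    have h6 : ∑ j, (π j : ℤ) * (c j + M * r - e j) =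
        ∑ i, (c i : ℤ) * π i + M * (r * ∑ i, (π i : ℤ)) - ∑ i, (π i : ℤ) * e i := by
      simp only [Finset.mul_sum, ← Finset.sum_add_distrib, ← Finset.sum_sub_distrib]
      exact Finset.sum_congr rfl fun i _ => by ring
    have h7 : ∑ i, (M : ℤ) * ((π i : ℤ) * π i) = M * ∑ i, (π i : ℤ) * π i := by
      rw [Finset.mul_sum]
    simp only [mul_sub, Finset.sum_sub_distrib]
    simp only [mul_sub, Finset.sum_sub_distrib] at h3 h6
    rw [h1, h2, h7, h3, h6]
    linear_combination h4 + (M : ℤ) * h5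
  have hrev : β Fin.revPerm = e := by
    ext j
    have hπ : ∀ i l : Fin (r + 1), i < l →
        ¬ ((Fin.revPerm i : Fin (r + 1)) : ℕ) < ((Fin.revPerm l : Fin (r + 1)) : ℕ) := by
      intro i l hil
      simp only [Fin.revPerm_apply, Fin.val_rev, not_lt]
      have : (i : ℕ) < l := hil
      omega
    have hb : β Fin.revPerm = (∑ i, c i • Finsupp.single i 1) +
        (∑ i, (M * ((Fin.revPerm i : Fin (r + 1)) : ℕ)) • Finsupp.single i 1) +
        ∑ i, ∑ j ∈ Finset.Ioi i, m i • Finsupp.single j 1 := by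
      simp only [β]
      congr 1
      refine Finset.sum_congr rfl fun i _ => Finset.sum_congr rfl fun l hl => ?_
      rw [if_neg (hπ i l (Finset.mem_Ioi.1 hl))]
    have hs : ∀ f : Fin (r + 1) → ℕ, (∑ i, f i • Finsupp.single i 1 : Fin (r + 1) →₀ ℕ) j = f j := by
      intro f
      simp [Finsupp.finsetSum_apply, Finsupp.single_apply]
    have hs2 : (∑ i, ∑ j ∈ Finset.Ioi i, m i • Finsupp.single j 1 : Fin (r + 1) →₀ ℕ) j =
        ∑ i ∈ Finset.Iio j, m i := by
      rw [Finset.sum_comm' (t' := Finset.univ) (s' := fun j => Finset.Iio j)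
        (by intro x y; simp)]
      simp only [← Finset.sum_smul]
      exact hs (fun l => ∑ i ∈ Finset.Iio l, m i)
    rw [hb, Finsupp.add_apply, Finsupp.add_apply, hs, hs, hs2]
    have h1 : ∑ i ∈ Finset.Iio j, m i + ∑ i ∈ Finset.Iio j, w i = M * j := by
      rw [← Finset.sum_add_distrib, Finset.sum_congr rfl fun i _ => hmw i]
      simp [mul_comm]
    have h2 := he j
    have h3 : M * ((Fin.revPerm j : Fin (r + 1)) : ℕ) + M * j = M * r := by
      rw [← mul_add]
      congr 1
      simp only [Fin.revPerm_apply, Fin.val_rev]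
      omega
    omega
  rw [hsplit, coeff_sum, Finset.sum_eq_single Fin.revPerm]
  · have := (hlead Fin.revPerm).1
    rwa [hrev] at this
  · intro π _ hne
    apply (hlead π).coeff_of_lt
    have hpos : 0 < ∑ i, ∑ j ∈ Finset.Ioi i, (w i : ℤ) * ((π j : ℤ) - min (π i : ℤ) (π j)) := by
      have hex : ∃ i j, i < j ∧ π i < π j := by
        by_contra hcon
        push Not at hcon
        apply hne
        apply eq_rev
        intro i j hij
        refine lt_of_le_of_ne (hcon i j hij) fun h => ?_
        exact hij.ne' (π.injective h)
      obtain ⟨i, j, hij, hlt⟩ := hex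
      have hnn : ∀ i j, 0 ≤ (w i : ℤ) * ((π j : ℤ) - min (π i : ℤ) (π j)) := fun i j =>
        mul_nonneg (by positivity) (sub_nonneg.2 (min_le_right _ _))
      refine Finset.sum_pos' (fun i _ => Finset.sum_nonneg fun j _ => hnn i j)
        ⟨i, Finset.mem_univ _, Finset.sum_pos' (fun j _ => hnn i j)
          ⟨j, Finset.mem_Ioi.2 hij, mul_pos (by exact_mod_cast hw i) ?_⟩⟩
      have : ((π i : ℕ) : ℤ) < (π j : ℕ) := by exact_mod_cast hlt
      rw [min_eq_left this.le]; linarith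
    have := hwt π
    omega
  · simp

theorem coeff_main (r q t : ℕ) (ht1 : 2 ≤ t) (ht2 : t ≤ 2 ^ q) (c : Fin (r + 1) → ℕ)
    (hc : ∀ i, c i = if i = 0 then 2 ^ (q + 1) - t else 2 ^ (q + 1) - 2)
    (d : ℕ) (hd : d = 2 ^ q * (r + 2) - t)
    (e : Fin (r + 1) →₀ ℕ) (he : ∀ i, e i = d - i) :
    coeff e ((∏ i, X i ^ c i) * ∏ i, ∏ j ∈ Finset.Ioi i,
      ((X i : MvPolynomial (Fin (r + 1)) (ZMod 2)) + X j) ^ (c i + 1)) = 1 := by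
  have hN : 2 ^ (q + 1) = 2 * 2 ^ q := by ring
  apply coeff_aux r q c (fun i => if i = 0 then 2 ^ q - t + 1 else 2 ^ q - 1)
    (fun i => 1 + if i = 0 then t - 2 else 0) (fun _ => 0)
  · intro i
    split_ifs <;> omega
  · intro i; omega
  · intro i
    rw [hc]
    split_ifs <;> omega
  · intro j
    rw [Finset.sum_add_distrib, Finset.sum_ite_eq', hc, he]
    simp only [Finset.sum_const, Fin.card_Iio, smul_eq_mul, mul_one, Finset.mem_Iio]
    have hjr : (j : ℕ) ≤ r := Nat.lt_succ_iff.1 j.2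
    have h1 : 2 ^ q * (r + 2) = 2 ^ q * r + 2 * 2 ^ q := by ring
    have h2 : r ≤ 2 ^ q * r := Nat.le_mul_of_pos_left r (by positivity)
    by_cases hj : j = 0
    · subst hj; simp; omega
    · have : 0 < j := Fin.pos_of_ne_zero hj
      rw [if_neg hj, if_pos this]; omega

end EquiPoly

namespace EquiGeo
open EquiTop

variable {d r : ℕ}

lemma hyper_null (a : EuclideanSpace ℝ (Fin d)) (b : ℝ) (h : a ≠ 0 ∨ b ≠ 0) :
    volume {y : EuclideanSpace ℝ (Fin d) | ⟪a, y⟫ - b = 0} = 0 := by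
  by_cases ha : a = 0
  · have hb : b ≠ 0 := by tauto
    have : {y : EuclideanSpace ℝ (Fin d) | ⟪a, y⟫ - b = 0} = ∅ := by
      ext y; simp [ha, hb]
    rw [this]; simp
  · have haa : ⟪a, a⟫ ≠ (0 : ℝ) := inner_self_ne_zero.2 ha
    have h1 : {y : EuclideanSpace ℝ (Fin d) | ⟪a, y⟫ - b = 0} =
        (fun y => (-((b / ⟪a, a⟫) • a)) + y) ⁻¹'
          ((LinearMap.ker (innerₛₗ ℝ a) : Submodule ℝ (EuclideanSpace ℝ (Fin d))) :
            Set (EuclideanSpace ℝ (Fin d))) := by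
      ext y
      simp only [Set.mem_ofPred_eq, Set.mem_preimage, SetLike.mem_coe, LinearMap.mem_ker,
        innerₛₗ_apply_apply, inner_add_right, inner_neg_right, inner_smul_right]
      rw [div_mul_cancel₀ _ haa]
      constructor <;> intro h <;> linarith
    rw [h1, measure_preimage_add]
    apply Measure.addHaar_submodule
    intro htop
    have : a ∈ (LinearMap.ker (innerₛₗ ℝ a) : Submodule ℝ (EuclideanSpace ℝ (Fin d))) := by
      rw [htop]; trivial
    exact haa (by simpa using this)

lemma sign_continuousAt {x : ℝ} (hx : x ≠ 0) : ContinuousAt Real.sign x := by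
  rcases lt_or_gt_of_ne hx with h | h
  · refine (continuousAt_const (y := (-1 : ℝ))).congr ?_
    filter_upwards [Iio_mem_nhds h] with y hy
    exact (Real.sign_of_neg hy).symm
  · refine (continuousAt_const (y := (1 : ℝ))).congr ?_
    filter_upwards [Ioi_mem_nhds h] with y hy
    exact (Real.sign_of_pos hy).symm

lemma sign_measurable : Measurable Real.sign := by
  have : Real.sign = fun r : ℝ => if r < 0 then (-1 : ℝ) else if 0 < r then 1 else 0 := by
    ext r; rfl
  rw [this]
  refine Measurable.ite measurableSet_Iio measurable_const
    (Measurable.ite measurableSet_Ioi measurable_const measurable_const)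

lemma sign_abs_le (x : ℝ) : |Real.sign x| ≤ 1 := by
  rcases Real.sign_apply_eq x with h | h | h <;> rw [h] <;> norm_num

/-- the normal vector -/
def A (x : Fin (r + 1) × Fin (d + 1) → ℝ) (i : Fin (r + 1)) : EuclideanSpace ℝ (Fin d) :=
  WithLp.toLp 2 (fun l => x (i, l.castSucc))

/-- the affine functional -/
def L (x : Fin (r + 1) × Fin (d + 1) → ℝ) (i : Fin (r + 1)) (y : EuclideanSpace ℝ (Fin d)) : ℝ :=
  ⟪A x i, y⟫ - x (i, Fin.last d)

lemma A_flip (x : Fin (r + 1) × Fin (d + 1) → ℝ) (i' i : Fin (r + 1)) :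
    A (rflip i' x) i = if i = i' then - A x i else A x i := by
  split_ifs with h <;> ext l <;> simp [A, rflip, h]

lemma L_flip (x : Fin (r + 1) × Fin (d + 1) → ℝ) (i' i : Fin (r + 1))
    (y : EuclideanSpace ℝ (Fin d)) :
    L (rflip i' x) i y = if i = i' then - L x i y else L x i y := by
  unfold L
  rw [A_flip]
  split_ifs with h
  · simp [rflip, h]; ring
  · simp [rflip, h]

lemma S_flip (x : Fin (r + 1) × Fin (d + 1) → ℝ) (i' i : Fin (r + 1))
    (y : EuclideanSpace ℝ (Fin d)) :
    Real.sign (L (rflip i' x) i y) =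
      if i = i' then - Real.sign (L x i y) else Real.sign (L x i y) := by
  rw [L_flip]
  split_ifs with h
  · rw [Real.sign_neg]
  · rfl

lemma A_cont (i : Fin (r + 1)) :
    Continuous (fun x : Fin (r + 1) × Fin (d + 1) → ℝ => A x i) := by
  unfold A
  fun_prop

lemma L_cont_x (i : Fin (r + 1)) (y : EuclideanSpace ℝ (Fin d)) :
    Continuous (fun x : Fin (r + 1) × Fin (d + 1) → ℝ => L x i y) := by
  unfold L
  have := A_cont (d := d) i
  fun_prop

lemma L_cont_y (x : Fin (r + 1) × Fin (d + 1) → ℝ) (i : Fin (r + 1)) : Continuous (L x i) := by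
  unfold L
  fun_prop

lemma NZ_ne {x : Fin (r + 1) × Fin (d + 1) → ℝ} (hx : NZ x) (i : Fin (r + 1)) :
    A x i ≠ 0 ∨ x (i, Fin.last d) ≠ 0 := by
  by_contra h
  push Not at h
  obtain ⟨l, hl⟩ := hx i
  apply hl
  refine Fin.lastCases h.2 (fun l => ?_) l
  have := congrArg (fun v : EuclideanSpace ℝ (Fin d) => v l) h.1
  simpa [A] using this

lemma S_meas (x : Fin (r + 1) × Fin (d + 1) → ℝ) (i : Fin (r + 1)) :
    Measurable (fun y => Real.sign (L x i y)) :=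
  sign_measurable.comp (L_cont_y x i).measurable

variable {μ : Measure (EuclideanSpace ℝ (Fin d))}

lemma L_ae (hac : μ ≪ volume) {x : Fin (r + 1) × Fin (d + 1) → ℝ} (hx : NZ x)
    (i : Fin (r + 1)) : ∀ᵐ y ∂μ, L x i y ≠ 0 := by
  have := hac (hyper_null (A x i) (x (i, Fin.last d)) (NZ_ne hx i))
  rw [ae_iff]
  simpa [L] using this

lemma cont1 [IsFiniteMeasure μ] (hac : μ ≪ volume) {x : Fin (r + 1) × Fin (d + 1) → ℝ}
    (hx : NZ x) (i : Fin (r + 1)) :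
    ContinuousAt (fun x : Fin (r + 1) × Fin (d + 1) → ℝ => ∫ y, Real.sign (L x i y) ∂μ) x := by
  apply continuousAt_of_dominated (bound := fun _ => 1)
  · exact Filter.Eventually.of_forall fun x => (S_meas x i).aestronglyMeasurable
  · exact Filter.Eventually.of_forall fun x => Filter.Eventually.of_forall fun y => sign_abs_le _
  · exact integrable_const _
  · filter_upwards [L_ae hac hx i] with y hy
    exact ContinuousAt.comp (f := fun x : Fin (r + 1) × Fin (d + 1) → ℝ => L x i y)
      (sign_continuousAt hy) (L_cont_x i y).continuousAt

lemma cont2 [IsFiniteMeasure μ] (hac : μ ≪ volume) {x : Fin (r + 1) × Fin (d + 1) → ℝ}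
    (hx : NZ x) (i j : Fin (r + 1)) :
    ContinuousAt (fun x : Fin (r + 1) × Fin (d + 1) → ℝ =>
      ∫ y, Real.sign (L x i y) * Real.sign (L x j y) ∂μ) x := by
  apply continuousAt_of_dominated (bound := fun _ => 1)
  · exact Filter.Eventually.of_forall fun x =>
      ((S_meas x i).mul (S_meas x j)).aestronglyMeasurable
  · refine Filter.Eventually.of_forall fun x => Filter.Eventually.of_forall fun y => ?_
    rw [Real.norm_eq_abs, abs_mul]
    exact mul_le_one₀ (sign_abs_le _) (abs_nonneg _) (sign_abs_le _)
  · exact integrable_const _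
  · filter_upwards [L_ae hac hx i, L_ae hac hx j] with y hy hy'
    exact (ContinuousAt.comp (f := fun x : Fin (r + 1) × Fin (d + 1) → ℝ => L x i y)
      (sign_continuousAt hy) (L_cont_x i y).continuousAt).mul
      (ContinuousAt.comp (f := fun x : Fin (r + 1) × Fin (d + 1) → ℝ => L x j y)
      (sign_continuousAt hy') (L_cont_x j y).continuousAt)

lemma half_meas (a : EuclideanSpace ℝ (Fin d)) (b : ℝ) (ε : Bool) :
    MeasurableSet (halfSpace a b ε) := by
  unfold halfSpace
  have : Continuous fun x : EuclideanSpace ℝ (Fin d) => ⟪a, x⟫ := by fun_prop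
  split_ifs
  · exact (isClosed_le continuous_const this).measurableSet
  · exact (isClosed_le this continuous_const).measurableSet

/-- the sign attached to a boolean -/
def sg (ε : Bool) : ℝ := if ε then 1 else -1

lemma half_ind (a : EuclideanSpace ℝ (Fin d)) (b : ℝ) (ε : Bool) (y : EuclideanSpace ℝ (Fin d))
    (hy : ⟪a, y⟫ - b ≠ 0) :
    (halfSpace a b ε).indicator (fun _ => (1 : ℝ)) y =
      (1 + sg ε * Real.sign (⟪a, y⟫ - b)) / 2 := by
  rcases lt_or_gt_of_ne hy with h | h
  · rw [Real.sign_of_neg h]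
    cases ε
    · rw [Set.indicator_of_mem]
      · norm_num [sg]
      · simp only [halfSpace]; simp; linarith
    · rw [Set.indicator_of_notMem]
      · norm_num [sg]
      · simp only [halfSpace]; simp; linarith
  · rw [Real.sign_of_pos h]
    cases ε
    · rw [Set.indicator_of_notMem]
      · norm_num [sg]
      · simp only [halfSpace]; simp; linarith
    · rw [Set.indicator_of_mem]
      · norm_num [sg]
      · simp only [halfSpace]; simp; linarith

lemma quad [IsFiniteMeasure μ] (hac : μ ≪ volume) {x : Fin (r + 1) × Fin (d + 1) → ℝ}
    (hx : NZ x) (i j : Fin (r + 1))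
    (h1 : ∫ y, Real.sign (L x i y) ∂μ = 0) (h2 : ∫ y, Real.sign (L x j y) ∂μ = 0)
    (h3 : ∫ y, Real.sign (L x i y) * Real.sign (L x j y) ∂μ = 0) (ε ε' : Bool) :
    μ (halfSpace (A x i) (x (i, Fin.last d)) ε ∩ halfSpace (A x j) (x (j, Fin.last d)) ε') =
      μ Set.univ / 2 ^ 2 := by
  have hI : ∀ i, Integrable (fun y => Real.sign (L x i y)) μ := fun i =>
    Integrable.mono' (integrable_const (1 : ℝ)) (S_meas x i).aestronglyMeasurable
      (Filter.Eventually.of_forall fun y => sign_abs_le _)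
  have hIJ : Integrable (fun y => Real.sign (L x i y) * Real.sign (L x j y)) μ := by
    refine Integrable.mono' (integrable_const (1 : ℝ))
      ((S_meas x i).mul (S_meas x j)).aestronglyMeasurable
      (Filter.Eventually.of_forall fun y => ?_)
    rw [Real.norm_eq_abs, abs_mul]
    exact mul_le_one₀ (sign_abs_le _) (abs_nonneg _) (sign_abs_le _)
  set R := halfSpace (A x i) (x (i, Fin.last d)) ε ∩ halfSpace (A x j) (x (j, Fin.last d)) ε'
    with hR
  have hRm : MeasurableSet R := (half_meas _ _ _).inter (half_meas _ _ _)
  have key : μ.real R = μ.real Set.univ / 4 := by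
    have e1 : μ.real R = ∫ y, R.indicator (fun _ => (1 : ℝ)) y ∂μ := by
      rw [integral_indicator hRm]; simp
    have e2 : ∫ y, R.indicator (fun _ => (1 : ℝ)) y ∂μ =
        ∫ y, (1 / 4 + sg ε / 4 * Real.sign (L x i y) + sg ε' / 4 * Real.sign (L x j y)) +
          (sg ε * sg ε' / 4) * (Real.sign (L x i y) * Real.sign (L x j y)) ∂μ := by
      apply integral_congr_ae
      filter_upwards [L_ae hac hx i, L_ae hac hx j] with y hy hy'
      have := Set.inter_indicator_mul (s := halfSpace (A x i) (x (i, Fin.last d)) ε)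
        (t := halfSpace (A x j) (x (j, Fin.last d)) ε') (fun _ => (1 : ℝ)) (fun _ => (1 : ℝ)) y
      rw [one_mul] at this
      rw [hR, this, half_ind _ _ _ _ hy, half_ind _ _ _ _ hy']
      unfold L
      ring
    rw [e1, e2, integral_add, integral_add, integral_add, integral_const_mul, integral_const_mul,
      integral_const_mul, h1, h2, h3]
    · simp; ring
    · exact integrable_const _
    · exact (hI i).const_mul _
    · exact (integrable_const _).add ((hI i).const_mul _)
    · exact (hI j).const_mul _
    · exact ((integrable_const _).add ((hI i).const_mul _)).add ((hI j).const_mul _)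
    · exact hIJ.const_mul _
  have hne : μ Set.univ / 2 ^ 2 ≠ ⊤ := ENNReal.div_ne_top (measure_ne_top _ _) (by norm_num)
  rw [← ENNReal.toReal_eq_toReal_iff' (measure_ne_top _ _) hne]
  rw [ENNReal.toReal_div]
  simp only [measureReal_def] at key
  rw [key]
  norm_num

lemma A_ne [IsFiniteMeasure μ] (hμ : μ ≠ 0) {x : Fin (r + 1) × Fin (d + 1) → ℝ}
    (hx : NZ x) (i : Fin (r + 1)) (h1 : ∫ y, Real.sign (L x i y) ∂μ = 0) : A x i ≠ 0 := by
  intro h0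
  have hb : x (i, Fin.last d) ≠ 0 := (NZ_ne hx i).resolve_left (fun h => h h0)
  have h2 : ∀ y, L x i y = - x (i, Fin.last d) := by intro y; simp [L, h0]
  simp only [h2, integral_const, smul_eq_mul] at h1
  rcases mul_eq_zero.1 h1 with h | h
  · rw [measureReal_eq_zero_iff] at h
    exact hμ (Measure.measure_univ_eq_zero.1 h)
  · rw [Real.sign_eq_zero_iff] at h
    exact hb (by linarith)

end EquiGeo

namespace EquiGeo
open EquiTop

/-- index type of the test functions -/
abbrev JJ (r : ℕ) (c : Fin (r + 1) → ℕ) : Type :=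
  (Σ i : Fin (r + 1), Fin (c i)) ⊕
    (Σ i : Fin (r + 1), (↥(Finset.Ioi i)) × Option (Fin (c i)))

/-- characters of the test functions -/
def ch (r : ℕ) (c : Fin (r + 1) → ℕ) : JJ r c → Fin (r + 1) → ZMod 2
  | Sum.inl p => Pi.single p.1 1
  | Sum.inr p => Pi.single p.1 1 + Pi.single (p.2.1 : Fin (r + 1)) 1

/-- the test functions -/
def tf {d n : ℕ} (ν : Fin n → Measure (EuclideanSpace ℝ (Fin d))) (r : ℕ) (c : Fin (r + 1) → ℕ)
    (hc : ∀ i, c i ≤ n) : JJ r c → (Fin (r + 1) × Fin (d + 1) → ℝ) → ℝ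
  | Sum.inl p => fun x => ∫ y, Real.sign (L x p.1 y) ∂(ν (Fin.castLE (hc p.1) p.2))
  | Sum.inr ⟨i, j, none⟩ => fun x => ⟪A x i, A x j⟫
  | Sum.inr ⟨i, j, some m⟩ => fun x =>
      ∫ y, Real.sign (L x i y) * Real.sign (L x j y) ∂(ν (Fin.castLE (hc i) m))

lemma ch_prod (r : ℕ) (c : Fin (r + 1) → ℕ) :
    (∏ j, ∑ i, MvPolynomial.C (ch r c j i) *
      (MvPolynomial.X i : MvPolynomial (Fin (r + 1)) (ZMod 2))) =
    (∏ i, MvPolynomial.X i ^ c i) * ∏ i, ∏ j ∈ Finset.Ioi i,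
      ((MvPolynomial.X i : MvPolynomial (Fin (r + 1)) (ZMod 2)) + MvPolynomial.X j) ^ (c i + 1) := by
  have hs : ∀ i : Fin (r + 1), ∑ i', MvPolynomial.C ((Pi.single i 1 : Fin (r + 1) → ZMod 2) i') *
      (MvPolynomial.X i' : MvPolynomial (Fin (r + 1)) (ZMod 2)) = MvPolynomial.X i := by
    intro i
    rw [Finset.sum_eq_single i]
    · simp
    · intro b _ hb; simp [Pi.single_eq_of_ne hb]
    · simp
  rw [Fintype.prod_sum_type, Fintype.prod_sigma, Fintype.prod_sigma]
  congr 1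
  · refine Finset.prod_congr rfl fun i _ => ?_
    simp only [ch, hs]
    simp
  · refine Finset.prod_congr rfl fun i _ => ?_
    rw [Fintype.prod_prod_type]
    simp only [ch, Pi.add_apply, map_add, add_mul, Finset.sum_add_distrib, hs]
    simp only [Finset.prod_const, Finset.card_univ, Fintype.card_option, Fintype.card_fin]
    exact Finset.prod_coe_sort (Finset.Ioi i) (fun j =>
      ((MvPolynomial.X i : MvPolynomial (Fin (r + 1)) (ZMod 2)) + MvPolynomial.X j) ^ (c i + 1))

lemma single_eq_zero_iff {r : ℕ} (i i' : Fin (r + 1)) :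
    (Pi.single i 1 : Fin (r + 1) → ZMod 2) i' = 0 ↔ i ≠ i' := by
  by_cases h : i = i'
  · subst h; simp
  · simp [Pi.single_eq_of_ne (Ne.symm h), h]

theorem geo {r d n : ℕ} (ν : Fin n → Measure (EuclideanSpace ℝ (Fin d)))
    (hfin : ∀ m, IsFiniteMeasure (ν m)) (hac : ∀ m, ν m ≪ volume) (hne : ∀ m, ν m ≠ 0)
    (c : Fin (r + 1) → ℕ) (hc : ∀ i, c i ≤ n) (hc0 : ∀ i, 0 < c i)
    (e : Fin (r + 1) →₀ ℕ) (he : ∀ i, e i ≤ d)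
    (hcoef : MvPolynomial.coeff e ((∏ i, MvPolynomial.X i ^ c i) * ∏ i, ∏ j ∈ Finset.Ioi i,
      ((MvPolynomial.X i : MvPolynomial (Fin (r + 1)) (ZMod 2)) +
        MvPolynomial.X j) ^ (c i + 1)) ≠ 0) :
    ∃ (a : Fin (r + 1) → EuclideanSpace ℝ (Fin d)) (b : Fin (r + 1) → ℝ),
      (∀ i, a i ≠ 0) ∧ (∀ i j, i ≠ j → ⟪a i, a j⟫ = (0 : ℝ)) ∧
      ∀ i j, i < j → ∀ m : Fin n, (m : ℕ) < c i → (m : ℕ) < c j → ∀ ε ε' : Bool,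
        ν m (halfSpace (a i) (b i) ε ∩ halfSpace (a j) (b j) ε') = ν m Set.univ / 2 ^ 2 := by
  obtain ⟨x, hx, hz⟩ := borsukUlam (tf ν r c hc) (ch r c) (by
      rintro (p | ⟨i, j, _ | m⟩) x hx
      · exact cont1 (hac _) hx _
      · have h1 := A_cont (d := d) i
        have h2 := A_cont (d := d) (j : Fin (r + 1))
        exact (h1.inner h2).continuousAt
      · exact cont2 (hac _) hx _ _) (by
      rintro (p | ⟨i, j, _ | m⟩) i' x hx
      · simp only [tf, ch, S_flip, single_eq_zero_iff]
        by_cases h : p.1 = i'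
        · simp [h, integral_neg]
        · simp [h]
      · have hij : i ≠ j := (Finset.mem_Ioi.1 j.2).ne
        simp only [tf, ch, A_flip, Pi.add_apply]
        by_cases h : i = i'
        · subst h
          simp [hij, hij.symm, Pi.single_eq_of_ne hij]
        · by_cases h' : (j : Fin (r + 1)) = i'
          · subst h'
            simp [h, Pi.single_eq_of_ne (Ne.symm h)]
          · simp [h, h', Pi.single_eq_of_ne (Ne.symm h), Pi.single_eq_of_ne (Ne.symm h')]
      · have hij : i ≠ j := (Finset.mem_Ioi.1 j.2).ne
        simp only [tf, ch, S_flip, Pi.add_apply]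
        by_cases h : i = i'
        · subst h
          simp [hij, hij.symm, Pi.single_eq_of_ne hij, integral_neg]
        · by_cases h' : (j : Fin (r + 1)) = i'
          · subst h'
            simp [h, Pi.single_eq_of_ne (Ne.symm h), integral_neg]
          · simp [h, h', Pi.single_eq_of_ne (Ne.symm h), Pi.single_eq_of_ne (Ne.symm h')])
      e he (by rw [ch_prod]; exact hcoef)
  have hs : ∀ i, ∀ m : Fin n, (m : ℕ) < c i → ∫ y, Real.sign (L x i y) ∂(ν m) = 0 := by
    intro i m hm
    exact hz (Sum.inl ⟨i, ⟨m, hm⟩⟩)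
  have ho : ∀ i j, i < j → ⟪A x i, A x j⟫ = (0 : ℝ) := by
    intro i j hij
    exact hz (Sum.inr ⟨i, ⟨j, Finset.mem_Ioi.2 hij⟩, none⟩)
  refine ⟨A x, fun i => x (i, Fin.last d), ?_, ?_, ?_⟩
  · intro i
    exact A_ne (hne ⟨0, (hc0 i).trans_le (hc i)⟩) hx i (hs i _ (hc0 i))
  · intro i j hij
    rcases lt_or_gt_of_ne hij with h | h
    · exact ho i j h
    · rw [real_inner_comm]; exact ho j i h
  · intro i j hij m hmi hmj ε ε'
    exact quad (hac m) hx i j (hs i m hmi) (hs j m hmj)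
      (hz (Sum.inr ⟨i, ⟨j, Finset.mem_Ioi.2 hij⟩, some ⟨m, hmi⟩⟩)) ε ε'

lemma region_pair {d k : ℕ} (a : Fin k → EuclideanSpace ℝ (Fin d)) (b : Fin k → ℝ)
    (i j : Fin k) (ε : Fin k → Bool) :
    region a b {i, j} ε = halfSpace (a i) (b i) (ε i) ∩ halfSpace (a j) (b j) (ε j) := by
  unfold region
  rw [Finset.set_biInter_insert, Finset.set_biInter_singleton]

lemma pair_of_card {k : ℕ} (s : Finset (Fin k)) (hs : s.card = 2) :
    ∃ i j, i < j ∧ s = {i, j} := by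
  obtain ⟨i, j, hij, rfl⟩ := Finset.card_eq_two.1 hs
  rcases lt_or_gt_of_ne hij with h | h
  · exact ⟨i, j, h, rfl⟩
  · exact ⟨j, i, h, Finset.pair_comm _ _⟩

end EquiGeo

theorem stmt_7 (k q t : ℕ) (hk : 2 ≤ k) (hq : 1 ≤ q) (ht1 : 2 ≤ t) (ht2 : t ≤ 2 ^ q)
    (d : ℕ) (hd : d = 2 ^ q * (k + 1) - t)
    (μ : Fin (2 ^ (q + 1) - 2) → Measure (EuclideanSpace ℝ (Fin d)))
    (hfin : ∀ r, IsFiniteMeasure (μ r))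
    (hac : ∀ r, μ r ≪ volume) :
    ∃ (a : Fin k → EuclideanSpace ℝ (Fin d)) (b : Fin k → ℝ),
      (∀ i, a i ≠ 0) ∧
      (∀ i j, i ≠ j → ⟪a i, a j⟫ = (0 : ℝ)) ∧
      -- (i) any two of H₁, …, H_k equipartition the first 2^(q+1) - t masses
      (∀ r : Fin (2 ^ (q + 1) - 2), (r : ℕ) < 2 ^ (q + 1) - t →
        ∀ s : Finset (Fin k), s.card = 2 → ∀ ε : Fin k → Bool,
          μ r (region a b s ε) = μ r Set.univ / 2 ^ 2) ∧
      -- (ii) any two of H₂, …, H_k equipartition the remaining t - 2 masses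
      (∀ r : Fin (2 ^ (q + 1) - 2), 2 ^ (q + 1) - t ≤ (r : ℕ) →
        ∀ s : Finset (Fin k), s.card = 2 → (∀ i ∈ s, (i : ℕ) ≠ 0) →
          ∀ ε : Fin k → Bool,
            μ r (region a b s ε) = μ r Set.univ / 2 ^ 2) := by
  classical
  obtain ⟨r, rfl⟩ : ∃ r, k = r + 1 := ⟨k - 1, by omega⟩
  have hN : 2 ^ (q + 1) = 2 * 2 ^ q := by ring
  let ν : Fin (2 ^ (q + 1) - 2) → Measure (EuclideanSpace ℝ (Fin d)) := fun m =>
    if μ m = 0 then volume.restrict (Metric.ball 0 1) else μ m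
  have hνfin : ∀ m, IsFiniteMeasure (ν m) := by
    intro m
    simp only [ν]
    split_ifs
    · exact ⟨by rw [Measure.restrict_apply_univ]; exact measure_ball_lt_top⟩
    · exact hfin m
  have hνac : ∀ m, ν m ≪ volume := by
    intro m
    simp only [ν]
    split_ifs
    · exact Measure.restrict_le_self.absolutelyContinuous
    · exact hac m
  have hνne : ∀ m, ν m ≠ 0 := by
    intro m
    simp only [ν]
    split_ifs with h
    · rw [Ne, Measure.restrict_eq_zero]
      exact (Metric.measure_ball_pos _ _ one_pos).ne'
    · exact h
  let c : Fin (r + 1) → ℕ := fun i => if i = 0 then 2 ^ (q + 1) - t else 2 ^ (q + 1) - 2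
  have hcoef := EquiPoly.coeff_main r q t ht1 ht2 c (fun i => rfl) d hd
    (Finsupp.equivFunOnFinite.symm fun i => d - (i : ℕ)) (fun i => rfl)
  obtain ⟨a, b, h1, h2, h3⟩ := EquiGeo.geo ν hνfin hνac hνne c
    (by intro i; simp only [c]; split_ifs <;> omega)
    (by intro i; simp only [c]; split_ifs <;> omega) _ (fun i => Nat.sub_le _ _)
    (by rw [hcoef]; exact one_ne_zero)
  have h4 : ∀ i j, i < j → ∀ m : Fin (2 ^ (q + 1) - 2), (m : ℕ) < c i → (m : ℕ) < c j →
      ∀ ε : Fin (r + 1) → Bool, μ m (region a b {i, j} ε) = μ m Set.univ / 2 ^ 2 := by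
    intro i j hij m hi hj ε
    by_cases h : μ m = 0
    · simp [h]
    · have h5 := h3 i j hij m hi hj (ε i) (ε j)
      simp only [ν, if_neg h] at h5
      rw [EquiGeo.region_pair]
      exact h5
  refine ⟨a, b, h1, h2, ?_, ?_⟩
  · intro m hm s hs ε
    obtain ⟨i, j, hij, rfl⟩ := EquiGeo.pair_of_card s hs
    exact h4 i j hij m (by simp only [c]; split_ifs <;> omega)
      (by simp only [c]; split_ifs <;> omega) ε
  · intro m hm s hs h0 ε
    obtain ⟨i, j, hij, rfl⟩ := EquiGeo.pair_of_card s hs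
    have hi : i ≠ 0 := fun h => h0 i (by simp) (by rw [h]; rfl)
    have hj : j ≠ 0 := fun h => h0 j (by simp) (by rw [h]; rfl)
    exact h4 i j hij m (by simp only [c]; rw [if_neg hi]; exact m.2)
      (by simp only [c]; rw [if_neg hj]; exact m.2) ε
end
end

section
/- Let q ≥ 0 and 1 ≤ t ≤ 2^q be integers and let d = 7·2^q − 2t. For any 2^{q+1} − 1 masses μ_1, …, μ_{2^{q+1}−1} on ℝ^d there exist four hyperplanes H_1, H_2, H_3, H_4 in ℝ^d such that (i) any three of H_1, H_2, H_3, H_4 equipartition each of the first 2^{q+1} − t masses μ_1, …, μ_{2^{q+1}−t}, and (ii) any two of H_2, H_3, H_4 equipartition each of the remaining t − 1 masses μ_{2^{q+1}−t+1}, …, μ_{2^{q+1}−1}. -/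
open MeasureTheory RealInnerProductSpace

noncomputable section

set_option linter.all false
namespace EqPart
open Finset
open Finset

section Comb
variable {ι κ : Type} [Fintype κ] [DecidableEq κ] [DecidableEq ι]

/-- negate the coordinates of block `b`. -/
def flipB {R : Type} [Neg R] (β : κ → ι) (b : ι) (x : κ → R) : κ → R :=
  fun c => if β c = b then - x c else x c

def fc (k j : ℕ) : ℕ := if j < k then j else j + 1

/-- the vertices of a simplex of the symmetric Kuhn triangulation. -/
def vert {N : ℕ} (s : κ → ℤˣ) (w : κ → ℕ) (π : Fin N ≃ κ) (k : ℕ) : κ → ℤ :=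
  fun c => (s c : ℤ) * ((w c : ℤ) + if (π.symm c : ℕ) < k then 1 else 0)

def simps (κ : Type) [Fintype κ] [DecidableEq κ] (N n : ℕ) :
    Finset ((κ → ℤˣ) × (κ → ℕ) × (Fin N ≃ κ)) :=
  univ ×ˢ (Fintype.piFinset (fun _ => range n) ×ˢ univ)

lemma mem_simps {N n : ℕ} (σ : (κ → ℤˣ) × (κ → ℕ) × (Fin N ≃ κ)) :
    σ ∈ simps κ N n ↔ ∀ c, σ.2.1 c < n := by
  simp [simps, Fintype.mem_piFinset]

def vt {N : ℕ} (σ : (κ → ℤˣ) × (κ → ℕ) × (Fin N ≃ κ)) : ℕ → κ → ℤ := vert σ.1 σ.2.1 σ.2.2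

lemma abs_unit_mul (u : ℤˣ) (z : ℤ) : |(u : ℤ) * z| = |z| := by
  rcases Int.units_eq_one_or u with h | h <;> simp [h]

lemma vt_abs_le {N n : ℕ} (σ : (κ → ℤˣ) × (κ → ℕ) × (Fin N ≃ κ)) (h : σ ∈ simps κ N n)
    (k : ℕ) (c : κ) : |vt σ k c| ≤ n := by
  have := (mem_simps σ).1 h c
  unfold vt vert
  rw [abs_unit_mul, abs_of_nonneg (by split_ifs <;> positivity)]
  split_ifs <;> omega

section stokes
variable {N n : ℕ} (β : κ → ι) (c : (ℕ → κ → ℤ) → ZMod 2)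
  (hloc : ∀ v v' : ℕ → κ → ℤ, (∀ j < N + 1, v j = v' j) → c v = c v')
  (hinv : ∀ b (v : ℕ → κ → ℤ), (∀ j < N + 1, ∀ i, |v j i| ≤ n) →
    (∀ j < N + 1, ∃ i, β i = b ∧ |v j i| = n) → c (fun j => flipB β b (v j)) = c v)
include hloc

lemma stokes_mid (k : ℕ) (h0 : 0 < k) (hk : k < N + 1) :
    ∑ σ ∈ simps κ (N + 1) n, c (fun j => vt σ (fc k j)) = 0 := by
  have hne : (⟨k - 1, by omega⟩ : Fin (N + 1)) ≠ ⟨k, hk⟩ := by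
    intro h; rw [Fin.mk.injEq] at h; omega
  set τ : Equiv.Perm (Fin (N + 1)) := Equiv.swap ⟨k - 1, by omega⟩ ⟨k, hk⟩ with hτ
  refine Finset.sum_involution (fun σ _ => (σ.1, σ.2.1, τ.trans σ.2.2)) ?_ ?_ ?_ ?_
  · intro σ hσ
    rw [hloc (fun j => vt (σ.1, σ.2.1, τ.trans σ.2.2) (fc k j)) (fun j => vt σ (fc k j)),
      CharTwo.add_self_eq_zero]
    intro j _
    have hj : fc k j ≠ k := by unfold fc; split_ifs <;> omega
    generalize fc k j = p at hj
    funext i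
    have : ((τ (σ.2.2.symm i) : Fin (N + 1)) : ℕ) < p ↔ ((σ.2.2.symm i : Fin (N + 1)) : ℕ) < p := by
      rw [hτ, Equiv.swap_apply_def]
      split_ifs with h1 h2
      · rw [h1]; simp; omega
      · rw [h2]; simp; omega
      · rfl
    have h2 : (τ.trans σ.2.2).symm i = τ (σ.2.2.symm i) := by
      simp [hτ]
    simp only [vt, vert, h2, this]
  · intro σ hσ _ h
    have h3 : τ.trans σ.2.2 = σ.2.2 := congrArg (fun z => z.2.2) h
    have h4 := congrArg (fun e : Fin (N + 1) ≃ κ => e ⟨k, hk⟩) h3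
    simp [hτ] at h4
    omega
  · intro σ hσ; rw [mem_simps] at hσ ⊢; exact hσ
  · intro σ hσ
    ext1
    · rfl
    ext1
    · rfl
    · ext j; simp [hτ]

lemma stokes_last :
    ∑ σ ∈ simps κ (N + 1) n with ¬ (0 < σ.2.1 (σ.2.2 (Fin.last N))),
      c (fun j => vt σ (fc (N + 1) j)) = 0 := by
  refine Finset.sum_involution
    (fun σ _ => (Function.update σ.1 (σ.2.2 (Fin.last N)) (- σ.1 (σ.2.2 (Fin.last N))), σ.2.1, σ.2.2)) ?_ ?_ ?_ ?_
  · intro σ hσ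
    rw [hloc (fun j => vt (Function.update σ.1 (σ.2.2 (Fin.last N)) (- σ.1 (σ.2.2 (Fin.last N))), σ.2.1, σ.2.2)
      (fc (N + 1) j)) (fun j => vt σ (fc (N + 1) j)), CharTwo.add_self_eq_zero]
    intro j hj
    funext i
    simp only [mem_filter, not_lt, nonpos_iff_eq_zero] at hσ
    simp only [vt, vert]
    by_cases h : i = σ.2.2 (Fin.last N)
    · subst h
      have : ¬ (N < fc (N + 1) j) := by unfold fc; split_ifs <;> omega
      simp [hσ.2, this]
    · simp [h]
  · intro σ hσ _ h
    have h4 := congrFun (congrArg (fun z => z.1) h) (σ.2.2 (Fin.last N))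
    simp at h4
  · intro σ hσ; simp only [mem_filter, mem_simps] at hσ ⊢; exact hσ
  · intro σ hσ
    ext1
    · funext i
      by_cases h : i = σ.2.2 (Fin.last N)
      · subst h; simp
      · simp [h]
    · rfl

include hinv in
lemma stokes_first :
    ∑ σ ∈ simps κ (N + 1) n with ¬ (σ.2.1 (σ.2.2 0) + 1 < n),
      c (fun j => vt σ (fc 0 j)) = 0 := by
  refine Finset.sum_involution
    (fun σ _ => (flipB β (β (σ.2.2 0)) σ.1, σ.2.1, σ.2.2)) ?_ ?_ ?_ ?_
  · intro σ hσ
    simp only [mem_filter] at hσ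
    have hw := (mem_simps σ).1 hσ.1 (σ.2.2 0)
    rw [hloc (fun j => vt (flipB β (β (σ.2.2 0)) σ.1, σ.2.1, σ.2.2) (fc 0 j))
      (fun j => flipB β (β (σ.2.2 0)) (vt σ (fc 0 j))), hinv, CharTwo.add_self_eq_zero]
    · intro j hj i
      exact vt_abs_le σ hσ.1 _ _
    · intro j hj
      refine ⟨σ.2.2 0, rfl, ?_⟩
      unfold vt vert
      rw [abs_unit_mul]
      have : fc 0 j = j + 1 := by simp [fc]
      simp only [Equiv.symm_apply_apply, this]
      simp
      rw [abs_of_nonneg (by positivity)]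
      omega
    · intro j hj
      funext i
      simp only [vt, vert, flipB]
      split_ifs <;> simp
  · intro σ hσ _ h
    have h4 := congrFun (congrArg (fun z => z.1) h) (σ.2.2 0)
    simp [flipB] at h4
  · intro σ hσ; simp only [mem_filter, mem_simps] at hσ ⊢; exact hσ
  · intro σ hσ
    ext1
    · funext i
      simp only [flipB]
      split_ifs <;> simp
    · rfl

lemma stokes_bij :
    ∑ σ ∈ simps κ (N + 1) n with (σ.2.1 (σ.2.2 0) + 1 < n), c (fun j => vt σ (fc 0 j)) =
    ∑ σ ∈ simps κ (N + 1) n with (0 < σ.2.1 (σ.2.2 (Fin.last N))),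
      c (fun j => vt σ (fc (N + 1) j)) := by
  have hr : ∀ j : Fin (N + 1), finRotate (N + 1) j = j + 1 := finRotate_apply
  have hl0 : finRotate (N + 1) (Fin.last N) = 0 := by simp
  have hl1 : (finRotate (N + 1)).symm 0 = Fin.last N := by rw [Equiv.symm_apply_eq]; simp
  refine Finset.sum_bij'
    (fun σ _ => (σ.1, Function.update σ.2.1 (σ.2.2 0) (σ.2.1 (σ.2.2 0) + 1), (finRotate (N + 1)).trans σ.2.2))
    (fun σ _ => (σ.1, Function.update σ.2.1 (σ.2.2 (Fin.last N)) (σ.2.1 (σ.2.2 (Fin.last N)) - 1), (finRotate (N + 1)).symm.trans σ.2.2)) ?_ ?_ ?_ ?_ ?_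
  · intro σ hσ
    simp only [mem_filter, mem_simps] at hσ ⊢
    refine ⟨fun i => ?_, ?_⟩
    · by_cases h : i = σ.2.2 0
      · subst h; simp [hσ.2]
      · simp [h, hσ.1 i]
    · simp only [Equiv.trans_apply, hl0]; simp
  · intro σ hσ
    simp only [mem_filter, mem_simps] at hσ ⊢
    refine ⟨fun i => ?_, ?_⟩
    · by_cases h : i = σ.2.2 (Fin.last N)
      · subst h; simp; have := hσ.1 (σ.2.2 (Fin.last N)); omega
      · simp [h, hσ.1 i]
    · simp only [Equiv.trans_apply, hl1]; simp
      have := hσ.1 (σ.2.2 (Fin.last N)); omega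
  · intro σ hσ
    ext1
    · rfl
    ext1
    · funext i
      simp only [Equiv.trans_apply, hl0]
      by_cases h : i = σ.2.2 0
      · subst h; simp
      · simp [h]
    · ext j; simp
  · intro σ hσ
    simp only [mem_filter, mem_simps] at hσ
    ext1
    · rfl
    ext1
    · funext i
      simp only [Equiv.trans_apply, hl1]
      by_cases h : i = σ.2.2 (Fin.last N)
      · subst h; simp; omega
      · simp [h]
    · ext j; simp
  · intro σ hσ
    apply hloc
    intro j hj
    have e1 : fc 0 j = j + 1 := by simp [fc]
    have e2 : fc (N + 1) j = j := by simp [fc, hj]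
    rw [e1, e2]
    funext i
    simp only [vt, vert]
    congr 1
    obtain ⟨p, rfl⟩ := σ.2.2.surjective i
    simp only [Equiv.symm_apply_apply, Equiv.symm_trans_apply]
    by_cases hp : p = 0
    · subst hp
      rw [hl1]
      simp; omega
    · have hne : σ.2.2 p ≠ σ.2.2 0 := fun h => hp (σ.2.2.injective h)
      rw [Function.update_of_ne hne]
      obtain ⟨q, rfl⟩ := Fin.exists_succ_eq.2 hp
      have : (finRotate (N + 1)).symm q.succ = q.castSucc := by
        rw [Equiv.symm_apply_eq, hr]; simp
      rw [this]; simp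

include hinv in
theorem stokes :
    ∑ σ ∈ simps κ (N + 1) n, ∑ k ∈ range (N + 2), c (fun j => vt σ (fc k j)) = 0 := by
  rw [Finset.sum_comm, Finset.sum_range_succ, Finset.sum_range_succ']
  rw [Finset.sum_eq_zero, zero_add]
  · rw [← Finset.sum_filter_add_sum_filter_not (simps κ (N + 1) n) (fun σ => σ.2.1 (σ.2.2 0) + 1 < n),
      stokes_first β c hloc hinv, add_zero,
      ← Finset.sum_filter_add_sum_filter_not (simps κ (N + 1) n) (fun σ => 0 < σ.2.1 (σ.2.2 (Fin.last N))),
      stokes_last c hloc, add_zero, stokes_bij c hloc, CharTwo.add_self_eq_zero]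
  · intro k hk
    rw [mem_range] at hk
    exact stokes_mid c hloc (k + 1) (by omega) (by omega)
end stokes


/-- cup product of the one-cocycles `δ (Λ j)`, `j < r`. -/
def cup {X : Type} (Λ : ℕ → X → ZMod 2) (r : ℕ) (v : ℕ → X) : ZMod 2 :=
  ∏ j ∈ range r, (Λ j (v j) + Λ j (v (j + 1)))

def dd {X : Type} (Λ : ℕ → X → ZMod 2) (m : ℕ) (h : X → ZMod 2) (r : ℕ) (v : ℕ → X) : ZMod 2 :=
  cup Λ m v * h (v m) * cup (fun j => Λ (m + 1 + j)) r (fun j => v (m + j))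

lemma cup_succ {X : Type} (Λ : ℕ → X → ZMod 2) (r : ℕ) (v : ℕ → X) :
    cup Λ (r + 1) v =
      (Λ 0 (v 0) + Λ 0 (v 1)) * cup (fun j => Λ (j + 1)) r (fun j => v (j + 1)) := by
  unfold cup; rw [prod_range_succ', mul_comm]

lemma cup_cocycle {X : Type} (r : ℕ) : ∀ (Λ : ℕ → X → ZMod 2) (v : ℕ → X),
    ∑ k ∈ range (r + 2), cup Λ r (fun j => v (fc k j)) = 0 := by
  induction r with
  | zero => intro Λ v; simp [cup]; decide
  | succ r ih =>
    intro Λ v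
    have h1 := ih (fun j => Λ (j + 1)) (fun j => v (j + 1))
    rw [sum_range_succ'] at h1
    rw [sum_range_succ', sum_range_succ']
    simp only [cup_succ]
    have e : ∀ k j, fc (k + 1) (j + 1) = fc k j + 1 := by
      intro k j; unfold fc; split_ifs <;> omega
    have e0 : ∀ j, fc 0 j = j + 1 := by intro j; simp [fc]
    have e1 : ∀ k, fc (k + 1) 0 = 0 := by intro j; simp [fc]
    have e2 : ∀ k, fc (k + 1 + 1) 1 = 1 := by intro j; simp [fc]
    have e3 : fc (0 + 1) 1 = 2 := by simp [fc]
    simp only [e, e0, e1, e2, e3, ← mul_sum] at h1 ⊢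
    rw [eq_neg_of_add_eq_zero_left h1]
    have h2 : (2 : ZMod 2) = 0 := by decide
    simp only [zero_add, Nat.reduceAdd]
    linear_combination (Λ 0 (v 2) * cup (fun j => Λ (j + 1)) r (fun j => v (j + 1 + 1))) * h2

lemma dd_succ {X : Type} (Λ : ℕ → X → ZMod 2) (m : ℕ) (h : X → ZMod 2) (r : ℕ) (v : ℕ → X) :
    dd Λ (m + 1) h r v =
      (Λ 0 (v 0) + Λ 0 (v 1)) * dd (fun j => Λ (j + 1)) m h r (fun j => v (j + 1)) := by
  unfold dd
  rw [cup_succ]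
  have e1 : ∀ j, m + 1 + 1 + j = m + 1 + j + 1 := by intro j; omega
  have e2 : ∀ j, m + 1 + j = m + j + 1 := by intro j; omega
  have : (fun j => v (m + 1 + j)) = fun j => v (m + j + 1) := by funext j; rw [e2]
  rw [this]
  simp only [e1]
  ring

lemma dd_leibniz {X : Type} (m : ℕ) (h : X → ZMod 2) (r : ℕ) :
    ∀ (Λ : ℕ → X → ZMod 2) (v : ℕ → X),
    ∑ k ∈ range (m + r + 2), dd Λ m h r (fun j => v (fc k j)) =
      cup Λ m v * (h (v m) + h (v (m + 1))) *
        cup (fun j => Λ (m + 1 + j)) r (fun j => v (m + 1 + j)) := by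
  have e : ∀ k j, fc (k + 1) (j + 1) = fc k j + 1 := by
    intro k j; unfold fc; split_ifs <;> omega
  have e0 : ∀ j, fc 0 j = j + 1 := by intro j; simp [fc]
  have e1 : ∀ k, fc (k + 1) 0 = 0 := by intro j; simp [fc]
  have e2 : ∀ k, fc (k + 1 + 1) 1 = 1 := by intro j; simp [fc]
  have e3 : fc (0 + 1) 1 = 2 := by simp [fc]
  have h2 : (2 : ZMod 2) = 0 := by decide
  induction m with
  | zero =>
    intro Λ v
    have h1 := cup_cocycle r (fun j => Λ (j + 1)) v
    rw [sum_range_succ'] at h1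
    simp only [zero_add, dd]
    rw [sum_range_succ']
    simp only [e0, e1, cup, range_zero, prod_empty, one_mul, zero_add] at h1 ⊢
    simp only [add_comm 1, ← mul_sum]
    rw [eq_neg_of_add_eq_zero_left h1]
    linear_combination (- h (v 0) * ∏ j ∈ range r, (Λ (j + 1) (v (j + 1)) + Λ (j + 1) (v (j + 1 + 1)))) * h2
  | succ m ih =>
    intro Λ v
    have h1 := ih (fun j => Λ (j + 1)) (fun j => v (j + 1))
    rw [sum_range_succ'] at h1
    rw [show m + 1 + r + 2 = m + r + 1 + 1 + 1 by omega, sum_range_succ', sum_range_succ']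
    simp only [dd_succ, cup_succ]
    simp only [e, e0, e1, e2, e3, ← mul_sum] at h1 ⊢
    rw [eq_sub_of_add_eq h1]
    have e4 : ∀ j, m + 1 + 1 + j = m + 1 + j + 1 := by intro j; omega
    simp only [zero_add, Nat.reduceAdd, e4]
    linear_combination (Λ 0 (v 2) * dd (fun j => Λ (j + 1)) m h r (fun j => v (j + 1 + 1))) * h2

def Eqv (β : κ → ι) (n : ℕ) (χ : ι → ZMod 2) (l : (κ → ℤ) → ZMod 2) : Prop :=
  ∀ b x, (∀ i, |x i| ≤ (n : ℤ)) → (∃ i, β i = b ∧ |x i| = (n : ℤ)) → l (flipB β b x) = l x + χ b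

lemma cup_congr {X : Type} {Λ Λ' : ℕ → X → ZMod 2} {r : ℕ} {v v' : ℕ → X}
    (h : ∀ j < r, Λ j (v j) + Λ j (v (j + 1)) = Λ' j (v' j) + Λ' j (v' (j + 1))) :
    cup Λ r v = cup Λ' r v' := by
  unfold cup; exact prod_congr rfl (fun j hj => h j (mem_range.1 hj))

lemma cup_split {X : Type} (Λ : ℕ → X → ZMod 2) (m r : ℕ) (v : ℕ → X) :
    cup Λ (m + r + 1) v = cup Λ m v * (Λ m (v m) + Λ m (v (m + 1))) *
        cup (fun j => Λ (m + 1 + j)) r (fun j => v (m + 1 + j)) := by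
  unfold cup
  rw [show m + r + 1 = m + 1 + r by omega, prod_range_add, prod_range_succ]; rfl

theorem inv_step {N n : ℕ} (β : κ → ι) (χ : ℕ → ι → ZMod 2) (Λ : ℕ → (κ → ℤ) → ZMod 2)
    (hΛ : ∀ j < N, Eqv β n (χ j) (Λ j)) (m : ℕ) (hm : m < N) (l : (κ → ℤ) → ZMod 2)
    (hl : Eqv β n (χ m) l) :
    ∑ σ ∈ simps κ N n, cup (Function.update Λ m l) N (vt σ) = ∑ σ ∈ simps κ N n, cup Λ N (vt σ) := by
  obtain ⟨r, rfl⟩ : ∃ r, N = m + 1 + r := ⟨N - (m + 1), by omega⟩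
  have h2 : (2 : ZMod 2) = 0 := by decide
  set h : (κ → ℤ) → ZMod 2 := fun x => Λ m x + l x with hh
  have key := stokes (N := m + r) (n := n) β (dd Λ m h r) ?_ ?_
  · simp only [dd_leibniz] at key
    rw [← sub_eq_zero, ← sum_sub_distrib]
    rw [show m + 1 + r = m + r + 1 by omega] at *
    rw [← key]
    apply sum_congr rfl
    intro σ _
    rw [cup_split, cup_split]
    have a1 : cup (Function.update Λ m l) m (vt σ) = cup Λ m (vt σ) := by
      apply cup_congr; intro j hj
      rw [Function.update_of_ne (by omega)]
    have a2 : (fun j => Function.update Λ m l (m + 1 + j)) = fun j => Λ (m + 1 + j) := by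
      funext j
      rw [Function.update_of_ne (by omega)]
    rw [a1, a2, Function.update_self]
    simp only [hh]
    linear_combination -(cup Λ m (vt σ) * (Λ m (vt σ m) + Λ m (vt σ (m + 1))) *
        cup (fun j => Λ (m + 1 + j)) r (fun j => vt σ (m + 1 + j))) * h2
  · intro v v' hv
    unfold dd
    rw [hv m (by omega)]
    congr 1
    · congr 1
      apply cup_congr; intro j hj; rw [hv j (by omega), hv (j + 1) (by omega)]
    · apply cup_congr; intro j hj; rw [hv (m + j) (by omega), hv (m + (j + 1)) (by omega)]
  · intro b v hv hb
    unfold dd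
    congr 1
    · congr 1
      · apply cup_congr; intro j hj
        rw [hΛ j (by omega) b _ (hv j (by omega)) (hb j (by omega)),
          hΛ j (by omega) b _ (hv (j + 1) (by omega)) (hb (j + 1) (by omega))]
        linear_combination χ j b * h2
      · simp only [hh]
        rw [hΛ m (by omega) b _ (hv m (by omega)) (hb m (by omega)),
          hl b _ (hv m (by omega)) (hb m (by omega))]
        linear_combination χ m b * h2
    · apply cup_congr; intro j hj
      rw [hΛ (m + 1 + j) (by omega) b _ (hv (m + j) (by omega)) (hb (m + j) (by omega)),
          hΛ (m + 1 + j) (by omega) b _ (hv (m + (j + 1)) (by omega)) (hb (m + (j + 1)) (by omega))]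
      linear_combination χ (m + 1 + j) b * h2

theorem inv_all {N n : ℕ} (β : κ → ι) (χ : ℕ → ι → ZMod 2) (Λ Λ' : ℕ → (κ → ℤ) → ZMod 2)
    (hΛ : ∀ j < N, Eqv β n (χ j) (Λ j)) (hΛ' : ∀ j < N, Eqv β n (χ j) (Λ' j)) :
    ∑ σ ∈ simps κ N n, cup Λ N (vt σ) = ∑ σ ∈ simps κ N n, cup Λ' N (vt σ) := by
  have key : ∀ m ≤ N, ∑ σ ∈ simps κ N n, cup (fun j => if j < m then Λ' j else Λ j) N (vt σ) =
      ∑ σ ∈ simps κ N n, cup Λ N (vt σ) := by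
    intro m
    induction m with
    | zero => intro _; simp
    | succ m ih =>
      intro hm
      rw [← ih (by omega), ← inv_step β χ (fun j => if j < m then Λ' j else Λ j) _ m (by omega) (Λ' m)
        (hΛ' m (by omega))]
      · apply sum_congr rfl; intro σ _
        congr 1
        funext j
        by_cases h : j = m
        · subst h; simp
        · rw [Function.update_of_ne h]
          have : j < m + 1 ↔ j < m := by omega
          simp [this]
      · intro j hj
        split_ifs
        · exact hΛ' j hj
        · exact hΛ j hj
  rw [← key N le_rfl]
  apply sum_congr rfl; intro σ _
  apply cup_congr; intro j hj; simp [hj]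

end Comb

section Std
variable {ι : Type} [Fintype ι] [DecidableEq ι] {d : ℕ}

open Classical in
def lex (y : Fin d → ℤ) : ZMod 2 := if ∃ l, y l < 0 ∧ ∀ l' < l, y l' = 0 then 1 else 0

lemma lex_zero (y : Fin d → ℤ) (h : ∀ l, y l = 0) : lex y = 0 := by
  simp [lex, h]

lemma lex_first (y : Fin d → ℤ) (l : Fin d) (h : ∀ l' < l, y l' = 0) (hl : y l ≠ 0) :
    lex y = if y l < 0 then 1 else 0 := by
  unfold lex
  congr 1
  rw [eq_iff_iff]
  constructor
  · rintro ⟨p, hp, hp'⟩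
    rcases lt_trichotomy p l with h1 | h1 | h1
    · have := h p h1; omega
    · subst h1; exact hp
    · exact absurd (hp' l h1) hl
  · intro h1; exact ⟨l, h1, h⟩

lemma exists_first (y : Fin d → ℤ) (h : ∃ l, y l ≠ 0) :
    ∃ l, y l ≠ 0 ∧ ∀ l' < l, y l' = 0 := by
  obtain ⟨l, hl⟩ := h
  induction l using WellFoundedLT.induction with
  | ind l ih =>
    by_cases hh : ∀ l' < l, y l' = 0
    · exact ⟨l, hl, hh⟩
    · push Not at hh
      obtain ⟨p, hp, hp'⟩ := hh
      exact ih p hp hp'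

lemma lex_neg (y : Fin d → ℤ) (h : ∃ l, y l ≠ 0) : lex (fun l => - y l) = lex y + 1 := by
  obtain ⟨l, hl, hl'⟩ := exists_first y h
  rw [lex_first y l hl' hl, lex_first (fun l => - y l) l (fun p hp => by simp [hl' p hp]) (by simpa using hl)]
  split_ifs <;> first | omega | decide

def std (b : ι) (x : ι × Fin d → ℤ) : ZMod 2 := lex (fun l => x (b, l))

lemma eqv_std (n : ℕ) (hn : 0 < n) (χ : ι → ZMod 2) :
    Eqv (Prod.fst : ι × Fin d → ι) n χ (fun x => ∑ b, χ b * std b x) := by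
  rintro b x hx ⟨⟨b', l⟩, rfl, hl⟩
  have h1 : ∀ p, std p (flipB Prod.fst b' x) = std p x + if p = b' then 1 else 0 := by
    intro p
    by_cases hp : p = b'
    · subst hp
      simp only [std, flipB, if_true]
      apply lex_neg
      refine ⟨l, fun h => ?_⟩
      rw [h] at hl; simp at hl; omega
    · simp [std, flipB, hp]
  simp only [h1, mul_add, sum_add_distrib]
  simp

variable {N : ℕ}

lemma vt_eq {κ : Type} (σ : (κ → ℤˣ) × (κ → ℕ) × (Fin N ≃ κ)) (k : ℕ) (c : κ) :
    vt σ k c = (σ.1 c : ℤ) * ((σ.2.1 c : ℤ) + if (σ.2.2.symm c : ℕ) < k then 1 else 0) := rfl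

lemma unit_mul_ne (u : ℤˣ) (z : ℤ) (hz : z ≠ 0) : (u : ℤ) * z ≠ 0 := by
  rcases Int.units_eq_one_or u with h | h <;> simp [h, hz]

/-- A step outside block `b` does not change the label. -/
lemma std_step_ne (σ : (ι × Fin d → ℤˣ) × (ι × Fin d → ℕ) × (Fin N ≃ ι × Fin d)) (j : Fin N) (b : ι)
    (hb : (σ.2.2 j).1 ≠ b) : std b (vt σ j) + std b (vt σ (j + 1)) = 0 := by
  have : ∀ l, vt σ (j + 1) (b, l) = vt σ j (b, l) := by
    intro l
    rw [vt_eq, vt_eq]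
    have h1 : σ.2.2.symm (b, l) ≠ j := by
      intro h; apply hb; rw [← h]; simp
    have h2 : (σ.2.2.symm (b, l) : ℕ) ≠ j := fun h => h1 (Fin.ext h)
    have : (σ.2.2.symm (b, l) : ℕ) < j + 1 ↔ (σ.2.2.symm (b, l) : ℕ) < j := by omega
    simp [this]
  simp only [std, this]
  exact CharTwo.add_self_eq_zero _

lemma std_step_zero (σ : (ι × Fin d → ℤˣ) × (ι × Fin d → ℕ) × (Fin N ≃ ι × Fin d)) (j : Fin N) (b : ι)
    (l : Fin d) (hb : σ.2.2 j = (b, l)) (h : std b (vt σ j) + std b (vt σ (j + 1)) ≠ 0) :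
    ∀ l' ≤ l, vt σ j (b, l') = 0 := by
  by_contra hcon
  apply h
  push Not at hcon
  obtain ⟨p, hp, hp'⟩ := hcon
  obtain ⟨m, hm, hm'⟩ := exists_first (fun l => vt σ j (b, l)) ⟨p, hp'⟩
  have hj : σ.2.2.symm (b, l) = j := by rw [← hb]; simp
  have hml : m ≤ l := by
    by_contra hlt
    exact hp' (hm' p (by omega))
  have hne : ∀ q, q ≠ l → vt σ (j + 1) (b, q) = vt σ j (b, q) := by
    intro q hq
    rw [vt_eq, vt_eq]
    have h1 : σ.2.2.symm (b, q) ≠ j := by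
      intro h; rw [← hj] at h; simp at h; exact hq h
    have h2 : (σ.2.2.symm (b, q) : ℕ) ≠ j := fun h => h1 (Fin.ext h)
    have : (σ.2.2.symm (b, q) : ℕ) < j + 1 ↔ (σ.2.2.symm (b, q) : ℕ) < j := by omega
    simp [this]
  have hmm : vt σ (j + 1) (b, m) ≠ 0 ∧ (vt σ (j + 1) (b, m) < 0 ↔ vt σ j (b, m) < 0) := by
    by_cases hq : m = l
    · subst hq
      rw [vt_eq, hj] at hm ⊢
      rw [vt_eq, hj]
      simp at hm ⊢
      rcases Int.units_eq_one_or (σ.1 (b, m)) with h | h <;> simp [h] <;> omega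
    · rw [hne m hq]; exact ⟨hm, Iff.rfl⟩
  unfold std
  rw [lex_first _ m hm' hm, lex_first (fun l => vt σ (j + 1) (b, l)) m _ hmm.1]
  · simp only [hmm.2]
    exact CharTwo.add_self_eq_zero _
  · intro q hq
    rw [hne q (by omega)]; exact hm' q hq

def anti (π : Fin N ≃ ι × Fin d) : Prop := ∀ b l l', l' < l → π.symm (b, l) < π.symm (b, l')

lemma std_step_val (σ : (ι × Fin d → ℤˣ) × (ι × Fin d → ℕ) × (Fin N ≃ ι × Fin d)) (j : Fin N) (b : ι)
    (l : Fin d) (hb : σ.2.2 j = (b, l)) (hw : ∀ c, σ.2.1 c = 0) (ha : anti σ.2.2) :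
    std b (vt σ j) + std b (vt σ (j + 1)) =
      (if (σ.1 (b, l) : ℤ) < 0 then 1 else 0) +
      (if h : (l : ℕ) + 1 < d then (if (σ.1 (b, ⟨l + 1, h⟩) : ℤ) < 0 then 1 else 0) else 0) := by
  have hj : σ.2.2.symm (b, l) = j := by rw [← hb]; simp
  have hlt : ∀ q, (σ.2.2.symm (b, q) : ℕ) < j ↔ l < q := by
    intro q
    rw [← hj]
    constructor
    · intro h
      rcases lt_trichotomy l q with h1 | h1 | h1
      · exact h1
      · subst h1; omega
      · have := ha b l q h1; omega
    · intro h; exact ha b q l h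
  have hlt' : ∀ q, (σ.2.2.symm (b, q) : ℕ) < j + 1 ↔ l ≤ q := by
    intro q
    rw [Nat.lt_succ_iff_lt_or_eq, hlt, le_iff_lt_or_eq, ← Fin.ext_iff, ← hj]
    simp [eq_comm]
  have e1 : std b (vt σ (j + 1)) = if (σ.1 (b, l) : ℤ) < 0 then 1 else 0 := by
    unfold std
    rw [lex_first _ l]
    · simp [vt_eq, hlt', hw]
    · intro p hp
      simp [vt_eq, hlt', hw, hp]
    · rw [vt_eq]; apply unit_mul_ne; simp [hlt', hw]
  have e2 : std b (vt σ j) = (if h : (l : ℕ) + 1 < d then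
      (if (σ.1 (b, ⟨l + 1, h⟩) : ℤ) < 0 then 1 else 0) else 0) := by
    unfold std
    split_ifs with h h'
    · rw [lex_first _ ⟨l + 1, h⟩]
      · simp [vt_eq, hlt, hw, h', Fin.lt_def]
      · intro p hp
        have : ¬ (l < p) := by rw [Fin.lt_def] at hp ⊢; simp at hp; omega
        simp [vt_eq, hlt, hw, this]
      · rw [vt_eq]; apply unit_mul_ne; simp [hlt, hw, Fin.lt_def]
    · rw [lex_first _ ⟨l + 1, h⟩]
      · simp [vt_eq, hlt, hw, Fin.lt_def]; simpa using h'
      · intro p hp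
        have : ¬ (l < p) := by rw [Fin.lt_def] at hp ⊢; simp at hp; omega
        simp [vt_eq, hlt, hw, this]
      · rw [vt_eq]; apply unit_mul_ne; simp [hlt, hw, Fin.lt_def]
    · apply lex_zero
      intro p
      have : ¬ (l < p) := by rw [Fin.lt_def]; omega
      simp [vt_eq, hlt, hw, this]
  rw [e1, e2, add_comm]

def s0 : ι × Fin d → ℤˣ := fun c => (-1) ^ (d - (c.2 : ℕ))

lemma s0_step (k : ℕ) : (if (((-1) ^ (k + 1) : ℤˣ) : ℤ) < 0 then (1 : ZMod 2) else 0) +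
    (if (((-1) ^ k : ℤˣ) : ℤ) < 0 then (1 : ZMod 2) else 0) = 1 := by
  rcases Int.units_eq_one_or ((-1) ^ k) with h | h <;> rw [pow_succ, h] <;> decide

open Classical in
lemma std_prod (σ : (ι × Fin d → ℤˣ) × (ι × Fin d → ℕ) × (Fin N ≃ ι × Fin d)) :
    ∏ j : Fin N, (std (σ.2.2 j).1 (vt σ j) + std (σ.2.2 j).1 (vt σ (j + 1))) =
      if σ.1 = s0 ∧ (σ.2.1 = fun _ => 0) ∧ anti σ.2.2 then 1 else 0 := by
  split_ifs with h
  · obtain ⟨hs, hw, ha⟩ := h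
    apply prod_eq_one
    intro j _
    rw [std_step_val σ j (σ.2.2 j).1 (σ.2.2 j).2 rfl (fun c => by rw [hw]) ha, hs]
    generalize (σ.2.2 j).2 = l
    unfold s0
    dsimp only
    by_cases h1 : (l : ℕ) + 1 < d
    · rw [dif_pos h1, show d - (l : ℕ) = (d - (l + 1)) + 1 by omega]
      exact s0_step _
    · rw [dif_neg h1, show d - (l : ℕ) = 1 by omega]
      simp
  · by_contra hne
    apply h
    have hne' : ∀ j : Fin N, std (σ.2.2 j).1 (vt σ j) + std (σ.2.2 j).1 (vt σ (j + 1)) ≠ 0 :=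
      fun j => Finset.prod_ne_zero_iff.1 hne j (mem_univ _)
    have hz : ∀ b l, ∀ l' ≤ l, vt σ (σ.2.2.symm (b, l)) (b, l') = 0 := by
      intro b l
      have := hne' (σ.2.2.symm (b, l))
      rw [Equiv.apply_symm_apply] at this
      exact std_step_zero σ _ b l (by simp) this
    have hw : ∀ c, σ.2.1 c = 0 := by
      rintro ⟨b, l⟩
      have := hz b l l le_rfl
      rw [vt_eq] at this
      by_contra h0
      exact unit_mul_ne _ _ (by simpa using h0) this
    have ha : anti σ.2.2 := by
      intro b l l' hl
      have := hz b l l' hl.le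
      rw [vt_eq] at this
      by_contra h0
      have h1 : σ.2.2.symm (b, l') ≠ σ.2.2.symm (b, l) := by
        intro h; simp at h; omega
      have h2 : (σ.2.2.symm (b, l') : ℕ) < σ.2.2.symm (b, l) := by
        rw [← Fin.lt_def]; exact lt_of_le_of_ne (not_lt.1 h0) h1
      exact unit_mul_ne _ _ (by simp [h2, hw]) this
    refine ⟨?_, funext hw, ha⟩
    have hstep : ∀ b l, (if (σ.1 (b, l) : ℤ) < 0 then (1 : ZMod 2) else 0) +
      (if h : (l : ℕ) + 1 < d then (if (σ.1 (b, ⟨l + 1, h⟩) : ℤ) < 0 then 1 else 0) else 0) ≠ 0 := by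
      intro b l
      have := hne' (σ.2.2.symm (b, l))
      rw [Equiv.apply_symm_apply] at this
      rwa [std_step_val σ _ b l (by simp) hw ha] at this
    have hk : ∀ k (hk : k < d) b, σ.1 (b, ⟨d - 1 - k, by omega⟩) = (-1) ^ (k + 1) := by
      intro k
      induction k with
      | zero =>
        intro hk b
        have := hstep b ⟨d - 1 - 0, by omega⟩
        rw [dif_neg (by simp; omega)] at this
        rcases Int.units_eq_one_or (σ.1 (b, ⟨d - 1 - 0, by omega⟩)) with h | h
        · rw [h] at this; simp at this
        · rw [h]; simp
      | succ k ih =>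
        intro hk b
        have := hstep b ⟨d - 1 - (k + 1), by omega⟩
        rw [dif_pos (by simp; omega)] at this
        have e : (⟨(⟨d - 1 - (k + 1), by omega⟩ : Fin d) + 1, by simp; omega⟩ : Fin d) =
          ⟨d - 1 - k, by omega⟩ := by rw [Fin.mk.injEq]; simp; omega
        rw [e, ih (by omega) b] at this
        rw [pow_succ]
        rcases Int.units_eq_one_or (σ.1 (b, ⟨d - 1 - (k + 1), by omega⟩)) with h | h <;>
        rcases Int.units_eq_one_or ((-1) ^ (k + 1)) with h' | h' <;> rw [h, h'] at this ⊢
        · exact absurd (by decide) this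
        · decide
        · decide
        · exact absurd (by decide) this
    funext ⟨b, l⟩
    have := hk (d - 1 - l) (by omega) b
    have e : (⟨d - 1 - (d - 1 - (l : ℕ)), by omega⟩ : Fin d) = l := by ext; simp; omega
    rw [e] at this
    rw [this]
    unfold s0
    congr 1
    simp; omega

lemma fiber_card (π : Fin N ≃ ι × Fin d) (b : ι) : #{j | (π j).1 = b} = d := by
  have : ({j | (π j).1 = b} : Finset (Fin N)) = univ.image (fun l : Fin d => π.symm (b, l)) := by
    ext j
    simp only [mem_filter, mem_univ, true_and, mem_image]
    constructor
    · intro h; exact ⟨(π j).2, by rw [Equiv.symm_apply_eq, ← h]⟩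
    · rintro ⟨l, rfl⟩; simp
  rw [this, card_image_of_injective]
  · simp
  · intro l l' h; simpa using h

lemma anti_unique (π : Fin N ≃ ι × Fin d) (ha : anti π) (i : Fin N → ι) (hi : ∀ b, #{j | i j = b} = d)
    (hπ : ∀ j, (π j).1 = i j) (b : ι) (l : Fin d) :
    π.symm (b, l) = Finset.orderEmbOfFin _ (hi b) l.rev := by
  have := Finset.orderEmbOfFin_unique (hi b) (f := fun l : Fin d => π.symm (b, l.rev))
    (fun x => by simp [← hπ]) (fun x y hxy => ha b _ _ (by simpa using hxy))
  have := congrFun this l.rev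
  simpa using this

open Classical in
lemma sum_anti (hN : N = Fintype.card ι * d) (G : (Fin N → ι) → ZMod 2) :
    ∑ π : Fin N ≃ ι × Fin d with anti π, G (fun j => (π j).1) =
      ∑ i : Fin N → ι with ∀ b, #{j | i j = b} = d, G i := by
  apply Finset.sum_nbij (fun π j => (π j).1)
  · intro π hπ
    simp only [mem_filter, mem_univ, true_and]
    intro b; exact fiber_card π b
  · intro π hπ π' hπ' h
    simp only [coe_filter, mem_univ, true_and, Set.mem_setOf_eq] at hπ hπ'
    have h1 := anti_unique π hπ _ (fun b => fiber_card π b) (fun _ => rfl)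
    have h2 := anti_unique π' hπ' _ (fun b => fiber_card π b) (fun j => (congrFun h j).symm)
    have : π.symm = π'.symm := by
      ext ⟨b, l⟩; rw [h1, h2]
    rw [← Equiv.symm_symm π, this, Equiv.symm_symm]
  · intro i hi
    simp only [coe_filter, mem_univ, true_and, Set.mem_setOf_eq] at hi
    have hmem : ∀ b l, i (Finset.orderEmbOfFin _ (hi b) l) = b := by
      intro b l
      have := Finset.orderEmbOfFin_mem _ (hi b) l
      exact (mem_filter.1 this).2
    let e : ι × Fin d → Fin N := fun c => Finset.orderEmbOfFin _ (hi c.1) c.2.rev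
    have hinj : Function.Injective e := by
      rintro ⟨b, l⟩ ⟨b', l'⟩ h
      have hb : b = b' := by
        have := congrArg i h
        simpa only [e, hmem] using this
      subst hb
      simpa [e] using h
    have hbij : Function.Bijective e := by
      rw [Fintype.bijective_iff_injective_and_card]
      exact ⟨hinj, by simp [hN]⟩
    refine ⟨(Equiv.ofBijective e hbij).symm, ?_, ?_⟩
    · simp only [coe_filter, mem_univ, true_and, Set.mem_setOf_eq]
      intro b l l' hl
      simp only [Equiv.symm_symm, Equiv.ofBijective_apply, e]
      simpa using hl
    · funext j
      obtain ⟨c, rfl⟩ := hbij.2 j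
      simp [e, hmem]
  · intro π hπ; rfl

open Classical in
theorem std_eval (n : ℕ) (hn : 0 < n) (hN : N = Fintype.card ι * d) (χ : ℕ → ι → ZMod 2) :
    ∑ σ ∈ simps (ι × Fin d) N n, cup (fun j x => ∑ b, χ j b * std b x) N (vt σ) =
      ∑ i : Fin N → ι with ∀ b, #{j | i j = b} = d, ∏ j : Fin N, χ j (i j) := by
  have h1 : ∀ σ ∈ simps (ι × Fin d) N n, cup (fun j x => ∑ b, χ j b * std b x) N (vt σ) =
      (∏ j : Fin N, χ j (σ.2.2 j).1) * if σ.1 = s0 ∧ (σ.2.1 = fun _ => 0) ∧ anti σ.2.2 then 1 else 0 := by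
    intro σ _
    rw [← std_prod, ← prod_mul_distrib, cup, prod_range]
    apply prod_congr rfl
    intro j _
    rw [← sum_add_distrib]
    simp only [← mul_add]
    apply sum_eq_single_of_mem _ (mem_univ _)
    intro b _ hb
    rw [std_step_ne σ j b (Ne.symm hb), mul_zero]
  rw [sum_congr rfl h1, ← sum_anti hN (fun i => ∏ j : Fin N, χ j (i j))]
  simp only [mul_ite, mul_one, mul_zero]
  rw [← sum_filter]
  symm
  apply Finset.sum_nbij (fun π => (s0, fun _ => 0, π))
  · intro π hπ
    simp only [mem_filter, mem_univ, true_and, mem_simps] at hπ ⊢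
    simp [hn, hπ]
  · intro π _ π' _ h
    simpa using h
  · rintro ⟨s, w, π⟩ h
    simp only [coe_filter, Set.mem_setOf_eq] at h
    obtain ⟨_, rfl, rfl, ha⟩ := h
    exact ⟨π, by simpa using ha, rfl⟩
  · intro π _; rfl

open MvPolynomial in
open Classical in
lemma coeff_prod_forms (χ : ℕ → ι → ZMod 2) :
    coeff (Finsupp.equivFunOnFinite.symm fun _ => d) (∏ j ∈ range N, ∑ b, C (χ j b) * X b : MvPolynomial ι (ZMod 2)) =
      ∑ i : Fin N → ι with ∀ b, #{j | i j = b} = d, ∏ j : Fin N, χ j (i j) := by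
  rw [prod_range, Fintype.prod_sum, coeff_sum, sum_filter]
  apply sum_congr rfl
  intro i _
  rw [prod_mul_distrib, ← map_prod, coeff_C_mul]
  have : (∏ j : Fin N, X (i j) : MvPolynomial ι (ZMod 2)) = monomial (∑ j, Finsupp.single (i j) 1) 1 := by
    rw [monomial_sum_one]; rfl
  rw [this, coeff_monomial]
  have h2 : (∑ j, Finsupp.single (i j) 1 = (Finsupp.equivFunOnFinite.symm fun _ => d : ι →₀ ℕ)) ↔
      ∀ b, #{j | i j = b} = d := by
    rw [Finsupp.ext_iff]
    apply forall_congr'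
    intro b
    rw [Finsupp.finsetSum_apply]
    simp [Finsupp.single_apply]
  simp only [h2]
  simp
end Std

section Top
variable {ι : Type} [Fintype ι] [DecidableEq ι] {d N : ℕ}
open Filter Topology

open MvPolynomial in
theorem exists_simplex (n : ℕ) (hn : 0 < n) (hN : N = Fintype.card ι * d) (χ : ℕ → ι → ZMod 2)
    (hodd : coeff (Finsupp.equivFunOnFinite.symm fun _ => d)
      (∏ j ∈ range N, ∑ b, C (χ j b) * X b : MvPolynomial ι (ZMod 2)) ≠ 0)
    (F : ℕ → (ι × Fin d → ℝ) → ℝ)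
    (heq : ∀ j < N, ∀ b x, (∃ l, |x (b, l)| = 1) → (∀ c, |x c| ≤ 1) →
      F j (flipB Prod.fst b x) = if χ j b = 0 then F j x else - F j x) :
    ∃ v : ℕ → ι × Fin d → ℤ, (∀ k c, |v k c| ≤ n) ∧ (∀ k c, |v k c - v 0 c| ≤ 1) ∧
      ∀ j < N, F j (fun c => (v j c : ℝ) / n) * F j (fun c => (v (j + 1) c : ℝ) / n) ≤ 0 := by
  classical
  let Λ : ℕ → (ι × Fin d → ℤ) → ZMod 2 := fun j x =>
    if F j (fun c => (x c : ℝ) / n) < 0 then 1 else if 0 < F j (fun c => (x c : ℝ) / n) then 0 else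
      ∑ b, χ j b * std b x
  have hn' : (0 : ℝ) < n := by exact_mod_cast hn
  have hΛ : ∀ j < N, Eqv (Prod.fst : ι × Fin d → ι) n (χ j) (Λ j) := by
    rintro j hj b x hx ⟨⟨b', l⟩, rfl, hl⟩
    have h1 : (fun c => ((flipB Prod.fst b' x : ι × Fin d → ℤ) c : ℝ) / n) =
        flipB Prod.fst b' (fun c => (x c : ℝ) / n) := by
      funext c; simp only [flipB]; split_ifs
      · push_cast; ring
      · rfl
    have h2 : ∀ c, |(x c : ℝ) / n| ≤ 1 := by
      intro c
      rw [abs_div, abs_of_pos hn', div_le_one hn']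
      exact_mod_cast hx c
    have h3 : |(x (b', l) : ℝ) / n| = 1 := by
      rw [abs_div, abs_of_pos hn', div_eq_one_iff_eq hn'.ne']
      exact_mod_cast hl
    have h4 := heq j hj b' (fun c => (x c : ℝ) / n) ⟨l, h3⟩ h2
    have h5 := eqv_std n hn (χ j) b' x hx ⟨(b', l), rfl, hl⟩
    simp only [Λ, h1, h4]
    dsimp only at h5
    rw [h5]
    have hz : χ j b' = 0 ∨ χ j b' = 1 := by
      generalize χ j b' = z; revert z; decide
    rcases hz with hz | hz
    · simp [hz]
    · simp only [hz]
      rcases lt_trichotomy (F j (fun c => (x c : ℝ) / n)) 0 with h | h | h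
      · simp [h, h.le, not_lt.2 h.le]; decide
      · simp [h]
      · simp [h, not_lt.2 h.le]
  have hI := inv_all (N := N) Prod.fst χ Λ _ hΛ (fun j _ => eqv_std n hn (χ j))
  rw [std_eval n hn hN, ← coeff_prod_forms] at hI
  rw [← hI] at hodd
  obtain ⟨σ, hσ, hne⟩ := Finset.exists_ne_zero_of_sum_ne_zero hodd
  refine ⟨vt σ, fun k c => vt_abs_le σ hσ k c, ?_, ?_⟩
  · intro k c
    rw [vt_eq, vt_eq, ← mul_sub, abs_unit_mul]
    split_ifs <;> simp
  · intro j hj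
    have h1 := Finset.prod_ne_zero_iff.1 hne j (mem_range.2 hj)
    by_contra hcon
    apply h1
    push Not at hcon
    simp only [Λ]
    rcases pos_and_pos_or_neg_and_neg_of_mul_pos hcon with ⟨h, h'⟩ | ⟨h, h'⟩
    · simp [h, h', not_lt.2 h.le, not_lt.2 h'.le]
    · simp [h, h']; decide

open MvPolynomial in
theorem exists_zero (hN : N = Fintype.card ι * d) (χ : ℕ → ι → ZMod 2)
    (hodd : coeff (Finsupp.equivFunOnFinite.symm fun _ => d)
      (∏ j ∈ range N, ∑ b, C (χ j b) * X b : MvPolynomial ι (ZMod 2)) ≠ 0)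
    (F : ℕ → (ι × Fin d → ℝ) → ℝ) (hF : ∀ j < N, Continuous (F j))
    (heq : ∀ j < N, ∀ b x, (∃ l, |x (b, l)| = 1) → (∀ c, |x c| ≤ 1) →
      F j (flipB Prod.fst b x) = if χ j b = 0 then F j x else - F j x) :
    ∃ x, ∀ j < N, F j x = 0 := by
  choose v hv1 hv2 hv3 using fun n : ℕ => exists_simplex (n + 1) n.succ_pos hN χ hodd F heq
  let y : ℕ → ℕ → ι × Fin d → ℝ := fun k n c => (v n k c : ℝ) / ((n + 1 : ℕ) : ℝ)
  have hn' : ∀ n : ℕ, (0 : ℝ) < ((n + 1 : ℕ) : ℝ) := fun n => by positivity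
  have hc : IsCompact (Set.univ.pi fun _ : ι × Fin d => Set.Icc (-1 : ℝ) 1) :=
    isCompact_univ_pi fun _ => isCompact_Icc
  obtain ⟨p, -, φ, hφ, hlim⟩ := hc.tendsto_subseq (x := y 0) (by
    intro n c _
    rw [Set.mem_Icc, ← abs_le]
    simp only [y]
    rw [abs_div, abs_of_pos (hn' n), div_le_one (hn' n)]
    exact_mod_cast hv1 n 0 c)
  have hk : ∀ k, Tendsto (y k ∘ φ) atTop (𝓝 p) := by
    intro k
    rw [tendsto_pi_nhds] at hlim ⊢
    intro c
    have h0 : Tendsto (fun m => y k (φ m) c - y 0 (φ m) c) atTop (𝓝 0) := by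
      apply squeeze_zero_norm (a := fun m => 1 / (((φ m : ℕ) : ℝ) + 1))
      · intro m
        simp only [y]
        rw [← sub_div, Real.norm_eq_abs, abs_div, abs_of_pos (hn' _)]
        push_cast
        gcongr
        exact_mod_cast hv2 (φ m) k c
      · exact tendsto_one_div_add_atTop_nhds_zero_nat.comp hφ.tendsto_atTop
    have := (hlim c).add h0
    simpa using this
  refine ⟨p, fun j hj => ?_⟩
  have h1 := (((hF j hj).tendsto p).comp (hk j)).mul (((hF j hj).tendsto p).comp (hk (j + 1)))
  have h2 : F j p * F j p ≤ 0 := le_of_tendsto' h1 (fun m => hv3 (φ m) j hj)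
  nlinarith [mul_self_nonneg (F j p)]

open MvPolynomial in
/-- version for an arbitrary finite index type -/
theorem exists_zero' {J : Type} [Fintype J] (hJ : Fintype.card J = Fintype.card ι * d) (χ : J → ι → ZMod 2)
    (hodd : coeff (Finsupp.equivFunOnFinite.symm fun _ => d)
      (∏ j, ∑ b, C (χ j b) * X b : MvPolynomial ι (ZMod 2)) ≠ 0)
    (F : J → (ι × Fin d → ℝ) → ℝ) (hF : ∀ j, Continuous (F j))
    (heq : ∀ j, ∀ b x, (∃ l, |x (b, l)| = 1) → (∀ c, |x c| ≤ 1) →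
      F j (flipB Prod.fst b x) = if χ j b = 0 then F j x else - F j x) :
    ∃ x, ∀ j, F j x = 0 := by
  let e := (Fintype.equivFin J).symm
  obtain ⟨x, hx⟩ := exists_zero (ι := ι) (N := Fintype.card J) hJ
    (fun j => if h : j < Fintype.card J then χ (e ⟨j, h⟩) else 0) (by
      rw [prod_range]
      simp only [Fin.is_lt, dif_pos]
      rwa [Fintype.prod_equiv e _ (fun j => (∑ b, C (χ j b) * X b : MvPolynomial ι (ZMod 2)))]
      intro j; rfl)
    (fun j => if h : j < Fintype.card J then F (e ⟨j, h⟩) else 0)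
    (fun j hj => by simp only [hj, dif_pos]; exact hF _)
    (fun j hj => by simp only [hj, dif_pos]; exact heq _)
  refine ⟨x, fun j => ?_⟩
  have := hx (e.symm j) (e.symm j).2
  simpa using this
end Top

section Meas
open MeasureTheory RealInnerProductSpace Filter Topology
variable {d : ℕ}

def sg (r : ℝ) : ℝ := ((SignType.sign r : SignType) : ℝ)

lemma sg_neg (r : ℝ) : sg (-r) = - sg r := by
  unfold sg; rw [Left.sign_neg]; simp

lemma sg_pos {r : ℝ} (h : 0 < r) : sg r = 1 := by simp [sg, h]
lemma sg_of_neg {r : ℝ} (h : r < 0) : sg r = -1 := by simp [sg, h]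

lemma sg_cont {r : ℝ} (h : r ≠ 0) : ContinuousAt sg r := by
  have h1 : ContinuousAt SignType.sign r := continuousAt_sign_of_ne_zero h
  exact (continuous_of_discreteTopology (f := fun s : SignType => (s : ℝ))).continuousAt.comp h1

lemma sg_meas : Measurable sg := by
  have : sg = fun r => if 0 < r then 1 else if r < 0 then -1 else 0 := by
    funext r
    rcases lt_trichotomy r 0 with h | h | h
    · simp [sg_of_neg h, h, not_lt.2 h.le]
    · subst h; simp [sg]
    · simp [sg_pos h, h]
  rw [this]
  exact Measurable.ite measurableSet_Ioi measurable_const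
    (Measurable.ite measurableSet_Iio measurable_const measurable_const)

lemma sg_abs_le (r : ℝ) : |sg r| ≤ 1 := by
  rcases lt_trichotomy r 0 with h | h | h
  · simp [sg_of_neg h]
  · subst h; simp [sg]
  · simp [sg_pos h]

lemma null_hyper (a : EuclideanSpace ℝ (Fin d)) (ha : a ≠ 0) (b : ℝ) :
    volume {z : EuclideanSpace ℝ (Fin d) | ⟪a, z⟫ = b} = 0 := by
  have haa : ⟪a, a⟫ ≠ (0 : ℝ) := by rwa [Ne, inner_self_eq_zero]
  let s : AffineSubspace ℝ (EuclideanSpace ℝ (Fin d)) :=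
    AffineSubspace.mk' ((b / ⟪a, a⟫) • a) (LinearMap.ker (innerₛₗ ℝ a))
  have hs : ∀ z, z ∈ s ↔ ⟪a, z⟫ = b := by
    intro z
    simp only [s, AffineSubspace.mem_mk', vsub_eq_sub, LinearMap.mem_ker, innerₛₗ_apply_apply,
      inner_sub_right, inner_smul_right]
    rw [div_mul_cancel₀ _ haa, sub_eq_zero]
  have : {z : EuclideanSpace ℝ (Fin d) | ⟪a, z⟫ = b} = (s : Set _) := by
    ext z; exact (hs z).symm
  rw [this]
  apply Measure.addHaar_affineSubspace
  intro htop
  have h1 : ∀ z, ⟪a, z⟫ = b := fun z => (hs z).1 (by rw [htop]; trivial)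
  have h2 := h1 0
  rw [inner_zero_right] at h2
  exact haa (by rw [h1 a, ← h2])

lemma ae_ne (μ : Measure (EuclideanSpace ℝ (Fin d))) (hac : μ ≪ volume)
    (a : EuclideanSpace ℝ (Fin d)) (b : ℝ) (h : a ≠ 0 ∨ b ≠ 0) :
    ∀ᵐ z ∂μ, ⟪a, z⟫ - b ≠ 0 := by
  by_cases ha : a = 0
  · have hb : b ≠ 0 := by tauto
    subst ha
    filter_upwards with z
    simpa using hb
  · apply hac.ae_le
    change ∀ᵐ z ∂(volume : Measure (EuclideanSpace ℝ (Fin d))), ⟪a, z⟫ - b ≠ 0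
    rw [ae_iff]
    convert null_hyper a ha b using 2
    ext z; simp [sub_eq_zero]

variable {k : ℕ}

/-- the test function: integral of a product of signs. -/
def tf (μ : Measure (EuclideanSpace ℝ (Fin d))) (S : Finset (Fin k))
    (a : Fin k → EuclideanSpace ℝ (Fin d)) (b : Fin k → ℝ) : ℝ :=
  ∫ z, ∏ i ∈ S, sg (⟪a i, z⟫ - b i) ∂μ

lemma prod_meas (S : Finset (Fin k))
    (a : Fin k → EuclideanSpace ℝ (Fin d)) (b : Fin k → ℝ) :
    Measurable fun z : EuclideanSpace ℝ (Fin d) => ∏ i ∈ S, sg (⟪a i, z⟫ - b i) := by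
  apply Finset.measurable_fun_prod
  intro i _
  apply sg_meas.comp
  fun_prop

lemma prod_abs_le (S : Finset (Fin k))
    (a : Fin k → EuclideanSpace ℝ (Fin d)) (b : Fin k → ℝ) (z : EuclideanSpace ℝ (Fin d)) :
    ‖∏ i ∈ S, sg (⟪a i, z⟫ - b i)‖ ≤ 1 := by
  rw [Real.norm_eq_abs, Finset.abs_prod]
  exact Finset.prod_le_one (fun _ _ => abs_nonneg _) (fun _ _ => sg_abs_le _)

lemma prod_int (μ : Measure (EuclideanSpace ℝ (Fin d))) [IsFiniteMeasure μ] (S : Finset (Fin k))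
    (a : Fin k → EuclideanSpace ℝ (Fin d)) (b : Fin k → ℝ) :
    Integrable (fun z : EuclideanSpace ℝ (Fin d) => ∏ i ∈ S, sg (⟪a i, z⟫ - b i)) μ :=
  Integrable.of_bound (prod_meas S a b).aestronglyMeasurable 1
    (Eventually.of_forall (prod_abs_le S a b))

lemma tf_cont {X : Type} [TopologicalSpace X] [FirstCountableTopology X]
    (μ : Measure (EuclideanSpace ℝ (Fin d))) [IsFiniteMeasure μ]
    (hac : μ ≪ volume) (S : Finset (Fin k)) (a : X → Fin k → EuclideanSpace ℝ (Fin d))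
    (b : X → Fin k → ℝ) (ha : ∀ i, Continuous fun x => a x i) (hb : ∀ i, Continuous fun x => b x i)
    (hne : ∀ x i, a x i ≠ 0 ∨ b x i ≠ 0) : Continuous fun x => tf μ S (a x) (b x) := by
  rw [continuous_iff_continuousAt]
  intro x
  unfold tf
  apply continuousAt_of_dominated (bound := fun _ => 1)
  · exact Eventually.of_forall fun y => (prod_meas S _ _).aestronglyMeasurable
  · exact Eventually.of_forall fun y => Eventually.of_forall fun z => prod_abs_le S _ _ z
  · exact integrable_const _
  · have h1 : ∀ᵐ z ∂μ, ∀ i, ⟪a x i, z⟫ - b x i ≠ 0 :=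
      ae_all_iff.2 fun i => ae_ne μ hac _ _ (hne x i)
    filter_upwards [h1] with z hz
    apply tendsto_finset_prod
    intro i _
    have h2 : ContinuousAt (fun y => ⟪a y i, z⟫ - b y i) x :=
      (((ha i).inner continuous_const).sub (hb i)).continuousAt
    exact ContinuousAt.comp (f := fun y => ⟪a y i, z⟫ - b y i) (sg_cont (hz i)) h2

def eps (ε : Bool) : ℝ := if ε then 1 else -1

lemma halfSpace_meas (a : EuclideanSpace ℝ (Fin d)) (b : ℝ) (ε : Bool) :
    MeasurableSet (halfSpace a b ε) := by
  unfold halfSpace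
  split_ifs
  · exact measurableSet_le measurable_const (by fun_prop)
  · exact measurableSet_le (by fun_prop) measurable_const

lemma region_measurable (s : Finset (Fin k)) (a : Fin k → EuclideanSpace ℝ (Fin d)) (b : Fin k → ℝ)
    (ε : Fin k → Bool) : MeasurableSet (region a b s ε) := by
  unfold region
  exact Finset.measurableSet_biInter s fun i _ => halfSpace_meas _ _ _

lemma half_ind (a : EuclideanSpace ℝ (Fin d)) (b : ℝ) (ε : Bool) (z : EuclideanSpace ℝ (Fin d))
    (hz : ⟪a, z⟫ - b ≠ 0) :
    (halfSpace a b ε).indicator (fun _ => (1 : ℝ)) z = (1 + eps ε * sg (⟪a, z⟫ - b)) / 2 := by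
  unfold halfSpace eps Set.indicator
  rcases lt_or_gt_of_ne hz with h | h
  · rw [sg_of_neg h]
    cases ε
    · have : ⟪a, z⟫ ≤ b := by linarith
      simp [this]
    · have : ¬ b ≤ ⟪a, z⟫ := by intro h'; linarith
      simp [this]
  · rw [sg_pos h]
    cases ε
    · have : ¬ ⟪a, z⟫ ≤ b := by intro h'; linarith
      simp [this]
    · have : b ≤ ⟪a, z⟫ := by linarith
      simp [this]

lemma region_ind (s : Finset (Fin k)) (a : Fin k → EuclideanSpace ℝ (Fin d)) (b : Fin k → ℝ)
    (ε : Fin k → Bool) (z : EuclideanSpace ℝ (Fin d)) :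
    (region a b s ε).indicator (fun _ => (1 : ℝ)) z =
      ∏ i ∈ s, (halfSpace (a i) (b i) (ε i)).indicator (fun _ => (1 : ℝ)) z := by
  classical
  by_cases h : z ∈ region a b s ε
  · rw [Set.indicator_of_mem h]
    simp only [region, Set.mem_iInter] at h
    symm
    apply Finset.prod_eq_one
    intro i hi
    rw [Set.indicator_of_mem (h i hi)]
  · rw [Set.indicator_of_notMem h]
    simp only [region, Set.mem_iInter] at h
    push Not at h
    obtain ⟨i, hi, h⟩ := h
    symm
    apply Finset.prod_eq_zero hi
    rw [Set.indicator_of_notMem h]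

lemma region_measure (μ : Measure (EuclideanSpace ℝ (Fin d))) [IsFiniteMeasure μ]
    (hac : μ ≪ volume) (s : Finset (Fin k)) (a : Fin k → EuclideanSpace ℝ (Fin d)) (b : Fin k → ℝ)
    (hne : ∀ i ∈ s, a i ≠ 0) (hz : ∀ S ⊆ s, S.Nonempty → tf μ S a b = 0) (ε : Fin k → Bool) :
    μ (region a b s ε) = μ Set.univ / 2 ^ s.card := by
  have h1 : ∀ᵐ z ∂μ, ∀ i ∈ s, ⟪a i, z⟫ - b i ≠ 0 := by
    refine (ae_ball_iff (p := fun z i _ => ⟪a i, z⟫ - b i ≠ 0) s.countable_toSet).2 ?_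
    exact fun i hi => ae_ne μ hac _ _ (Or.inl (hne i hi))
  have h2 : ∀ᵐ z ∂μ, (region a b s ε).indicator (fun _ => (1 : ℝ)) z =
      (1 / 2) ^ s.card * ∑ S ∈ s.powerset, (∏ i ∈ S, eps (ε i)) * ∏ i ∈ S, sg (⟪a i, z⟫ - b i) := by
    filter_upwards [h1] with z hz
    rw [region_ind, Finset.prod_congr rfl (fun i hi => half_ind (a i) (b i) (ε i) z (hz i hi))]
    simp only [← Finset.prod_mul_distrib]
    rw [← Finset.prod_one_add, ← Finset.prod_const, ← Finset.prod_mul_distrib]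
    apply Finset.prod_congr rfl
    intro i _; ring
  have h3 : μ.real (region a b s ε) = (1 / 2) ^ s.card * μ.real Set.univ := by
    have e1 : ∫ z, (region a b s ε).indicator (fun _ => (1 : ℝ)) z ∂μ = μ.real (region a b s ε) :=
      integral_indicator_one (region_measurable s a b ε)
    rw [← e1, integral_congr_ae h2, integral_const_mul, integral_finset_sum]
    · rw [Finset.sum_eq_single_of_mem ∅ (by simp)]
      · simp
      · intro S hS hne
        rw [integral_const_mul]
        have := hz S (Finset.mem_powerset.1 hS) (Finset.nonempty_iff_ne_empty.2 hne)
        unfold tf at this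
        rw [this, mul_zero]
    · intro S _
      exact (prod_int μ S a b).const_mul _
  rw [← ENNReal.toReal_eq_toReal_iff' (measure_ne_top _ _) (ENNReal.div_ne_top (measure_ne_top _ _) (by simp))]
  rw [ENNReal.toReal_div]
  simp only [measureReal_def] at h3
  rw [h3]
  simp
  ring

lemma tf_single_zero (μ : Measure (EuclideanSpace ℝ (Fin d))) [IsFiniteMeasure μ]
    (a : Fin k → EuclideanSpace ℝ (Fin d)) (b : Fin k → ℝ) (i : Fin k) (ha : a i = 0) (hb : b i ≠ 0)
    (hz : tf μ {i} a b = 0) : μ = 0 := by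
  unfold tf at hz
  simp only [Finset.prod_singleton, ha, inner_zero_left, integral_const, zero_sub, sg_neg] at hz
  have : sg (b i) ≠ 0 := by
    rcases lt_or_gt_of_ne hb with h | h
    · simp [sg_of_neg h]
    · simp [sg_pos h]
  simp [this] at hz
  rwa [measureReal_eq_zero_iff, Measure.measure_univ_eq_zero] at hz

lemma tf_flip (μ : Measure (EuclideanSpace ℝ (Fin d))) (S : Finset (Fin k))
    (a a' : Fin k → EuclideanSpace ℝ (Fin d)) (b b' : Fin k → ℝ) (i : Fin k)
    (ha : a' i = - a i) (hb : b' i = - b i) (hj : ∀ j ≠ i, a' j = a j ∧ b' j = b j) :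
    tf μ S a' b' = if i ∈ S then - tf μ S a b else tf μ S a b := by
  classical
  unfold tf
  split_ifs with h
  · rw [← integral_neg]
    congr 1
    funext z
    rw [← Finset.mul_prod_erase _ _ h, ← Finset.mul_prod_erase _ _ h, ha, hb, inner_neg_left,
      show -⟪a i, z⟫ - -b i = -(⟪a i, z⟫ - b i) by ring, sg_neg, neg_mul]
    congr 2
    apply Finset.prod_congr rfl
    intro j hj'
    obtain ⟨h1, h2⟩ := hj j (Finset.ne_of_mem_erase hj')
    rw [h1, h2]
  · congr 1
    funext z
    apply Finset.prod_congr rfl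
    intro j hj'
    obtain ⟨h1, h2⟩ := hj j (fun h' => h (h' ▸ hj'))
    rw [h1, h2]
end Meas
section Alg
open MvPolynomial

abbrev Mon := ℕ × ℕ × ℕ × ℕ

abbrev RR := MvPolynomial (Fin 4) (ZMod 2)

def fs (p : Mon) : Fin 4 →₀ ℕ := Finsupp.equivFunOnFinite.symm ![p.1, p.2.1, p.2.2.1, p.2.2.2]

def mon (p : Mon) : RR := monomial (fs p) 1

def madd (p q : Mon) : Mon := (p.1 + q.1, p.2.1 + q.2.1, p.2.2.1 + q.2.2.1, p.2.2.2 + q.2.2.2)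

lemma fs_madd (p q : Mon) : fs (madd p q) = fs p + fs q := by
  ext i; fin_cases i <;> simp [fs, madd]

lemma fs_inj {p q : Mon} (h : fs p = fs q) : p = q := by
  have h0 := DFunLike.congr_fun h 0
  have h1 := DFunLike.congr_fun h 1
  have h2 := DFunLike.congr_fun h 2
  have h3 := DFunLike.congr_fun h 3
  simp [fs] at h0 h1 h2 h3
  ext <;> assumption

lemma mon_madd (p q : Mon) : mon (madd p q) = mon p * mon q := by
  simp [mon, fs_madd, monomial_mul]

def ev (L : List Mon) : RR := (L.map mon).sum

@[simp] lemma ev_nil : ev [] = 0 := rfl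
@[simp] lemma ev_cons (p : Mon) (L : List Mon) : ev (p :: L) = mon p + ev L := by simp [ev]

lemma two_zero (a : RR) : a + a = 0 := CharTwo.add_self_eq_zero a

def key (p : Mon) : ℕ := ((p.1 * 32 + p.2.1) * 32 + p.2.2.1) * 32 + p.2.2.2

def meq (p q : Mon) : Bool :=
  Nat.beq p.1 q.1 && (Nat.beq p.2.1 q.2.1 && (Nat.beq p.2.2.1 q.2.2.1 && Nat.beq p.2.2.2 q.2.2.2))

lemma meq_eq {p q : Mon} (h : meq p q = true) : p = q := by
  simp [meq] at h
  ext <;> simp [h]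

/-- merge of sorted lists, cancelling equal terms (symmetric difference) -/
def mrg : ℕ → List Mon → List Mon → List Mon
  | 0, L, M => L ++ M
  | _ + 1, [], M => M
  | _ + 1, L, [] => L
  | n + 1, p :: L, q :: M =>
    cond (meq p q) (mrg n L M)
      (cond (Nat.ble (key p) (key q)) (p :: mrg n L (q :: M)) (q :: mrg n (p :: L) M))

lemma ev_append (L M : List Mon) : ev (L ++ M) = ev L + ev M := by simp [ev]

lemma ev_mrg (n : ℕ) (L M : List Mon) : ev (mrg n L M) = ev L + ev M := by
  induction n generalizing L M with
  | zero => simp [mrg, ev_append]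
  | succ n ih =>
    cases L with
    | nil => simp [mrg]
    | cons p L =>
      cases M with
      | nil => simp [mrg]
      | cons q M =>
        simp only [mrg]
        cases h : meq p q
        · cases h' : Nat.ble (key p) (key q)
          · simp [ih]; ring
          · simp [ih]; ring
        · have := meq_eq h
          subst this
          simp only [cond_true, ih, ev_cons]
          linear_combination -two_zero (mon p)

def II (k : ℕ) : Ideal RR := Ideal.span (Set.range fun i : Fin 4 => (X i : RR) ^ k)

def good (k : ℕ) (p : Mon) : Bool :=
  Nat.blt p.1 k && (Nat.blt p.2.1 k && (Nat.blt p.2.2.1 k && Nat.blt p.2.2.2 k))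

lemma X_pow_mem {k l : ℕ} (h : k ≤ l) (i : Fin 4) : (X i : RR) ^ l ∈ II k := by
  rw [← Nat.sub_add_cancel h, pow_add]
  exact Ideal.mul_mem_left _ _ (Ideal.subset_span ⟨i, rfl⟩)

lemma mon_mem_of {k : ℕ} {p : Mon} (i : Fin 4) (h : k ≤ fs p i) : mon p ∈ II k := by
  have : mon p = monomial (fs p - Finsupp.single i k) 1 * X i ^ k := by
    rw [X_pow_eq_monomial, monomial_mul, tsub_add_cancel_of_le]
    · simp [mon]
    · simpa using h
  rw [this]
  exact Ideal.mul_mem_left _ _ (X_pow_mem le_rfl i)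

lemma mon_mem {k : ℕ} {p : Mon} (h : good k p = false) : mon p ∈ II k := by
  by_contra hc
  have h1 : ∀ i, fs p i < k := fun i => by
    by_contra h2
    exact hc (mon_mem_of i (not_lt.1 h2))
  have h10 := h1 0
  have h11 := h1 1
  have h12 := h1 2
  have h13 := h1 3
  simp [fs] at h10 h11 h12 h13
  have : good k p = true := by
    unfold good
    simp only [Bool.and_eq_true]
    refine ⟨?_, ?_, ?_, ?_⟩ <;> (rw [Nat.blt_eq]; assumption)
  simp [this] at h

lemma ev_filter (k : ℕ) (L : List Mon) : ev L - ev (L.filter (good k)) ∈ II k := by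
  induction L with
  | nil => simp
  | cons p L ih =>
    cases h : good k p
    · rw [List.filter_cons_of_neg (by simp [h]), ev_cons, add_sub_assoc]
      exact Ideal.add_mem _ (mon_mem h) ih
    · rw [List.filter_cons_of_pos (by simp [h]), ev_cons, ev_cons, add_sub_add_left_eq_sub]
      exact ih

lemma ev_map_madd (p : Mon) (L : List Mon) : ev (L.map (madd p)) = mon p * ev L := by
  induction L with
  | nil => simp
  | cons q L ih => simp [ih, mon_madd, mul_add]

def unit (i : Fin 4) : Mon :=
  match i with
  | 0 => (1, 0, 0, 0)
  | 1 => (0, 1, 0, 0)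
  | 2 => (0, 0, 1, 0)
  | 3 => (0, 0, 0, 1)

lemma mon_unit (i : Fin 4) : mon (unit i) = X i := by
  have h : fs (unit i) = Finsupp.single i 1 := by
    ext j
    fin_cases i <;> fin_cases j <;> simp [fs, unit]
  rw [mon, X, h]

def mulF (L : List Mon) : List (Fin 4) → List Mon
  | [] => []
  | i :: f => mrg 1000 (L.map (madd (unit i))) (mulF L f)

def lf (f : List (Fin 4)) : RR := (f.map X).sum

lemma ev_mulF (L : List Mon) (f : List (Fin 4)) : ev (mulF L f) = lf f * ev L := by
  induction f with
  | nil => simp [mulF, lf]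
  | cons i f ih =>
    simp only [mulF, ev_mrg, ih, ev_map_madd, mon_unit, lf, List.map_cons, List.sum_cons]
    ring

def mulAll (k : ℕ) (L : List Mon) : List (List (Fin 4)) → List Mon
  | [] => L
  | f :: fs => mulAll k ((mulF L f).filter (good k)) fs

lemma ev_mulAll (k : ℕ) (fs : List (List (Fin 4))) (L : List Mon) :
    (fs.map lf).prod * ev L - ev (mulAll k L fs) ∈ II k := by
  induction fs generalizing L with
  | nil => simp [mulAll]
  | cons f fs ih =>
    have h1 := ih ((mulF L f).filter (good k))
    have h2 := Ideal.mul_mem_left _ (fs.map lf).prod (ev_filter k (mulF L f))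
    rw [ev_mulF] at h2
    have h3 := Ideal.add_mem _ h1 h2
    simp only [mulAll, List.map_cons, List.prod_cons]
    convert h3 using 1
    ring

def dbl (L : List Mon) : List Mon := L.map fun p => madd p p

lemma ev_dbl (L : List Mon) : ev (dbl L) = ev L ^ 2 := by
  induction L with
  | nil => simp [dbl]
  | cons p L ih =>
    have : dbl (p :: L) = madd p p :: dbl L := rfl
    rw [this, ev_cons, ev_cons, ih, mon_madd, CharTwo.add_sq]
    ring

def chk (k n : ℕ) (L M : List Mon) (fs : List (List (Fin 4))) : Bool :=
  (mrg 1000 (mulAll k L fs) ((M.map (madd (n, n, n, n))).filter (good k))).isEmpty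

def xx : RR := mon (1, 1, 1, 1)

lemma xx_pow (n : ℕ) : xx ^ n = mon (n, n, n, n) := by
  induction n with
  | zero =>
    rw [pow_zero, mon]
    have : fs (0, 0, 0, 0) = 0 := by ext j; fin_cases j <;> simp [fs]
    rw [this]; rfl
  | succ n ih => rw [pow_succ, ih, xx, ← mon_madd]; rfl

lemma chk_mem {k n : ℕ} {L M : List Mon} {fs : List (List (Fin 4))} (h : chk k n L M fs = true) :
    (fs.map lf).prod * ev L - xx ^ n * ev M ∈ II k := by
  have h1 := ev_mulAll k fs L
  have h2 := ev_filter k (M.map (madd (n, n, n, n)))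
  rw [ev_map_madd, ← xx_pow] at h2
  simp only [chk, List.isEmpty_iff] at h
  have h3 := congrArg ev h
  rw [ev_mrg, ev_nil] at h3
  have h4 := Ideal.sub_mem _ h1 h2
  convert h4 using 1
  linear_combination two_zero (ev (mulAll k L fs)) - h3

def lA : List Mon := [(2, 3, 4, 5), (2, 3, 5, 4), (2, 4, 3, 5), (2, 4, 5, 3), (2, 5, 3, 4), (2, 5, 4, 3), (3, 2, 4, 5), (3, 2, 5, 4), (3, 4, 2, 5), (3, 4, 5, 2), (3, 5, 2, 4), (3, 5, 4, 2), (4, 2, 3, 5), (4, 2, 5, 3), (4, 3, 2, 5), (4, 3, 5, 2), (4, 5, 2, 3), (4, 5, 3, 2), (5, 2, 3, 4), (5, 2, 4, 3), (5, 3, 2, 4), (5, 3, 4, 2), (5, 4, 2, 3), (5, 4, 3, 2)]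

def lB : List Mon := [(5, 0, 4, 5), (5, 0, 5, 4), (5, 2, 3, 4), (5, 2, 4, 3), (5, 3, 2, 4), (5, 3, 4, 2), (5, 4, 0, 5), (5, 4, 2, 3), (5, 4, 3, 2), (5, 4, 5, 0), (5, 5, 0, 4), (5, 5, 4, 0)]

def sE : List (List (Fin 4)) := [[0], [1], [2], [3], [0, 1], [0, 2], [0, 3], [1, 2], [1, 3], [2, 3], [0, 1, 2], [0, 1, 3], [0, 2, 3], [1, 2, 3]]

def sF : List (List (Fin 4)) := [[1], [2], [3], [1, 2], [1, 3], [2, 3]]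

def EE : RR := (sE.map lf).prod
def FF : RR := (sF.map lf).prod

lemma base_mem : EE - ev lA ∈ II 6 := by
  have h : chk 6 0 [(0, 0, 0, 0)] lA sE = true := by decide +kernel
  have := chk_mem h
  have h0 : mon (0, 0, 0, 0) = 1 := by rw [← xx_pow, pow_zero]
  simpa [h0, EE] using this

lemma EA_mem : EE * ev lA ^ 2 - xx ^ 7 * ev lA ∈ II 13 := by
  have h : chk 13 7 (dbl lA) lA sE = true := by decide +kernel
  have := chk_mem h
  rwa [ev_dbl] at this

lemma EB_mem : EE * ev lB ^ 2 - xx ^ 7 * ev lB ∈ II 13 := by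
  have h : chk 13 7 (dbl lB) lB sE = true := by decide +kernel
  have := chk_mem h
  rwa [ev_dbl] at this

lemma FA_mem : FF * ev lA ^ 2 - xx ^ 5 * ev lB ∈ II 11 := by
  have h : chk 11 5 (dbl lA) lB sF = true := by decide +kernel
  have := chk_mem h
  rwa [ev_dbl] at this

lemma FB_mem : FF * ev lB ^ 2 - xx ^ 5 * ev lB ∈ II 11 := by
  have h : chk 11 5 (dbl lB) lB sF = true := by decide +kernel
  have := chk_mem h
  rwa [ev_dbl] at this

lemma II_mul {c r : RR} {k l : ℕ} (hc : ∀ i, c * X i ^ k ∈ II l) (hr : r ∈ II k) : c * r ∈ II l := by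
  induction hr using Submodule.span_induction with
  | mem x hx => obtain ⟨i, rfl⟩ := hx; exact hc i
  | zero => simp
  | add x y _ _ hx hy => rw [mul_add]; exact Ideal.add_mem _ hx hy
  | smul a x _ hx =>
    rw [smul_eq_mul, mul_left_comm]; exact Ideal.mul_mem_left _ _ hx

lemma II_sq {r : RR} {k : ℕ} (hr : r ∈ II k) : r ^ 2 ∈ II (2 * k) := by
  induction hr using Submodule.span_induction with
  | mem x hx =>
    obtain ⟨i, rfl⟩ := hx
    simp only []
    rw [← pow_mul]; exact X_pow_mem (by omega) i
  | zero => simp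
  | add x y _ _ hx hy => rw [CharTwo.add_sq]; exact Ideal.add_mem _ hx hy
  | smul a x _ hx =>
    rw [smul_eq_mul, mul_pow]; exact Ideal.mul_mem_left _ _ hx

lemma II_xx {r : RR} {k : ℕ} (n : ℕ) (hr : r ∈ II k) : xx ^ n * r ∈ II (k + n) := by
  refine II_mul (fun i => ?_) hr
  rw [xx_pow, ← mul_one (X i : RR)]
  have : mon (n, n, n, n) * (X i * 1 : RR) ^ k = monomial (fs (n, n, n, n) + Finsupp.single i k) 1 := by
    rw [mul_one, X_pow_eq_monomial, mon, monomial_mul, mul_one]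
  rw [this]
  have h2 : monomial (fs (n, n, n, n) + Finsupp.single i k) (1 : ZMod 2) =
      monomial (fs (n, n, n, n) - Finsupp.single i n) 1 * X i ^ (k + n) := by
    rw [X_pow_eq_monomial, monomial_mul, mul_one]
    have hf : fs (n, n, n, n) i = n := by fin_cases i <;> simp [fs]
    have he : fs (n, n, n, n) + Finsupp.single i k =
        fs (n, n, n, n) - Finsupp.single i n + Finsupp.single i (k + n) := by
      ext j
      by_cases hj : i = j
      · subst hj; simp [hf]; omega
      · simp [Finsupp.single_apply, hj]
    rw [he]
  rw [h2]
  exact Ideal.mul_mem_left _ _ (X_pow_mem le_rfl i)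

lemma X_dvd_EE (i : Fin 4) : (X i : RR) ∣ EE := by
  apply List.dvd_prod
  rw [List.mem_map]
  exact ⟨[i], by fin_cases i <;> decide, by simp [lf]⟩

lemma II_EE {r : RR} {k : ℕ} (hr : r ∈ II k) : EE * r ∈ II (k + 1) := by
  refine II_mul (fun i => ?_) hr
  obtain ⟨c, hc⟩ := X_dvd_EE i
  rw [hc, mul_comm (X i) c, mul_assoc, ← pow_succ']
  exact Ideal.mul_mem_left _ _ (X_pow_mem le_rfl i)

lemma II_mono {r : RR} {k l : ℕ} (h : l ≤ k) (hr : r ∈ II k) : r ∈ II l := by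
  have := II_mul (c := 1) (k := k) (l := l) (fun i => by rw [one_mul]; exact X_pow_mem h i) hr
  rwa [one_mul] at this

lemma key_ind (q : ℕ) : ∀ t n : ℕ, 1 ≤ t → t ≤ 2 ^ q → n + 5 + 2 * t = 7 * 2 ^ q →
    EE ^ (2 * 2 ^ q - t) * FF ^ (t - 1) - xx ^ n * ev lA ∈ II (n + 6) ∨
    EE ^ (2 * 2 ^ q - t) * FF ^ (t - 1) - xx ^ n * ev lB ∈ II (n + 6) := by
  induction q with
  | zero =>
    intro t n h1 h2 h3
    have ht : t = 1 := by simp at h2; omega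
    subst ht
    have hn : n = 0 := by simp at h3; omega
    subst hn
    left
    simpa using base_mem
  | succ q ih =>
    intro t n h1 h2 h3
    rw [pow_succ] at h2 h3
    obtain ⟨s, hs | hs⟩ : ∃ s, t + 1 = 2 * s ∨ t = 2 * s := ⟨(t + 1) / 2, by omega⟩
    · obtain ⟨n', hn'⟩ : ∃ n', n' + 5 + 2 * s = 7 * 2 ^ q := ⟨7 * 2 ^ q - 5 - 2 * s, by omega⟩
      have hn : n = 2 * n' + 7 := by omega
      have hP : EE ^ (2 * 2 ^ (q + 1) - t) * FF ^ (t - 1) =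
          EE * (EE ^ (2 * 2 ^ q - s) * FF ^ (s - 1)) ^ 2 := by
        have e1 : 2 * 2 ^ (q + 1) - t = (2 * 2 ^ q - s) * 2 + 1 := by rw [pow_succ]; omega
        have e2 : t - 1 = (s - 1) * 2 := by omega
        rw [e1, e2, pow_succ, pow_mul, pow_mul]; ring
      have key : ∀ L : List Mon, EE * ev L ^ 2 - xx ^ 7 * ev L ∈ II 13 →
          EE ^ (2 * 2 ^ q - s) * FF ^ (s - 1) - xx ^ n' * ev L ∈ II (n' + 6) →
          EE ^ (2 * 2 ^ (q + 1) - t) * FF ^ (t - 1) - xx ^ n * ev L ∈ II (n + 6) := by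
        intro L hL hr
        have g1 := II_EE (II_sq hr)
        have g2 := II_xx (2 * n') hL
        have g3 := Ideal.add_mem _ (II_mono (l := n + 6) (by omega) g1)
          (II_mono (l := n + 6) (by omega) g2)
        rw [hP, hn]
        rw [hn] at g3
        convert g3 using 1
        rw [CharTwo.sub_eq_add _ (xx ^ n' * ev L), CharTwo.add_sq]
        linear_combination -two_zero (EE * (xx ^ n' * ev L) ^ 2)
      rcases ih s n' (by omega) (by omega) hn' with h | h
      · exact Or.inl (key _ EA_mem h)
      · exact Or.inr (key _ EB_mem h)
    · obtain ⟨n', hn'⟩ : ∃ n', n' + 5 + 2 * s = 7 * 2 ^ q := ⟨7 * 2 ^ q - 5 - 2 * s, by omega⟩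
      have hn : n = 2 * n' + 5 := by omega
      have hP : EE ^ (2 * 2 ^ (q + 1) - t) * FF ^ (t - 1) =
          FF * (EE ^ (2 * 2 ^ q - s) * FF ^ (s - 1)) ^ 2 := by
        have e1 : 2 * 2 ^ (q + 1) - t = (2 * 2 ^ q - s) * 2 := by rw [pow_succ]; omega
        have e2 : t - 1 = (s - 1) * 2 + 1 := by omega
        rw [e1, e2, pow_succ FF, pow_mul, pow_mul]; ring
      have key : ∀ L : List Mon, FF * ev L ^ 2 - xx ^ 5 * ev lB ∈ II 11 →
          EE ^ (2 * 2 ^ q - s) * FF ^ (s - 1) - xx ^ n' * ev L ∈ II (n' + 6) →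
          EE ^ (2 * 2 ^ (q + 1) - t) * FF ^ (t - 1) - xx ^ n * ev lB ∈ II (n + 6) := by
        intro L hL hr
        have g1 := Ideal.mul_mem_left _ FF (II_sq hr)
        have g2 := II_xx (2 * n') hL
        have g3 := Ideal.add_mem _ (II_mono (l := n + 6) (by omega) g1)
          (II_mono (l := n + 6) (by omega) g2)
        rw [hP, hn]
        rw [hn] at g3
        convert g3 using 1
        rw [CharTwo.sub_eq_add _ (xx ^ n' * ev L), CharTwo.add_sq]
        linear_combination -two_zero (FF * (xx ^ n' * ev L) ^ 2)
      rcases ih s n' (by omega) (by omega) hn' with h | h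
      · exact Or.inr (key _ FA_mem h)
      · exact Or.inr (key _ FB_mem h)

lemma II_coeff {r : RR} {k : ℕ} (hr : r ∈ II k) (m : Fin 4 →₀ ℕ) (hm : ∀ i, m i < k) :
    coeff m r = 0 := by
  obtain ⟨c, rfl⟩ := Ideal.mem_span_range_iff_exists_fun.1 hr
  rw [coeff_sum]
  refine Finset.sum_eq_zero fun i _ => ?_
  rw [X_pow_eq_monomial, coeff_mul_monomial', if_neg]
  intro h
  have := h i
  simp at this
  exact absurd (hm i) (by omega)

lemma coeff_ev (m : Mon) (L : List Mon) : coeff (fs m) (ev L) = (L.count m : ZMod 2) := by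
  induction L with
  | nil => simp
  | cons p L ih =>
    rw [ev_cons, coeff_add, ih, mon, coeff_monomial, List.count_cons]
    by_cases h : p = m
    · subst h; simp [add_comm]
    · have : fs p ≠ fs m := fun h' => h (fs_inj h')
      simp [h, this]

lemma coeff_main (q t d : ℕ) (h1 : 1 ≤ t) (h2 : t ≤ 2 ^ q) (hd : d = 7 * 2 ^ q - 2 * t) :
    coeff (Finsupp.equivFunOnFinite.symm fun _ => d)
      (EE ^ (2 * 2 ^ q - t) * FF ^ (t - 1) * mon (0, 1, 2, 3)) = 1 := by
  obtain ⟨n, rfl⟩ : ∃ n, d = n + 5 := ⟨d - 5, by have := Nat.one_le_two_pow (n := q); omega⟩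
  have key : ∀ L : List Mon, (L.count (5, 4, 3, 2) : ZMod 2) = 1 →
      EE ^ (2 * 2 ^ q - t) * FF ^ (t - 1) - xx ^ n * ev L ∈ II (n + 6) →
      coeff (Finsupp.equivFunOnFinite.symm fun _ => n + 5)
        (EE ^ (2 * 2 ^ q - t) * FF ^ (t - 1) * mon (0, 1, 2, 3)) = 1 := by
    intro L hL hr
    have g := II_coeff (Ideal.mul_mem_right (mon (0, 1, 2, 3)) _ hr)
      (Finsupp.equivFunOnFinite.symm fun _ => n + 5) (fun i => by simp)
    rw [sub_mul, coeff_sub, sub_eq_zero] at g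
    rw [g, xx_pow, mul_right_comm, ← mon_madd, mul_comm]
    have e : (Finsupp.equivFunOnFinite.symm fun _ => n + 5 : Fin 4 →₀ ℕ) =
        fs (5, 4, 3, 2) + fs (madd (n, n, n, n) (0, 1, 2, 3)) := by
      ext i; fin_cases i <;> simp [fs, madd] <;> omega
    rw [e, mon, coeff_mul_monomial, coeff_ev, hL, one_mul]
  rcases key_ind q t n h1 h2 (by omega) with h | h
  · exact key _ (by decide) h
  · exact key _ (by decide) h
end Alg
section Assembly
open MvPolynomial MeasureTheory

def cfA {d : ℕ} (x : Fin 4 × Fin d → ℝ) (i : Fin 4) : EuclideanSpace ℝ (Fin d) :=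
  WithLp.toLp 2 fun l => x (i, l)

def cfB {d : ℕ} (x : Fin 4 × Fin d → ℝ) (i : Fin 4) : ℝ := 1 - ‖fun l => x (i, l)‖

lemma cf_ne {d : ℕ} (x : Fin 4 × Fin d → ℝ) (i : Fin 4) : cfA x i ≠ 0 ∨ cfB x i ≠ 0 := by
  by_cases h : cfA x i = 0
  · right
    have : (fun l => x (i, l)) = 0 := by
      funext l
      have := congrArg (fun v : EuclideanSpace ℝ (Fin d) => v l) h
      simpa [cfA] using this
    simp [cfB, this]
  · exact Or.inl h

lemma zero_of {d : ℕ} {J : Type} [Fintype J] (hJ : Fintype.card J = 4 * d)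
    (S : J → Finset (Fin 4))
    (hodd : coeff (Finsupp.equivFunOnFinite.symm fun _ => d)
      (∏ j, ∑ i ∈ S j, X i : RR) ≠ 0)
    (ν : J → Measure (EuclideanSpace ℝ (Fin d))) (hfin : ∀ j, IsFiniteMeasure (ν j))
    (hac : ∀ j, ν j ≪ volume) :
    ∃ (a : Fin 4 → EuclideanSpace ℝ (Fin d)) (b : Fin 4 → ℝ), (∀ i, a i ≠ 0 ∨ b i ≠ 0) ∧
      ∀ j, tf (ν j) (S j) a b = 0 := by
  obtain ⟨x, hx⟩ := exists_zero' (ι := Fin 4) (d := d) (J := J) (by simpa using hJ)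
    (fun j b => if b ∈ S j then 1 else 0)
    (by
      have e : ∀ j, ∑ b, C (if b ∈ S j then (1 : ZMod 2) else 0) * X b =
          (∑ i ∈ S j, X i : RR) := by
        intro j
        simp [apply_ite C, ite_mul, Finset.sum_ite_mem]
      simpa only [e] using hodd)
    (fun j x => tf (ν j) (S j) (cfA x) (cfB x))
    (fun j => by
      haveI := hfin j
      refine tf_cont (ν j) (hac j) (S j) (fun x => cfA x) (fun x => cfB x) ?_ ?_ cf_ne
      · intro i
        unfold cfA
        fun_prop
      · intro i
        unfold cfB
        fun_prop)
    (by
      intro j b x h1 h2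
      have hn : ‖fun l => x (b, l)‖ = 1 := by
        obtain ⟨l, hl⟩ := h1
        apply le_antisymm
        · rw [pi_norm_le_iff_of_nonneg zero_le_one]
          exact fun l => by simpa using h2 (b, l)
        · rw [← hl]
          exact norm_le_pi_norm (fun l => x (b, l)) l
      have hf : (fun l => flipB Prod.fst b x (b, l)) = - fun l => x (b, l) := by
        funext l; simp [flipB]
      have := tf_flip (ν j) (S j) (cfA x) (cfA (flipB Prod.fst b x)) (cfB x)
        (cfB (flipB Prod.fst b x)) b
        (by unfold cfA; rw [hf]; rfl)
        (by unfold cfB; rw [hf, norm_neg, hn]; norm_num)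
        (fun i hi => by
          have : (fun l => flipB Prod.fst b x (i, l)) = fun l => x (i, l) := by
            funext l; simp [flipB, hi]
          unfold cfA cfB; rw [this]; exact ⟨rfl, rfl⟩)
      rw [this]
      by_cases hb : b ∈ S j <;> simp [hb])
  exact ⟨cfA x, cfB x, cf_ne x, hx⟩

def sQ : List (List (Fin 4)) := [[1], [2], [2], [3], [3], [3]]

lemma sQ_prod : (sQ.map lf).prod = mon (0, 1, 2, 3) := by
  have : (sQ.map lf).prod = X 1 * X 2 * X 2 * X 3 * X 3 * X 3 := by
    simp [sQ, lf]; ring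
  rw [this]
  simp only [← mon_unit, ← mon_madd]
  rfl

lemma lf_toFinset {l : List (Fin 4)} (h : l.Nodup) : ∑ i ∈ l.toFinset, (X i : RR) = lf l := by
  rw [List.sum_toFinset _ h]; rfl

lemma prod_get (s : List (List (Fin 4))) (hs : ∀ l ∈ s, l.Nodup) :
    ∏ k : Fin s.length, ∑ i ∈ (s.get k).toFinset, (X i : RR) = (s.map lf).prod := by
  rw [← Fin.prod_univ_fun_getElem s lf]
  refine Finset.prod_congr rfl fun k _ => ?_
  exact lf_toFinset (hs _ (List.get_mem s k))

lemma cover_E : ∀ S : Finset (Fin 4), S.Nonempty → S.card ≤ 3 →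
    ∃ k : Fin sE.length, (sE.get k).toFinset = S := by decide +kernel

lemma cover_F : ∀ S : Finset (Fin 4), S.Nonempty → S.card ≤ 2 → 0 ∉ S →
    ∃ k : Fin sF.length, (sF.get k).toFinset = S := by decide +kernel

lemma main_zero (q t : ℕ) (ht1 : 1 ≤ t) (ht2 : t ≤ 2 ^ q)
    (d : ℕ) (hd : d = 7 * 2 ^ q - 2 * t)
    (μ : Fin (2 ^ (q + 1) - 1) → Measure (EuclideanSpace ℝ (Fin d)))
    (hfin : ∀ r, IsFiniteMeasure (μ r))
    (hac : ∀ r, μ r ≪ volume) :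
    ∃ (a : Fin 4 → EuclideanSpace ℝ (Fin d)) (b : Fin 4 → ℝ), (∀ i, a i ≠ 0 ∨ b i ≠ 0) ∧
      (∀ r : Fin (2 ^ (q + 1) - 1), (r : ℕ) < 2 ^ (q + 1) - t →
        ∀ S : Finset (Fin 4), S.Nonempty → S.card ≤ 3 → tf (μ r) S a b = 0) ∧
      (∀ r : Fin (2 ^ (q + 1) - 1), 2 ^ (q + 1) - t ≤ (r : ℕ) →
        ∀ S : Finset (Fin 4), S.Nonempty → S.card ≤ 2 → 0 ∉ S → tf (μ r) S a b = 0) := by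
  have hp : 2 ^ (q + 1) = 2 * 2 ^ q := by rw [pow_succ]; ring
  have hlE : sE.length = 14 := rfl
  have hlF : sF.length = 6 := rfl
  have hlQ : sQ.length = 6 := rfl
  obtain ⟨a, b, hne, hz⟩ := zero_of (d := d)
    (J := (Fin (2 * 2 ^ q - t) × Fin sE.length) ⊕ (Fin (t - 1) × Fin sF.length) ⊕ Fin sQ.length)
    (by
      simp only [Fintype.card_sum, Fintype.card_prod, Fintype.card_fin, hlE, hlF, hlQ]
      omega)
    (Sum.elim (fun p => (sE.get p.2).toFinset)
      (Sum.elim (fun p => (sF.get p.2).toFinset) (fun k => (sQ.get k).toFinset)))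
    (by
      rw [Fintype.prod_sum_type, Fintype.prod_sum_type]
      simp only [Sum.elim_inl, Sum.elim_inr]
      rw [Fintype.prod_prod_type, Fintype.prod_prod_type]
      simp only []
      rw [prod_get sE (by decide), prod_get sF (by decide), prod_get sQ (by decide), sQ_prod]
      simp only [Finset.prod_const, Finset.card_univ, Fintype.card_fin]
      have := coeff_main q t d ht1 ht2 hd
      rw [mul_assoc] at this
      unfold EE FF at this
      rw [this]
      exact one_ne_zero)
    (Sum.elim (fun p => μ ⟨p.1, by have := p.1.2; omega⟩)
      (Sum.elim (fun p => μ ⟨2 * 2 ^ q - t + p.1, by have := p.1.2; omega⟩) (fun _ => 0)))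
    (by
      rintro (p | p | p)
      · exact hfin _
      · exact hfin _
      · simp only [Sum.elim_inr]; infer_instance)
    (by
      rintro (p | p | p)
      · exact hac _
      · exact hac _
      · exact Measure.AbsolutelyContinuous.zero _)
  refine ⟨a, b, hne, ?_, ?_⟩
  · intro r hr S h1 h2
    obtain ⟨k, rfl⟩ := cover_E S h1 h2
    exact hz (Sum.inl (⟨r, by omega⟩, k))
  · intro r hr S h1 h2 h3
    obtain ⟨k, rfl⟩ := cover_F S h1 h2 h3
    have := hz (Sum.inr (Sum.inl (⟨r - (2 * 2 ^ q - t), by have := r.2; omega⟩, k)))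
    simp only [Sum.elim_inl, Sum.elim_inr] at this
    convert this using 2
    congr 1
    ext
    simp only []
    omega

lemma fix_region {d : ℕ} (μ : Measure (EuclideanSpace ℝ (Fin d))) [IsFiniteMeasure μ]
    (hac : μ ≪ volume) (a : Fin 4 → EuclideanSpace ℝ (Fin d)) (b : Fin 4 → ℝ)
    (hne : ∀ i, a i ≠ 0 ∨ b i ≠ 0) (v : EuclideanSpace ℝ (Fin d)) (s : Finset (Fin 4))
    (hz : ∀ S ⊆ s, S.Nonempty → tf μ S a b = 0) (ε : Fin 4 → Bool) :
    μ (region (fun i => if a i = 0 then v else a i) b s ε) = μ Set.univ / 2 ^ s.card := by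
  by_cases h : ∀ i ∈ s, a i ≠ 0
  · rw [← region_measure μ hac s a b h hz ε]
    congr 1
    unfold region
    refine Set.iInter₂_congr fun i hi => ?_
    simp only [if_neg (h i hi)]
  · push Not at h
    obtain ⟨i, hi, h0⟩ := h
    have := tf_single_zero μ a b i h0 ((hne i).resolve_left (by simpa using h0))
      (hz {i} (by simpa using hi) (by simp))
    subst this
    simp
end Assembly
end EqPart

theorem stmt_8 (q t : ℕ) (ht1 : 1 ≤ t) (ht2 : t ≤ 2 ^ q)
    (d : ℕ) (hd : d = 7 * 2 ^ q - 2 * t)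
    (μ : Fin (2 ^ (q + 1) - 1) → Measure (EuclideanSpace ℝ (Fin d)))
    (hfin : ∀ r, IsFiniteMeasure (μ r))
    (hac : ∀ r, μ r ≪ volume) :
    ∃ (a : Fin 4 → EuclideanSpace ℝ (Fin d)) (b : Fin 4 → ℝ),
      (∀ i, a i ≠ 0) ∧
      -- (i) any three of H₁, H₂, H₃, H₄ equipartition the first 2^(q+1) - t masses
      (∀ r : Fin (2 ^ (q + 1) - 1), (r : ℕ) < 2 ^ (q + 1) - t →
        ∀ s : Finset (Fin 4), s.card = 3 → ∀ ε : Fin 4 → Bool,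
          μ r (region a b s ε) = μ r Set.univ / 2 ^ 3) ∧
      -- (ii) any two of H₂, H₃, H₄ equipartition the remaining t - 1 masses
      (∀ r : Fin (2 ^ (q + 1) - 1), 2 ^ (q + 1) - t ≤ (r : ℕ) →
        ∀ s : Finset (Fin 4), s.card = 2 → (0 : Fin 4) ∉ s →
          ∀ ε : Fin 4 → Bool,
            μ r (region a b s ε) = μ r Set.univ / 2 ^ 2) := by
  obtain ⟨a, b, hne, h1, h2⟩ := EqPart.main_zero q t ht1 ht2 d hd μ hfin hac
  have hd0 : 0 < d := by have := Nat.one_le_two_pow (n := q); omega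
  obtain ⟨v, hv⟩ : ∃ v : EuclideanSpace ℝ (Fin d), v ≠ 0 :=
    ⟨EuclideanSpace.single ⟨0, hd0⟩ 1, by simp⟩
  refine ⟨fun i => if a i = 0 then v else a i, b, ?_, ?_, ?_⟩
  · intro i
    show (if a i = 0 then v else a i) ≠ 0
    split_ifs with h
    · exact hv
    · exact h
  · intro r hr s hs ε
    haveI := hfin r
    rw [← hs]
    exact EqPart.fix_region (μ r) (hac r) a b hne v s
      (fun S hS hS' => h1 r hr S hS' (hs ▸ Finset.card_le_card hS)) ε
  · intro r hr s hs h0 ε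
    haveI := hfin r
    rw [← hs]
    exact EqPart.fix_region (μ r) (hac r) a b hne v s
      (fun S hS hS' => h2 r hr S hS' (hs ▸ Finset.card_le_card hS) (fun h => h0 (hS h))) ε
end
end
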